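/- arXiv:2511.14867 — 2 statements merged into one kernel-verified Lean document; each statement's English description precedes it below -/
import Mathlib

section
/- Let r ≥ 3 be an integer and let G be a 2-connected non-bipartite graph with minimum degree δ(G) ≥ r and |V(G)| ≥ 2r + 1. Then G contains an even cycle of length at least 2r and an odd cycle of length at least 2r − 1. -/
open SimpleGraph

/-- A graph is bipartite if its vertex set can be partitioned into two parts with every
edge joining the two parts. -/
def IsBip {α : Type*} (G : SimpleGraph α) : Prop :=
  ∃ A : Set α, ∀ ⦃x y⦄, G.Adj x y → (x ∈ A ↔ y ∉ A)

/-- A graph is 2-connected if it has at least 3 vertices and remains connected after the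
deletion of any single vertex. -/
def TwoConnected {α : Type*} [Fintype α] (G : SimpleGraph α) : Prop :=
  3 ≤ Fintype.card α ∧ ∀ v : α, (G.induce {u | u ≠ v}).Connected

section Paths

variable {V : Type*} {G : SimpleGraph V}

/-- There is a path of length `n` from `a` to `b` all of whose vertices lie in `S`. -/
def HasPath (G : SimpleGraph V) (S : Finset V) (a b : V) (n : ℕ) : Prop :=
  ∃ p : G.Walk a b, p.IsPath ∧ p.length = n ∧ ∀ v ∈ p.support, v ∈ S

theorem HasPath.mono {S T : Finset V} {a b : V} {n : ℕ} (h : HasPath G S a b n) (hST : S ⊆ T) :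
    HasPath G T a b n := by
  obtain ⟨p, h1, h2, h3⟩ := h
  exact ⟨p, h1, h2, fun v hv => hST (h3 v hv)⟩

theorem HasPath.left_mem {S : Finset V} {a b : V} {n : ℕ} (h : HasPath G S a b n) : a ∈ S := by
  obtain ⟨p, h1, h2, h3⟩ := h
  exact h3 a p.start_mem_support

theorem HasPath.right_mem {S : Finset V} {a b : V} {n : ℕ} (h : HasPath G S a b n) : b ∈ S := by
  obtain ⟨p, h1, h2, h3⟩ := h
  exact h3 b p.end_mem_support

theorem HasPath.refl {S : Finset V} {a : V} (h : a ∈ S) : HasPath G S a a 0 :=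
  ⟨Walk.nil, by simp, rfl, by simpa using h⟩

theorem HasPath.symm {S : Finset V} {a b : V} {n : ℕ} (h : HasPath G S a b n) :
    HasPath G S b a n := by
  obtain ⟨p, h1, h2, h3⟩ := h
  exact ⟨p.reverse, h1.reverse, by simpa using h2, by simpa using h3⟩

theorem HasPath.pos {S : Finset V} {a b : V} {n : ℕ} (h : HasPath G S a b n) (hab : a ≠ b) :
    1 ≤ n := by
  obtain ⟨p, h1, h2, h3⟩ := h
  rcases Nat.eq_zero_or_pos n with h0 | h0
  · exact absurd (Walk.eq_of_length_eq_zero (h2.trans h0)) hab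
  · exact h0

theorem HasPath.cons [DecidableEq V] {S : Finset V} {a b c : V} {n : ℕ} (h : HasPath G S b c n)
    (hab : G.Adj a b) (ha : a ∉ S) : HasPath G (insert a S) a c (n + 1) := by
  obtain ⟨p, h1, h2, h3⟩ := h
  refine ⟨Walk.cons hab p, h1.cons fun h => ha (h3 a h), by simp [h2], ?_⟩
  intro v hv
  rw [Walk.support_cons, List.mem_cons] at hv
  rcases hv with rfl | hv
  · simp
  · exact Finset.mem_insert_of_mem (h3 v hv)

theorem HasPath.snoc [DecidableEq V] {S : Finset V} {a b c : V} {n : ℕ} (h : HasPath G S a b n)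
    (hbc : G.Adj b c) (hc : c ∉ S) : HasPath G (insert c S) a c (n + 1) :=
  (h.symm.cons hbc.symm hc).symm

theorem HasPath.edge [DecidableEq V] {a b : V} (h : G.Adj a b) : HasPath G {a, b} a b 1 :=
  (HasPath.refl (Finset.mem_singleton_self b)).cons h (by simpa using h.ne)

theorem HasPath.append [DecidableEq V] {S T : Finset V} {a b c : V} {n k : ℕ}
    (h : HasPath G S a b n) (h' : HasPath G T b c k) (hST : ∀ v ∈ S, v ∈ T → v = b) :
    HasPath G (S ∪ T) a c (n + k) := by
  obtain ⟨p, h1, h2, h3⟩ := h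
  obtain ⟨p', h1', h2', h3'⟩ := h'
  refine ⟨p.append p', ?_, by simp [h2, h2'], ?_⟩
  · rw [Walk.isPath_def, Walk.support_append]
    have hn' := (Walk.isPath_def p').1 h1'
    rw [← Walk.cons_tail_support] at hn'
    refine List.Nodup.append ((Walk.isPath_def p).1 h1) (List.nodup_cons.1 hn').2 ?_
    intro v hv hv'
    have : v = b := hST v (h3 v hv) (h3' v (List.mem_of_mem_tail hv'))
    subst this
    exact (List.nodup_cons.1 hn').1 hv'
  · intro v hv
    rw [Walk.mem_support_append_iff] at hv
    rcases hv with hv | hv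
    · exact Finset.mem_union_left _ (h3 v hv)
    · exact Finset.mem_union_right _ (h3' v hv)

/-- Closing a path of length at least two by an edge gives a cycle. -/
theorem HasPath.exists_cycle {S : Finset V} {a b : V} {n : ℕ} (h : HasPath G S a b n)
    (hn : 2 ≤ n) (hab : G.Adj b a) : ∃ (v : V) (c : G.Walk v v), c.IsCycle ∧ c.length = n + 1 := by
  obtain ⟨p, h1, h2, h3⟩ := h
  refine ⟨b, Walk.cons hab p, ?_, by simp [h2]⟩
  rw [Walk.isCycle_iff_isPath_tail_and_le_length]
  refine ⟨by simpa using h1, by simp; omega⟩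

/-- Removing the last edge of a path. -/
theorem HasPath.exists_snoc [DecidableEq V] {S : Finset V} {a c : V} {n : ℕ}
    (h : HasPath G S a c (n + 1)) : ∃ b, G.Adj b c ∧ HasPath G (S.erase c) a b n := by
  obtain ⟨p, h1, h2, h3⟩ := h.symm
  cases p with
  | nil => simp at h2
  | cons hcb p =>
    rename_i b
    rw [Walk.cons_isPath_iff] at h1
    refine ⟨b, hcb.symm, HasPath.symm ⟨p, h1.1, by simpa using h2, fun v hv => ?_⟩⟩
    rw [Finset.mem_erase]
    exact ⟨fun e => h1.2 (e ▸ hv), h3 v (by simp [hv])⟩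

/-- `b` is reachable from `a` inside `S`. -/
def Reach (G : SimpleGraph V) (S : Finset V) (a b : V) : Prop :=
  Relation.ReflTransGen (fun u v => G.Adj u v ∧ u ∈ S ∧ v ∈ S) a b

/-- `S` is connected in `G`. -/
def Conn (G : SimpleGraph V) (S : Finset V) : Prop :=
  ∀ a ∈ S, ∀ b ∈ S, Reach G S a b

theorem Reach.mono {S T : Finset V} {a b : V} (h : Reach G S a b) (hST : S ⊆ T) :
    Reach G T a b := by
  induction h with
  | refl => exact .refl
  | tail _ hbc ih => exact Relation.ReflTransGen.tail ih ⟨hbc.1, hST hbc.2.1, hST hbc.2.2⟩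

theorem Reach.symm {S : Finset V} {a b : V} (h : Reach G S a b) : Reach G S b a := by
  induction h with
  | refl => exact .refl
  | tail _ hbc ih => exact Relation.ReflTransGen.head ⟨hbc.1.symm, hbc.2.2, hbc.2.1⟩ ih

theorem Reach.trans {S : Finset V} {a b c : V} (h : Reach G S a b) (h' : Reach G S b c) :
    Reach G S a c :=
  Relation.ReflTransGen.trans h h'

theorem Reach.adj {S : Finset V} {a b : V} (h : G.Adj a b) (ha : a ∈ S) (hb : b ∈ S) :
    Reach G S a b :=
  Relation.ReflTransGen.single ⟨h, ha, hb⟩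

theorem Reach.hasPath [DecidableEq V] {S : Finset V} {a b : V} (h : Reach G S a b) (ha : a ∈ S) :
    ∃ n, HasPath G S a b n := by
  have : ∃ p : G.Walk a b, ∀ v ∈ p.support, v ∈ S := by
    induction h with
    | refl => exact ⟨Walk.nil, by simpa using ha⟩
    | tail _ hbc ih =>
      obtain ⟨p, hp⟩ := ih
      refine ⟨p.concat hbc.1, fun v hv => ?_⟩
      rw [Walk.support_concat, List.mem_append, List.mem_singleton] at hv
      rcases hv with hv | rfl
      · exact hp v hv
      · exact hbc.2.2
  obtain ⟨p, hp⟩ := this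
  exact ⟨_, p.bypass, p.bypass_isPath, rfl, fun v hv => hp v (p.support_bypass_subset_support hv)⟩

/-- A set closed under steps of `Reach` contains everything reachable from it. -/
theorem Reach.mem_of_closed {S : Finset V} {a b : V} (h : Reach G S a b) {P : V → Prop}
    (ha : P a) (hP : ∀ u v, P u → G.Adj u v → u ∈ S → v ∈ S → P v) : P b := by
  induction h with
  | refl => exact ha
  | tail _ hbc ih => exact hP _ _ ih hbc.1 hbc.2.1 hbc.2.2

end Paths

section Blocks

variable {V : Type*} [DecidableEq V] {G : SimpleGraph V}

/-- `S` has at least two vertices, is connected and has no cut vertex. -/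
def Block (G : SimpleGraph V) (S : Finset V) : Prop :=
  (∃ a ∈ S, ∃ b ∈ S, a ≠ b) ∧ Conn G S ∧ ∀ q, Conn G (S.erase q)

theorem Conn.exists_endBlock {R : Finset V} {c : V} (hR : Conn G R) (hc : c ∈ R)
    (hne : ∃ x ∈ R, x ≠ c) :
    ∃ (K : Finset V) (q : V), K ⊆ R ∧ K.Nonempty ∧ q ∈ R ∧ q ∉ K ∧ c ∉ K ∧
      (∀ v ∈ K, ∀ w ∈ R, G.Adj v w → w ∈ insert q K) ∧ Block G (insert q K) ∧
      Conn G (R \ K) := by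
  classical
  let Good : Finset V → V → Prop := fun K q => K ⊆ R ∧ K.Nonempty ∧ q ∈ R ∧ q ∉ K ∧ c ∉ K ∧
      (∀ v ∈ K, ∀ w ∈ R, G.Adj v w → w ∈ insert q K)
  have hex : ∃ n K q, Good K q ∧ K.card = n := by
    obtain ⟨x, hx, hxc⟩ := hne
    refine ⟨_, R.erase c, c, ⟨R.erase_subset c, ⟨x, by simp [hx, hxc]⟩, hc, by simp, by simp, ?_⟩,
      rfl⟩
    intro v _ w hw _
    rwa [Finset.insert_erase hc]
  obtain ⟨K, q, hK, hcard⟩ := Nat.find_spec hex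
  have hmin : ∀ K' q', Good K' q' → K.card ≤ K'.card := fun K' q' h' => by
    rw [hcard]
    exact Nat.find_min' hex ⟨K', q', h', rfl⟩
  obtain ⟨hKR, hKne, hq, hqK, hcK, hcl⟩ := hK
  have hcl' : ∀ u v, G.Adj u v → u ∈ R → u ∉ K → v ∈ K → u = q := by
    intro u v h hu huK hv
    have := hcl v hv u hu h.symm
    simpa [huK] using this
  have hBR : insert q K ⊆ R := Finset.insert_subset hq hKR
  have hreach : ∀ v ∈ insert q K, Reach G (insert q K) v q := by
    intro v hv
    by_cases hvq : v = q
    · subst hvq; exact .refl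
    have hvK : v ∈ K := by simpa [hvq] using hv
    have := Reach.mem_of_closed (hR v (hKR hvK) c hc)
      (P := fun u => (u ∈ K → Reach G (insert q K) v u) ∧ (u ∉ K → Reach G (insert q K) v q))
      ⟨fun _ => .refl, fun h => absurd hvK h⟩ ?_
    · exact this.2 hcK
    · intro u w hu huw huR hwR
      refine ⟨fun hw => ?_, fun hw => ?_⟩
      · by_cases huK : u ∈ K
        · exact (hu.1 huK).trans (.adj huw (by simp [huK]) (by simp [hw]))
        · have := hcl' u w huw huR huK hw
          subst this
          exact (hu.2 huK).trans (.adj huw (by simp) (by simp [hw]))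
      · by_cases huK : u ∈ K
        · have := hcl' w u huw.symm hwR hw huK
          subst this
          exact (hu.1 huK).trans (.adj huw (by simp [huK]) (by simp))
        · exact hu.2 huK
  have key : ∀ z ∈ insert q K, ∀ a ∈ (insert q K).erase z, ∀ b ∈ (insert q K).erase z,
      (z = q ∨ b = q) → Reach G ((insert q K).erase z) a b := by
    intro z hz a ha b hb hzb
    by_contra hab
    let K' := ((insert q K).erase z).filter (Reach G ((insert q K).erase z) a)
    have hmem : ∀ u, u ∈ K' ↔ u ∈ (insert q K).erase z ∧ Reach G ((insert q K).erase z) a u :=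
      fun u => Finset.mem_filter
    have hK'q : ∀ u ∈ K', u ∈ K := by
      intro u hu
      rw [hmem] at hu
      have huq : u ≠ q := by
        rcases hzb with h | h
        · rw [← h]; exact Finset.ne_of_mem_erase hu.1
        · rintro rfl; rw [h] at hab; exact hab hu.2
      simpa [huq] using Finset.mem_of_mem_erase hu.1
    have hlt : K'.card < K.card := by
      apply Finset.card_lt_card
      refine ⟨hK'q, fun h => ?_⟩
      rcases hzb with e | e
      · have hbK : b ∈ K := by
          have h1 := Finset.ne_of_mem_erase hb
          have h2 := Finset.mem_of_mem_erase hb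
          rw [e] at h1
          simpa [h1] using h2
        exact hab ((hmem b).1 (h hbK)).2
      · have hzq : z ≠ q := by
          rw [← e]; exact (Finset.ne_of_mem_erase hb).symm
        have hzK : z ∈ K := by simpa [hzq] using hz
        exact Finset.ne_of_mem_erase ((hmem z).1 (h hzK)).1 rfl
    refine absurd (hmin K' z ⟨fun u hu => hKR (hK'q u hu), ⟨a, (hmem a).2 ⟨ha, .refl⟩⟩, hBR hz,
      fun h => Finset.ne_of_mem_erase ((hmem z).1 h).1 rfl, fun h => hcK (hK'q c h), ?_⟩) (by omega)
    intro v hv w hw hvw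
    have h1 := hcl v (hK'q v hv) w hw hvw
    by_cases hwz : w = z
    · simp [hwz]
    · have h2 : w ∈ (insert q K).erase z := Finset.mem_erase.2 ⟨hwz, h1⟩
      rw [hmem] at hv
      exact Finset.mem_insert_of_mem ((hmem w).2 ⟨h2, hv.2.trans (.adj hvw hv.1 h2)⟩)
  have hconn : Conn G (insert q K) := fun a ha b hb => (hreach a ha).trans (hreach b hb).symm
  refine ⟨K, q, hKR, hKne, hq, hqK, hcK, hcl, ⟨?_, hconn, ?_⟩, ?_⟩
  · obtain ⟨x, hx⟩ := hKne
    exact ⟨x, by simp [hx], q, by simp, fun h => hqK (h ▸ hx)⟩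
  · intro z
    by_cases hz : z ∈ insert q K
    · intro a ha b hb
      by_cases hzq : z = q
      · exact key z hz a ha b hb (Or.inl hzq)
      · have hq' : q ∈ (insert q K).erase z := Finset.mem_erase.2 ⟨fun h => hzq h.symm, by simp⟩
        exact (key z hz a ha q hq' (Or.inr rfl)).trans (key z hz b hb q hq' (Or.inr rfl)).symm
    · rwa [Finset.erase_eq_of_notMem hz]
  · suffices h : ∀ v ∈ R \ K, Reach G (R \ K) c v from
      fun a ha b hb => (h a ha).symm.trans (h b hb)
    intro v hv
    rw [Finset.mem_sdiff] at hv
    have := Reach.mem_of_closed (hR c hc v hv.1)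
      (P := fun u => (u ∉ K → Reach G (R \ K) c u) ∧ (u ∈ K → Reach G (R \ K) c q))
      ⟨fun _ => .refl, fun h => absurd h hcK⟩ ?_
    · exact this.1 hv.2
    · intro u w hu huw huR hwR
      refine ⟨fun hw => ?_, fun hw => ?_⟩
      · by_cases huK : u ∈ K
        · have := hcl' w u huw.symm hwR hw huK
          subst this
          exact hu.2 huK
        · exact (hu.1 huK).trans (.adj huw (by simp [*]) (by simp [*]))
      · by_cases huK : u ∈ K
        · exact hu.2 huK
        · have := hcl' u w huw huR huK hw
          subst this
          exact hu.1 huK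

/-- Removing a vertex `x` from a block leaves an end block `D` attached at `q`. -/
theorem Block.exists_peel {S : Finset V} {x c : V} (hS : Block G S) (hx : x ∈ S) (hc : c ∈ S)
    (hxc : x ≠ c) (h3 : ∃ z ∈ S, z ≠ x ∧ z ≠ c) :
    ∃ (D : Finset V) (q y : V) (m : ℕ), Block G D ∧ D ⊆ S.erase x ∧ q ∈ D ∧ y ∈ D ∧ y ≠ q ∧
      G.Adj x y ∧ (c ∈ D → c = q) ∧
      (∀ v ∈ D, v ≠ q → ∀ w ∈ S, G.Adj v w → w ∈ D ∨ w = x) ∧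
      HasPath G (insert q (S.erase x \ D)) q c m := by
  obtain ⟨z, hz, hzx, hzc⟩ := h3
  obtain ⟨K, q, hKR, ⟨k, hk⟩, hq, hqK, hcK, hcl, hB, hRK⟩ :=
    Conn.exists_endBlock (hS.2.2 x) (c := c) (by simp [hc, hxc.symm]) ⟨z, by simp [hz, hzx], hzc⟩
  have hqS := Finset.mem_erase.1 hq
  obtain ⟨m, hp⟩ := (hRK q (by simp [hqS, hqK]) c (by simp [hc, hxc.symm, hcK])).hasPath
    (by simp [hqS, hqK])
  have hy : ∃ y ∈ K, G.Adj x y := by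
    by_contra hno
    push Not at hno
    have hkS := Finset.mem_erase.1 (hKR hk)
    have := Reach.mem_of_closed (hS.2.2 q k
      (Finset.mem_erase.2 ⟨fun h => hqK (h ▸ hk), hkS.2⟩) x
      (Finset.mem_erase.2 ⟨hqS.1.symm, hx⟩)) (P := fun u => u ∈ K) hk ?_
    · exact (Finset.mem_erase.1 (hKR this)).1 rfl
    · intro u w hu huw _ hw
      have hw' := Finset.mem_erase.1 hw
      have hwx : w ≠ x := by
        rintro rfl
        exact hno u hu huw.symm
      have := hcl u hu w (Finset.mem_erase.2 ⟨hwx, hw'.2⟩) huw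
      simpa [hw'.1] using this
  obtain ⟨y, hyK, hxy⟩ := hy
  refine ⟨insert q K, q, y, m, hB, Finset.insert_subset hq hKR, by simp, by simp [hyK],
    fun h => hqK (h ▸ hyK), hxy, ?_, ?_, hp.mono ?_⟩
  · intro h
    simpa [hcK] using h
  · intro v hv hvq w hw hvw
    by_cases hwx : w = x
    · exact Or.inr hwx
    · have hvK : v ∈ K := by simpa [hvq] using hv
      exact Or.inl (hcl v hvK w (Finset.mem_erase.2 ⟨hwx, hw⟩) hvw)
  · intro v hv
    simp only [Finset.mem_sdiff, Finset.mem_insert, not_or] at hv ⊢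
    tauto

end Blocks

section Degree

variable {V : Type*} {G : SimpleGraph V} [DecidableRel G.Adj]

/-- The number of neighbours of `v` in `D`. -/
def dg (G : SimpleGraph V) [DecidableRel G.Adj] (D : Finset V) (v : V) : ℕ :=
  (D.filter (G.Adj v)).card

theorem dg_le_card {D E : Finset V} {v : V} (h : ∀ w ∈ D, G.Adj v w → w ∈ E) :
    dg G D v ≤ E.card :=
  Finset.card_le_card fun w hw => h w (Finset.mem_filter.1 hw).1 (Finset.mem_filter.1 hw).2

end Degree

section LongPaths

variable {V : Type*} [DecidableEq V] {G : SimpleGraph V}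

theorem Block.exists_peel_path {S : Finset V} {x c : V} (hS : Block G S) (hx : x ∈ S) (hc : c ∈ S)
    (hxc : x ≠ c) (h3 : ∃ z ∈ S, z ≠ x ∧ z ≠ c) :
    ∃ (D : Finset V) (q y : V) (m : ℕ), Block G D ∧ D ⊆ S.erase x ∧ q ∈ D ∧ y ∈ D ∧ y ≠ q ∧
      G.Adj x y ∧ (c ∈ D → c = q) ∧
      (∀ v ∈ D, v ≠ q → ∀ w ∈ S, G.Adj v w → w ∈ D ∨ w = x) ∧
      (∀ v n, HasPath G D v q n → HasPath G (S.erase x) v c (n + m)) ∧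
      (∀ v n, G.Adj x v → HasPath G D v q n → HasPath G S x c (n + m + 1)) := by
  obtain ⟨D, q, y, m, hB, hDS, hq, hy, hyq, hxy, hcD, hcl, hp⟩ := hS.exists_peel hx hc hxc h3
  have h1 : ∀ v n, HasPath G D v q n → HasPath G (S.erase x) v c (n + m) := by
    intro v n h
    refine (h.append hp ?_).mono ?_
    · intro u hu hu'
      simpa [hu] using hu'
    · intro u hu
      simp only [Finset.mem_union, Finset.mem_insert, Finset.mem_sdiff] at hu
      rcases hu with hu | rfl | hu
      · exact hDS hu
      · exact hDS hq
      · exact hu.1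
  refine ⟨D, q, y, m, hB, hDS, hq, hy, hyq, hxy, hcD, hcl, h1, fun v n hxv h => ?_⟩
  have := (h1 v n h).cons hxv (by simp)
  rwa [Finset.insert_erase hx] at this

theorem Block.exists_path {D : Finset V} {x c : V} (hD : Block G D) (hx : x ∈ D) (hc : c ∈ D) :
    ∃ n, HasPath G D x c n :=
  (hD.2.1 x hx c hc).hasPath hx

variable [DecidableRel G.Adj]

theorem dg_le_dg_add {D D' E : Finset V} {v : V} (h : ∀ w ∈ D, G.Adj v w → w ∈ D' ∪ E) :
    dg G D v ≤ dg G D' v + E.card := by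
  refine (Finset.card_le_card (t := D'.filter (G.Adj v) ∪ E) ?_).trans (Finset.card_union_le _ _)
  intro w hw
  rw [Finset.mem_filter] at hw
  have := h w hw.1 hw.2
  simp only [Finset.mem_union, Finset.mem_filter] at this ⊢
  tauto

/-- Erdős–Gallai: in a block, vertices other than the end `c` having degree at least `d`,
there is a path of length at least `d` between any two vertices `x` and `c`. -/
theorem Block.exists_long_path (d : ℕ) : ∀ {D : Finset V} {x c : V}, Block G D → x ∈ D → c ∈ D →
    x ≠ c → (∀ v ∈ D, v ≠ c → d ≤ dg G D v) → ∃ n, d ≤ n ∧ HasPath G D x c n := by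
  induction d with
  | zero =>
    intro D x c hD hx hc _ _
    obtain ⟨n, hn⟩ := hD.exists_path hx hc
    exact ⟨n, Nat.zero_le _, hn⟩
  | succ d ih =>
    intro D x c hD hx hc hxc hdeg
    by_cases h3 : ∃ z ∈ D, z ≠ x ∧ z ≠ c
    · obtain ⟨D₁, q, y, m, hB, hDS, hq, hy, hyq, hxy, hcD, hcl, -, hp⟩ :=
        hD.exists_peel_path hx hc hxc h3
      obtain ⟨n, hn, hpn⟩ := ih hB hy hq hyq fun v hv hvq => by
        have h1 := hdeg v (Finset.mem_of_mem_erase (hDS hv)) fun h => hvq (h ▸ hcD (h ▸ hv))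
        have h2 : dg G D v ≤ dg G D₁ v + ({x} : Finset V).card := dg_le_dg_add fun w hw hvw => by
          simpa [or_comm] using hcl v hv hvq w hw hvw
        rw [Finset.card_singleton] at h2
        omega
      exact ⟨_, by omega, hp y n hxy hpn⟩
    · obtain ⟨n, hn⟩ := hD.exists_path hx hc
      have h1 := hdeg x hx hxc
      have h2 : dg G D x ≤ ({c} : Finset V).card := dg_le_card fun w hw hxw => by
        by_contra hwc
        exact h3 ⟨w, hw, hxw.ne', by simpa using hwc⟩
      rw [Finset.card_singleton] at h2
      exact ⟨n, by have := hn.pos hxc; omega, hn⟩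

/-- The variant in which also the degree of the start `x` is unrestricted. -/
theorem Block.exists_long_path_exceptional {d : ℕ} {D : Finset V} {x c : V} (hD : Block G D)
    (hx : x ∈ D) (hc : c ∈ D) (hxc : x ≠ c) (hdeg : ∀ v ∈ D, v ≠ x → v ≠ c → d ≤ dg G D v)
    (h3 : d ≤ 1 ∨ ∃ z ∈ D, z ≠ x ∧ z ≠ c) : ∃ n, d ≤ n ∧ HasPath G D x c n := by
  by_cases hd : d ≤ 1
  · obtain ⟨n, hn⟩ := hD.exists_path hx hc
    exact ⟨n, hd.trans (hn.pos hxc), hn⟩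
  · obtain ⟨D₁, q, y, m, hB, hDS, hq, hy, hyq, hxy, hcD, hcl, -, hp⟩ :=
      hD.exists_peel_path hx hc hxc (h3.resolve_left hd)
    obtain ⟨n, hn, hpn⟩ := hB.exists_long_path (d - 1) hy hq hyq fun v hv hvq => by
      have hv' := Finset.mem_erase.1 (hDS hv)
      have h1 := hdeg v hv'.2 hv'.1 fun h => hvq (h ▸ hcD (h ▸ hv))
      have h2 : dg G D v ≤ dg G D₁ v + ({x} : Finset V).card := dg_le_dg_add fun w hw hvw => by
        simpa [or_comm] using hcl v hv hvq w hw hvw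
      rw [Finset.card_singleton] at h2
      omega
    exact ⟨_, by omega, hp y n hxy hpn⟩

/-- Either two paths of different parity of length at least `d - 1`, or a path of length at
least `2 * d + e - 2`. -/
def LongPaths (P : ℕ → Prop) (d e : ℕ) : Prop :=
  (∃ n₁ n₂, (n₁ + n₂) % 2 = 1 ∧ d ≤ n₁ + 1 ∧ d ≤ n₂ + 1 ∧ P n₁ ∧ P n₂) ∨
    ∃ n, 2 * d + e ≤ n + 2 ∧ P n

theorem LongPaths.map {P Q : ℕ → Prop} {d e d' e' k : ℕ} (h : LongPaths P d e)
    (hPQ : ∀ n, P n → Q (n + k)) (hd : d' ≤ d + k) (he : 2 * d' + e' ≤ 2 * d + e + k) :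
    LongPaths Q d' e' := by
  rcases h with ⟨n₁, n₂, h0, h1, h2, h3, h4⟩ | ⟨n, h1, h2⟩
  · exact Or.inl ⟨n₁ + k, n₂ + k, by omega, by omega, by omega, hPQ _ h3, hPQ _ h4⟩
  · exact Or.inr ⟨n + k, by omega, hPQ _ h2⟩

/-- A degree condition in `X` on the vertices of `D`: at least `d`, and at least `d + e`
outside of the independent set `W`. -/
def DegCond (G : SimpleGraph V) [DecidableRel G.Adj] (D X : Finset V) (W : Set V) (d e : ℕ)
    (c : V) : Prop :=
  ∀ v ∈ D, v ≠ c → d ≤ dg G X v ∧ (v ∉ W → d + e ≤ dg G X v)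

theorem longPaths_aux (d : ℕ) :
    ∀ {D : Finset V} {c p x : V} {W : Set V} {e : ℕ}, e ≤ 1 → Block G D → c ∈ D → p ∉ D →
      x ∈ D → x ≠ c → G.Adj p x → DegCond G D (insert p D) W d e c →
      (∀ u ∈ W, ∀ v ∈ W, ¬ G.Adj u v) → (∀ v ∈ D, v ≠ c → v ∈ W → ¬ G.Adj p v) →
      LongPaths (fun n => ∃ n', n' + 1 = n ∧ ∃ y ∈ D, G.Adj p y ∧ HasPath G D y c n') d e := by
  induction d with
  | zero =>
    intro D c p x W e he hD hc hp hx hxc hpx _ _ _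
    obtain ⟨n, hn⟩ := hD.exists_path hx hc
    exact Or.inr ⟨n + 1, by omega, n, rfl, x, hx, hpx, hn⟩
  | succ d ih =>
    intro D c p x W e he hD hc hp hx hxc hpx hdeg hW hpW
    by_cases h3 : ∃ z ∈ D, z ≠ x ∧ z ≠ c
    swap
    · obtain ⟨n, hn⟩ := hD.exists_path hx hc
      have h1 := (hdeg x hx hxc).2 fun h => hpW x hx hxc h hpx
      have h2 : dg G (insert p D) x ≤ ({p, c} : Finset V).card := dg_le_card fun w hw hxw => by
        rw [Finset.mem_insert] at hw
        by_contra hwc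
        simp only [Finset.mem_insert, Finset.mem_singleton, not_or] at hwc
        exact h3 ⟨w, hw.resolve_left hwc.1, hxw.ne', hwc.2⟩
      have h4 := h2.trans Finset.card_le_two
      have h5 := hn.pos hxc
      exact Or.inr ⟨n + 1, by omega, n, rfl, x, hx, hpx, hn⟩
    obtain ⟨D₁, q, y, m, hB, hDS, hq, hy, hyq, hxy, hcD, hcl, hp1, hp2⟩ :=
      hD.exists_peel_path hx hc hxc h3
    have hD₁ : ∀ v ∈ D₁, v ≠ q → v ∈ D ∧ v ≠ c ∧ v ≠ x := fun v hv hvq =>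
      ⟨Finset.mem_of_mem_erase (hDS hv), fun h => hvq (h ▸ hcD (h ▸ hv)),
        Finset.ne_of_mem_erase (hDS hv)⟩
    by_cases htri : ∃ z ∈ D₁, z ≠ q ∧ G.Adj p z ∧ G.Adj x z
    · obtain ⟨z, hz, hzq, hpz, hxz⟩ := htri
      obtain ⟨n, hn, hpn⟩ := hB.exists_long_path (d - 1) hz hq hzq fun v hv hvq => by
        have h1 := (hdeg v (hD₁ v hv hvq).1 (hD₁ v hv hvq).2.1).1
        have h2 : dg G (insert p D) v ≤ dg G D₁ v + ({p, x} : Finset V).card :=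
          dg_le_dg_add fun w hw hvw => by
            rw [Finset.mem_insert] at hw
            rcases hw with rfl | hw
            · simp
            · have := hcl v hv hvq w hw hvw
              simp only [Finset.mem_union, Finset.mem_insert, Finset.mem_singleton]
              tauto
        have h4 : ({p, x} : Finset V).card ≤ 2 := Finset.card_le_two
        omega
      refine Or.inl ⟨n + m + 1, n + m + 1 + 1, by omega, by omega, by omega,
        ⟨_, rfl, z, (hD₁ z hz hzq).1, hpz, (hp1 z n hpn).mono (Finset.erase_subset _ _)⟩,
        ⟨_, rfl, x, hx, hpx, hp2 z n hxz hpn⟩⟩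
    · have hstart : ∃ y ∈ D₁, y ≠ q ∧ G.Adj x y ∧
          ∀ v ∈ D₁, v ≠ q → v ∈ {v | v ∈ W ∧ G.Adj x v} → ¬ G.Adj y v := by
        by_cases hne : ∃ y ∈ D₁, y ≠ q ∧ y ∈ W ∧ G.Adj x y
        · obtain ⟨y, hy, hyq, hyW, hxy⟩ := hne
          exact ⟨y, hy, hyq, hxy, fun v _ _ hvW => hW y hyW v hvW.1⟩
        · exact ⟨y, hy, hyq, hxy, fun v hv hvq hvW => absurd ⟨v, hv, hvq, hvW.1, hvW.2⟩ hne⟩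
      clear hxy hyq hy
      obtain ⟨y, hy, hyq, hxy, hyW⟩ := hstart
      have hdeg₁ : DegCond G D₁ D₁ {v | v ∈ W ∧ G.Adj x v} d e q := by
        intro v hv hvq
        have hvD := hD₁ v hv hvq
        have h1 := hdeg v hvD.1 hvD.2.1
        by_cases hvx : G.Adj x v
        · have h2 : dg G (insert p D) v ≤ dg G D₁ v + ({x} : Finset V).card :=
            dg_le_dg_add fun w hw hvw => by
              rw [Finset.mem_insert] at hw
              rcases hw with rfl | hw
              · exact absurd ⟨v, hv, hvq, hvw.symm, hvx⟩ htri
              · simpa [or_comm] using hcl v hv hvq w hw hvw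
          rw [Finset.card_singleton] at h2
          refine ⟨by omega, fun hvW => ?_⟩
          have := h1.2 fun h => hvW ⟨h, hvx⟩
          omega
        · have h2 : dg G (insert p D) v ≤ dg G D₁ v + ({p} : Finset V).card :=
            dg_le_dg_add fun w hw hvw => by
              rw [Finset.mem_insert] at hw
              rcases hw with rfl | hw
              · simp
              · have hwx : w ≠ x := by
                  rintro rfl
                  exact hvx hvw.symm
                exact Finset.mem_union_left _ ((hcl v hv hvq w hw hvw).resolve_right hwx)
          rw [Finset.card_singleton] at h2
          refine ⟨by omega, fun hvW => ?_⟩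
          by_cases hvW' : v ∈ W
          · have h4 : dg G (insert p D) v ≤ dg G D₁ v + (∅ : Finset V).card :=
              dg_le_dg_add fun w hw hvw => by
                rw [Finset.mem_insert] at hw
                rcases hw with rfl | hw
                · exact absurd hvw.symm (hpW v hvD.1 hvD.2.1 hvW')
                · have hwx : w ≠ x := by
                    rintro rfl
                    exact hvx hvw.symm
                  simpa [hwx] using hcl v hv hvq w hw hvw
            rw [Finset.card_empty] at h4
            omega
          · have := h1.2 hvW'
            omega
      have main : LongPaths (HasPath G D₁ y q) d e := by
        by_cases h3' : ∃ z ∈ D₁, z ≠ y ∧ z ≠ q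
        · obtain ⟨D₂, q₂, y₂, m₂, hB₂, hDS₂, hq₂, hy₂, hyq₂, hxy₂, hcD₂, hcl₂, -, hp₂⟩ :=
            hB.exists_peel_path hy hq hyq h3'
          have hD₂ : ∀ v ∈ D₂, v ≠ q₂ → v ∈ D₁ ∧ v ≠ q ∧ v ≠ y := fun v hv hvq =>
            ⟨Finset.mem_of_mem_erase (hDS₂ hv), fun h => hvq (h ▸ hcD₂ (h ▸ hv)),
              Finset.ne_of_mem_erase (hDS₂ hv)⟩
          have := ih (W := {v | v ∈ W ∧ G.Adj x v}) he hB₂ hq₂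
            (fun h => Finset.ne_of_mem_erase (hDS₂ h) rfl) hy₂ hyq₂ hxy₂ (fun v hv hvq => by
              have h1 := hdeg₁ v (hD₂ v hv hvq).1 (hD₂ v hv hvq).2.1
              have h2 : dg G D₁ v ≤ dg G (insert y D₂) v + (∅ : Finset V).card :=
                dg_le_dg_add fun w hw hvw => by
                  simpa [or_comm] using hcl₂ v hv hvq w hw hvw
              rw [Finset.card_empty] at h2
              exact ⟨h1.1.trans h2, fun h => (h1.2 h).trans h2⟩)
            (fun u hu v hv => hW u hu.1 v hv.1)
            (fun v hv hvq hvW => hyW v (hD₂ v hv hvq).1 (hD₂ v hv hvq).2.1 hvW)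
          refine this.map (k := m₂) (fun n hn => ?_) (by omega) (by omega)
          obtain ⟨n', rfl, z, hz, hyz, hn'⟩ := hn
          have := hp₂ z n' hyz hn'
          rwa [show n' + 1 + m₂ = n' + m₂ + 1 by omega]
        · obtain ⟨n, hn⟩ := hB.exists_path hy hq
          have h1 := (hdeg₁ y hy hyq).1
          have h2 : dg G D₁ y ≤ ({q} : Finset V).card := dg_le_card fun w hw hxw => by
            by_contra hwc
            exact h3' ⟨w, hw, hxw.ne', by simpa using hwc⟩
          rw [Finset.card_singleton] at h2
          have h5 := hn.pos hyq
          exact Or.inr ⟨n, by omega, hn⟩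
      refine main.map (k := m + 2) (fun n hn => ⟨n + m + 1, by omega, x, hx, hpx, hp2 y n hxy hn⟩)
        (by omega) (by omega)

/-- Long paths between two vertices of a block, the degree of the start being unrestricted. -/
theorem Block.longPaths {D : Finset V} {x c : V} {W : Set V} {d e : ℕ} (he : e ≤ 1)
    (hD : Block G D) (hx : x ∈ D) (hc : c ∈ D) (hxc : x ≠ c)
    (hdeg : ∀ v ∈ D, v ≠ x → v ≠ c → d ≤ dg G D v ∧ (v ∉ W → d + e ≤ dg G D v))
    (h3 : d ≤ 1 ∨ ∃ z ∈ D, z ≠ x ∧ z ≠ c) (hW : ∀ u ∈ W, ∀ v ∈ W, ¬ G.Adj u v)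
    (hxW : ∀ v ∈ D, v ≠ c → v ∈ W → ¬ G.Adj x v) : LongPaths (HasPath G D x c) d e := by
  by_cases h3' : ∃ z ∈ D, z ≠ x ∧ z ≠ c
  · obtain ⟨D₂, q₂, y₂, m₂, hB₂, hDS₂, hq₂, hy₂, hyq₂, hxy₂, hcD₂, hcl₂, -, hp₂⟩ :=
      hD.exists_peel_path hx hc hxc h3'
    have hD₂ : ∀ v ∈ D₂, v ≠ q₂ → v ∈ D ∧ v ≠ c ∧ v ≠ x := fun v hv hvq =>
      ⟨Finset.mem_of_mem_erase (hDS₂ hv), fun h => hvq (h ▸ hcD₂ (h ▸ hv)),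
        Finset.ne_of_mem_erase (hDS₂ hv)⟩
    have := longPaths_aux d (W := W) he hB₂ hq₂
      (fun h => Finset.ne_of_mem_erase (hDS₂ h) rfl) hy₂ hyq₂ hxy₂ (fun v hv hvq => by
        have hvD := hD₂ v hv hvq
        have h1 := hdeg v hvD.1 hvD.2.2 hvD.2.1
        have h2 : dg G D v ≤ dg G (insert x D₂) v + (∅ : Finset V).card :=
          dg_le_dg_add fun w hw hvw => by
            simpa [or_comm] using hcl₂ v hv hvq w hw hvw
        rw [Finset.card_empty] at h2
        exact ⟨h1.1.trans h2, fun h => (h1.2 h).trans h2⟩)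
      hW (fun v hv hvq hvW => hxW v (hD₂ v hv hvq).1 (hD₂ v hv hvq).2.1 hvW)
    refine this.map (k := m₂) (fun n hn => ?_) (by omega) (by omega)
    obtain ⟨n', rfl, z, hz, hyz, hn'⟩ := hn
    have := hp₂ z n' hyz hn'
    rwa [show n' + 1 + m₂ = n' + m₂ + 1 by omega]
  · obtain ⟨n, hn⟩ := hD.exists_path hx hc
    have h5 := hn.pos hxc
    have := h3.resolve_right h3'
    exact Or.inr ⟨n, by omega, hn⟩

end LongPaths

section CircularCounting

variable {m : ℕ}

/-- Elements of `A` and `A'` never lie on an arc of length less than `l` and of the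
parity of `l`. -/
def FarApart (A A' : Finset (ZMod m)) (l : ℕ) : Prop :=
  ∀ k : ℕ, 0 < k → k < m → k % 2 = l % 2 →
    (∀ i ∈ A, i + (k : ZMod m) ∈ A' → l ≤ k) ∧ (∀ i ∈ A', i + (k : ZMod m) ∈ A → l ≤ k)

theorem two_mul_half (hm : m % 2 = 1) : (2 : ZMod m) * ((m + 1) / 2 : ℕ) = 1 := by
  have : 2 * ((m + 1) / 2) = m + 1 := by omega
  have h := congrArg (Nat.cast : ℕ → ZMod m) this
  push_cast at h
  simpa using h

/-- For odd `l`, the elements of `A'` avoid long progressions of step `2` starting in `A`. -/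
theorem FarApart.notMem {A A' : Finset (ZMod m)} {l : ℕ} (hm : m % 2 = 1) (h : FarApart A A' l)
    (hl : l % 2 = 1) (hlm : l < m) {x : ZMod m} (hx : x ∈ A) {j : ℕ} (h1 : m < 2 * j + l)
    (h2 : 2 * j < m + l) : x + (j : ZMod m) * 2 ∉ A' := by
  intro hy
  rcases lt_or_gt_of_ne (show 2 * j ≠ m by omega) with hj | hj
  · have := (h (m - 2 * j) (by omega) (by omega) (by omega)).2 _ hy (by
      rw [Nat.cast_sub hj.le]
      push_cast
      rw [ZMod.natCast_self]
      rwa [show x + (j : ZMod m) * 2 + (0 - 2 * j) = x by ring])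
    omega
  · have := (h (2 * j - m) (by omega) (by omega) (by omega)).1 _ hx (by
      rw [Nat.cast_sub hj.le]
      push_cast
      rw [ZMod.natCast_self]
      rwa [show x + (2 * j - 0 : ZMod m) = x + (j : ZMod m) * 2 by ring])
    omega

theorem FarApart.symm {A A' : Finset (ZMod m)} {l : ℕ} (h : FarApart A A' l) :
    FarApart A' A l := fun k h0 hk hp => (h k h0 hk hp).symm

theorem FarApart.mono {A A' B B' : Finset (ZMod m)} {l : ℕ} (h : FarApart A A' l) (hB : B ⊆ A)
    (hB' : B' ⊆ A') : FarApart B B' l := fun k h0 hk hp =>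
  ⟨fun i hi hi' => (h k h0 hk hp).1 i (hB hi) (hB' hi'),
    fun i hi hi' => (h k h0 hk hp).2 i (hB' hi) (hB hi')⟩

/-- The union of the arithmetic progressions `x, x + d, …, x + (k - 1) * d` for `x ∈ S`. -/
def progressions (d : ZMod m) (S : Finset (ZMod m)) (k : ℕ) : Finset (ZMod m) :=
  (Finset.range k).biUnion fun j => S.image (· + (j : ZMod m) * d)

theorem mem_progressions {d : ZMod m} {S : Finset (ZMod m)} {k : ℕ} {y : ZMod m} :
    y ∈ progressions d S k ↔ ∃ j < k, ∃ x ∈ S, x + (j : ZMod m) * d = y := by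
  simp only [progressions, Finset.mem_biUnion, Finset.mem_range, Finset.mem_image]

variable [NeZero m]

theorem ZMod.exists_add_natCast {x y : ZMod m} (h : x ≠ y) : ∃ k : ℕ, 0 < k ∧ k < m ∧ x + k = y := by
  refine ⟨(y - x).val, ?_, ZMod.val_lt _, by simp⟩
  rw [Nat.pos_iff_ne_zero, Ne, ZMod.val_eq_zero, sub_eq_zero]
  exact h.symm

theorem card_add_le_card_progressions {d e : ZMod m} (hd : d * e = 1) {S : Finset (ZMod m)}
    (hS : S.Nonempty) (k : ℕ) (hu : progressions d S (k + 1) ≠ Finset.univ) :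
    S.card + k ≤ (progressions d S (k + 1)).card := by
  induction k with
  | zero =>
    rw [Nat.add_zero]
    refine Finset.card_le_card fun x hx => mem_progressions.2 ⟨0, by simp, x, hx, by simp⟩
  | succ k ih =>
    have hsub : progressions d S (k + 1) ⊆ progressions d S (k + 1 + 1) := fun y hy => by
      obtain ⟨j, hj, x, hx, h⟩ := mem_progressions.1 hy
      exact mem_progressions.2 ⟨j, by omega, x, hx, h⟩
    have h1 := ih fun h => hu (Finset.univ_subset_iff.1 (h ▸ hsub))
    have hlt : (progressions d S (k + 1)).card < (progressions d S (k + 1 + 1)).card := by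
      refine Finset.card_lt_card ⟨hsub, fun hsub' => hu ?_⟩
      obtain ⟨x₀, hx₀⟩ := hS
      have hcl : ∀ j : ℕ, x₀ + (j : ZMod m) * d ∈ progressions d S (k + 1 + 1) := by
        intro j
        induction j with
        | zero => exact mem_progressions.2 ⟨0, by omega, x₀, hx₀, by simp⟩
        | succ j ihj =>
          obtain ⟨i, hi, x, hx, h⟩ := mem_progressions.1 (hsub' ihj)
          refine mem_progressions.2 ⟨i + 1, by omega, x, hx, ?_⟩
          push_cast
          linear_combination h
      refine Finset.eq_univ_iff_forall.2 fun y => ?_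
      have := hcl ((y - x₀) * e).val
      rw [ZMod.natCast_val, ZMod.cast_id', id] at this
      rwa [show x₀ + (y - x₀) * e * d = y by linear_combination (y - x₀) * hd] at this
    omega

/-- If distinct elements of `X` and `Y` are always at circular distance at least `g`, measured in
steps of size `d`, then `X` and `Y` are small, unless they coincide. -/
theorem card_of_circular_distance {d e : ZMod m} (hd : d * e = 1) {X Y : Finset (ZMod m)} {g : ℕ}
    (hg : 2 ≤ g) (hne : ∃ x ∈ X, ∃ y ∈ Y, x ≠ y)
    (h : ∀ x ∈ X, ∀ y ∈ Y, x ≠ y → ∀ j < g, x + (j : ZMod m) * d ≠ y ∧ y + (j : ZMod m) * d ≠ x) :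
    (X = Y ∧ g * X.card ≤ m) ∨ (X ≠ Y ∧ X.card + Y.card + 2 * g ≤ m + 2) ∨
      (X.card ≠ Y.card ∧ X.card + Y.card + 2 * g ≤ m + 3) := by
  have hgm : g ≤ m := by
    obtain ⟨x, hx, y, hy, hxy⟩ := hne
    by_contra hlt
    have := (h x hx y hy hxy ((y - x) * e).val ((ZMod.val_lt _).trans (by omega))).1
    rw [ZMod.natCast_val, ZMod.cast_id', id] at this
    exact this (by linear_combination (y - x) * hd)
  have hsep : ∀ x ∈ X, ∀ y ∈ Y, x ≠ y → ∀ i < g, ∀ j < g,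
      x + (i : ZMod m) * d ≠ y + (j : ZMod m) * d := by
    intro x hx y hy hxy i hi j hj heq
    rcases le_total i j with hij | hij
    · refine (h x hx y hy hxy (j - i) (by omega)).2 ?_
      rw [Nat.cast_sub hij]
      linear_combination -heq
    · refine (h x hx y hy hxy (i - j) (by omega)).1 ?_
      rw [Nat.cast_sub hij]
      linear_combination heq
  have hZ : (progressions d (X ∩ Y) g).card = g * (X ∩ Y).card := by
    rw [progressions, Finset.card_biUnion]
    · rw [Finset.sum_congr rfl fun (j : ℕ) _ => Finset.card_image_of_injective
        (X ∩ Y) (add_left_injective ((j : ZMod m) * d))]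
      simp
    · intro i hi j hj hij
      rw [Finset.mem_coe, Finset.mem_range] at hi hj
      rw [Function.onFun, Finset.disjoint_left]
      intro a ha hb
      simp only [Finset.mem_image, Finset.mem_inter] at ha hb
      obtain ⟨x, hx, rfl⟩ := ha
      obtain ⟨y, hy, hxy⟩ := hb
      by_cases hxy' : x = y
      · subst hxy'
        have h1 : (i : ZMod m) = j := by linear_combination (-e) * hxy + (j - i : ZMod m) * hd
        rw [ZMod.natCast_eq_natCast_iff'] at h1
        rw [Nat.mod_eq_of_lt (by omega), Nat.mod_eq_of_lt (by omega)] at h1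
        exact hij h1
      · exact hsep x hx.1 y hy.2 hxy' i hi j hj hxy.symm
  have hdisj : ∀ S T : Finset (ZMod m), (∀ x ∈ S, ∀ y ∈ T, ∀ i < g, ∀ j < g,
      x + (i : ZMod m) * d ≠ y + (j : ZMod m) * d) →
      Disjoint (progressions d S g) (progressions d T g) := by
    intro S T hST
    rw [Finset.disjoint_left]
    intro a ha hb
    obtain ⟨i, hi, x, hx, h1⟩ := mem_progressions.1 ha
    obtain ⟨j, hj, y, hy, h2⟩ := mem_progressions.1 hb
    exact hST x hx y hy i hi j hj (h1.trans h2.symm)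
  have hXY := hdisj (X \ Y) (Y \ X) fun x hx y hy => by
    rw [Finset.mem_sdiff] at hx hy
    exact hsep x hx.1 y hy.1 fun he => hx.2 (he ▸ hy.1)
  have hXZ := hdisj (X \ Y) (X ∩ Y) fun x hx y hy => by
    rw [Finset.mem_sdiff] at hx
    rw [Finset.mem_inter] at hy
    exact hsep x hx.1 y hy.2 fun he => hx.2 (he ▸ hy.2)
  have hZY := hdisj (X ∩ Y) (Y \ X) fun x hx y hy => by
    rw [Finset.mem_sdiff] at hy
    rw [Finset.mem_inter] at hx
    exact hsep x hx.1 y hy.1 fun he => hy.2 (he ▸ hx.1)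
  have htot : (progressions d (X \ Y) g).card + (progressions d (X ∩ Y) g).card +
      (progressions d (Y \ X) g).card ≤ m := by
    rw [← Finset.card_union_of_disjoint hXZ, ← Finset.card_union_of_disjoint
      (Finset.disjoint_union_left.2 ⟨hXY, hZY⟩)]
    exact (Finset.card_le_univ _).trans_eq (ZMod.card m)
  have hgrow : ∀ S : Finset (ZMod m), S.Nonempty → (∃ y, y ∉ progressions d S g) →
      S.card + (g - 1) ≤ (progressions d S g).card := by
    intro S hS ⟨y, hy⟩
    have h1 := card_add_le_card_progressions hd hS (g - 1)
    rw [show g - 1 + 1 = g by omega] at h1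
    exact h1 fun hu => hy (hu ▸ Finset.mem_univ y)
  have hX : (X \ Y).Nonempty → (X \ Y).card + (g - 1) ≤ (progressions d (X \ Y) g).card := by
    intro hS
    refine hgrow _ hS ?_
    obtain ⟨-, -, y, hy, -⟩ := hne
    refine ⟨y, fun hmem => ?_⟩
    obtain ⟨j, hj, x, hx, h1⟩ := mem_progressions.1 hmem
    rw [Finset.mem_sdiff] at hx
    exact (h x hx.1 y hy (fun he => hx.2 (he ▸ hy)) j hj).1 h1
  have hY : (Y \ X).Nonempty → (Y \ X).card + (g - 1) ≤ (progressions d (Y \ X) g).card := by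
    intro hS
    refine hgrow _ hS ?_
    obtain ⟨x, hx, -⟩ := hne
    refine ⟨x, fun hmem => ?_⟩
    obtain ⟨j, hj, y, hy, h1⟩ := mem_progressions.1 hmem
    rw [Finset.mem_sdiff] at hy
    exact (h x hx y hy.1 (fun he => hy.2 (he ▸ hx)) j hj).2 h1
  have hcX := Finset.card_sdiff_add_card_inter X Y
  have hcY := Finset.card_sdiff_add_card_inter Y X
  rw [Finset.inter_comm] at hcY
  rw [hZ] at htot
  have hXpos : 1 ≤ X.card := by
    obtain ⟨x, hx, -⟩ := hne
    exact Finset.card_pos.2 ⟨x, hx⟩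
  have hYpos : 1 ≤ Y.card := by
    obtain ⟨-, -, y, hy, -⟩ := hne
    exact Finset.card_pos.2 ⟨y, hy⟩
  obtain ⟨g, rfl⟩ : ∃ g', g = g' + 2 := ⟨g - 2, by omega⟩
  rcases Finset.eq_empty_or_nonempty (X \ Y) with hX0 | hX0 <;>
    rcases Finset.eq_empty_or_nonempty (Y \ X) with hY0 | hY0
  · rw [Finset.sdiff_eq_empty_iff_subset] at hX0 hY0
    have : X = Y := hX0.antisymm hY0
    subst this
    rw [Finset.inter_self] at htot
    exact Or.inl ⟨rfl, by omega⟩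
  · have h1 := hY hY0
    have h2 := Finset.card_pos.2 hY0
    rw [hX0, Finset.card_empty] at hcX
    refine Or.inr (Or.inr ⟨by omega, ?_⟩)
    obtain ⟨c, hc⟩ : ∃ c, (X ∩ Y).card = c + 1 := ⟨(X ∩ Y).card - 1, by omega⟩
    rw [hc] at htot hcX hcY
    rw [show (g + 2) * (c + 1) = c * g + g + 2 * c + 2 by ring] at htot
    omega
  · have h1 := hX hX0
    have h2 := Finset.card_pos.2 hX0
    rw [hY0, Finset.card_empty] at hcY
    refine Or.inr (Or.inr ⟨by omega, ?_⟩)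
    obtain ⟨c, hc⟩ : ∃ c, (X ∩ Y).card = c + 1 := ⟨(X ∩ Y).card - 1, by omega⟩
    rw [hc] at htot hcX hcY
    rw [show (g + 2) * (c + 1) = c * g + g + 2 * c + 2 by ring] at htot
    omega
  · have h1 := hX hX0
    have h2 := hY hY0
    refine Or.inr (Or.inl ⟨fun he => ?_, ?_⟩)
    · rw [he, Finset.sdiff_self] at hX0
      exact Finset.not_nonempty_empty hX0
    rw [show (g + 2) * (X ∩ Y).card = g * (X ∩ Y).card + 2 * (X ∩ Y).card by ring] at htot
    omega

theorem FarApart.lt {A A' : Finset (ZMod m)} {l : ℕ} (hm : m % 2 = 1) (h : FarApart A A' l)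
    {x y : ZMod m} (hx : x ∈ A) (hy : y ∈ A') (hxy : x ≠ y) : l < m := by
  obtain ⟨k, hk0, hkm, rfl⟩ := ZMod.exists_add_natCast hxy
  by_cases hp : k % 2 = l % 2
  · have := (h k hk0 hkm hp).1 x hx hy
    omega
  · have := (h (m - k) (by omega) (by omega) (by omega)).2 _ hy (by
      rw [Nat.cast_sub hkm.le]; simpa using hx)
    omega

theorem FarApart.card_odd {A A' : Finset (ZMod m)} {l : ℕ} (hm : m % 2 = 1) (h : FarApart A A' l)
    (hl : l % 2 = 1) (hl3 : 3 ≤ l) (hne : ∃ x ∈ A, ∃ y ∈ A', x ≠ y) :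
    (progressions 2 A (l - 1)).card + A'.card ≤ m ∧ A.card + A'.card + l ≤ m + 2 := by
  obtain ⟨x, hx, y, hy, hxy⟩ := hne
  have hlm := h.lt hm hx hy hxy
  set s : ZMod m := (((m - l) / 2 + 1 : ℕ) : ZMod m) * 2 with hs
  have hdisj : Disjoint ((progressions 2 A (l - 1)).image (· + s)) A' := by
    rw [Finset.disjoint_left]
    intro z hz hz'
    rw [Finset.mem_image] at hz
    obtain ⟨w, hw, rfl⟩ := hz
    obtain ⟨j, hj, a, ha, rfl⟩ := mem_progressions.1 hw
    refine h.notMem hm hl hlm ha (j := j + ((m - l) / 2 + 1)) (by omega) (by omega) ?_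
    rw [hs] at hz'
    push_cast at hz' ⊢
    rwa [add_mul, ← add_assoc]
  have h1 := Finset.card_union_of_disjoint hdisj
  rw [Finset.card_image_of_injective _ (add_left_injective s)] at h1
  have h2 := (Finset.card_le_univ ((progressions 2 A (l - 1)).image (· + s) ∪ A')).trans_eq
    (ZMod.card m)
  have hpos := Finset.card_pos.2 ⟨y, hy⟩
  have h3 := card_add_le_card_progressions (two_mul_half hm) ⟨x, hx⟩ (l - 2)
  rw [show l - 2 + 1 = l - 1 by omega] at h3
  have h4 := h3 fun hu => by
    have h5 : (progressions 2 A (l - 1)).card = m := by rw [hu, Finset.card_univ, ZMod.card]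
    omega
  omega

theorem FarApart.dist_even {A A' : Finset (ZMod m)} {g : ℕ} (hm : m % 2 = 1)
    (h : FarApart A A' (2 * g)) {x y : ZMod m} (hx : x ∈ A) (hy : y ∈ A') (hxy : x ≠ y)
    {j : ℕ} (hj : j < g) : x + (j : ZMod m) * 2 ≠ y ∧ y + (j : ZMod m) * 2 ≠ x := by
  have hlm := h.lt hm hx hy hxy
  have hcast : (j : ZMod m) * 2 = ((2 * j : ℕ) : ZMod m) := by push_cast; ring
  rcases Nat.eq_zero_or_pos j with rfl | hj0
  · simpa using ⟨hxy, hxy.symm⟩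
  · rw [hcast]
    have := h (2 * j) (by omega) (by omega) (by omega)
    refine ⟨fun he => ?_, fun he => ?_⟩
    · have := this.1 x hx (he ▸ hy); omega
    · have := this.2 y hy (he ▸ hx); omega

theorem FarApart.card {A A' : Finset (ZMod m)} {l : ℕ} (hm : m % 2 = 1) (h : FarApart A A' l)
    (hl : 3 ≤ l) (hne : ∃ x ∈ A, ∃ y ∈ A', x ≠ y) :
    A.card + A'.card + l ≤ m + 2 ∨ (A = A' ∧ l % 2 = 0 ∧ l * A.card ≤ 2 * m) ∨
      (A.card ≠ A'.card ∧ l % 2 = 0 ∧ A.card + A'.card + l ≤ m + 3) := by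
  rcases Nat.mod_two_eq_zero_or_one l with hp | hp
  · obtain ⟨g, rfl⟩ : ∃ g, l = 2 * g := ⟨l / 2, by omega⟩
    rcases card_of_circular_distance (g := g) (two_mul_half hm) (by omega) hne
      (fun x hx y hy hxy j hj => h.dist_even hm hx hy hxy hj) with ⟨h1, h2⟩ | ⟨-, h1⟩ | ⟨h1, h2⟩
    · exact Or.inr (Or.inl ⟨h1, hp, by rw [mul_assoc]; omega⟩)
    · exact Or.inl h1
    · exact Or.inr (Or.inr ⟨h1, hp, h2⟩)
  · exact Or.inl (h.card_odd hm hp hl hne).2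

theorem FarApart.dist_both {A A' : Finset (ZMod m)} {l l' g : ℕ} (hm : m % 2 = 1)
    (h : FarApart A A' l) (h' : FarApart A A' l') (hp : (l + l') % 2 = 1) (hg : g ≤ l)
    (hg' : g ≤ l') {x y : ZMod m} (hx : x ∈ A) (hy : y ∈ A') (hxy : x ≠ y)
    {j : ℕ} (hj : j < g) : x + (j : ZMod m) ≠ y ∧ y + (j : ZMod m) ≠ x := by
  have hlm := h.lt hm hx hy hxy
  rcases Nat.eq_zero_or_pos j with rfl | hj0
  · simpa using ⟨hxy, hxy.symm⟩
  · by_cases hq : j % 2 = l % 2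
    · have := h j hj0 (by omega) hq
      refine ⟨fun he => ?_, fun he => ?_⟩
      · have := this.1 x hx (he ▸ hy); omega
      · have := this.2 y hy (he ▸ hx); omega
    · have := h' j hj0 (by omega) (by omega)
      refine ⟨fun he => ?_, fun he => ?_⟩
      · have := this.1 x hx (he ▸ hy); omega
      · have := this.2 y hy (he ▸ hx); omega

theorem FarApart.card_both {A A' : Finset (ZMod m)} {l l' g : ℕ} (hm : m % 2 = 1)
    (h : FarApart A A' l) (h' : FarApart A A' l') (hp : (l + l') % 2 = 1) (hg2 : 2 ≤ g)
    (hg : g ≤ l) (hg' : g ≤ l') (hne : ∃ x ∈ A, ∃ y ∈ A', x ≠ y) :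
    (A ≠ A' ∧ A.card + A'.card + 2 * g ≤ m + 3) ∨ (A = A' ∧ g * A.card ≤ m) := by
  rcases card_of_circular_distance (d := 1) (e := 1) (by simp) hg2 hne
      (fun x hx y hy hxy j hj => by
        simpa using h.dist_both hm h' hp hg hg' hx hy hxy hj) with h1 | ⟨h0, h1⟩ | ⟨h0, h1⟩
  · exact Or.inr h1
  · exact Or.inl ⟨h0, by omega⟩
  · exact Or.inl ⟨fun he => h0 (he ▸ rfl), h1⟩

/-- For a pair of distinct elements, the two arcs between them yield a lower bound for `m`. -/
theorem FarApart.add_le {A A' : Finset (ZMod m)} {l l' : ℕ} (hm : m % 2 = 1)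
    (h : FarApart A A' l) (h' : FarApart A A' l') (hp : (l + l') % 2 = 1)
    (hne : ∃ x ∈ A, ∃ y ∈ A', x ≠ y) : l + l' ≤ m := by
  obtain ⟨x, hx, y, hy, hxy⟩ := hne
  obtain ⟨k, hk0, hkm, rfl⟩ := ZMod.exists_add_natCast hxy
  have hback : x + (k : ZMod m) + ((m - k : ℕ) : ZMod m) ∈ A := by
    rw [Nat.cast_sub hkm.le]; simpa using hx
  by_cases hq : k % 2 = l % 2
  · have h1 := (h k hk0 hkm hq).1 x hx hy
    have h2 := (h' (m - k) (by omega) (by omega) (by omega)).2 _ hy hback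
    omega
  · have h1 := (h' k hk0 hkm (by omega)).1 x hx hy
    have h2 := (h (m - k) (by omega) (by omega) (by omega)).2 _ hy hback
    omega

theorem card_add_two_le_card_progressions (hm : m % 2 = 1) {X : Finset (ZMod m)} {y : ZMod m}
    (hX : 2 ≤ X.card) (hXm : 2 * X.card < m)
    (h1 : y + 2 ∉ X) (h2 : y - 2 ∉ X)
    (hmid : ∀ j : ℕ, X.card ≤ j → j + X.card ≤ m → y + (j : ZMod m) * 2 ∉ X) :
    X.card + 2 ≤ (progressions 2 X 2).card := by
  set s := X.card with hs
  let P := (Finset.range m).filter fun p => y + ((p : ℕ) : ZMod m) * 2 ∈ X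
  have hP : ∀ p : ℕ, p ∈ P ↔ p < m ∧ y + (p : ZMod m) * 2 ∈ X := fun p => by
    simp [P]
  have hsP : s ≤ P.card := by
    refine (Finset.card_le_card (t := P.image fun p => y + ((p : ℕ) : ZMod m) * 2) ?_).trans
      Finset.card_image_le
    intro x hx
    rw [Finset.mem_image]
    have : y + (((x - y) * ((m + 1) / 2 : ℕ) : ZMod m).val : ZMod m) * 2 = x := by
      rw [ZMod.natCast_val, ZMod.cast_id', id]
      linear_combination (x - y) * two_mul_half hm
    exact ⟨_, (hP _).2 ⟨ZMod.val_lt _, this.symm ▸ hx⟩, this⟩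
  have hP1 : 1 ∉ P := fun h => h1 (by simpa using ((hP _).1 h).2)
  have hPm : m - 1 ∉ P := fun h => h2 (by
    have := ((hP _).1 h).2
    rw [Nat.cast_sub (by omega)] at this
    rw [ZMod.natCast_self] at this
    rwa [show y - 2 = y + (0 - (1 : ℕ) : ZMod m) * 2 by push_cast; ring])
  have hPmid : ∀ p ∈ P, s ≤ p → m < p + s := fun p hp hsp => by
    by_contra hlt
    exact hmid p hsp (by omega) ((hP p).1 hp).2
  have hinj : ∀ p q : ℕ, p < m → q < m → y + (p : ZMod m) * 2 = y + (q : ZMod m) * 2 → p = q := by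
    intro p q hp hq h
    have h1 : (p : ZMod m) = q := by
      linear_combination ((m + 1) / 2 : ℕ) * h - ((p : ZMod m) - q) * two_mul_half hm
    rwa [ZMod.natCast_eq_natCast_iff', Nat.mod_eq_of_lt hp, Nat.mod_eq_of_lt hq] at h1
  have hlow : (P.filter (· < s)).Nonempty := by
    by_contra hne
    rw [Finset.not_nonempty_iff_eq_empty, Finset.filter_eq_empty_iff] at hne
    have : P ⊆ Finset.Ico (m - s + 1) (m - 1) := fun p hp => by
      have h3 := hne hp
      have h4 := hPmid p hp (by omega)
      have h5 := ((hP p).1 hp).1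
      have h6 : p ≠ m - 1 := fun h => hPm (h ▸ hp)
      rw [Finset.mem_Ico]
      omega
    have := Finset.card_le_card this
    rw [Nat.card_Ico] at this
    omega
  have hhigh : (P.filter (s ≤ ·)).Nonempty := by
    by_contra hne
    rw [Finset.not_nonempty_iff_eq_empty, Finset.filter_eq_empty_iff] at hne
    have : P ⊆ (Finset.range s).erase 1 := fun p hp => by
      have h3 := hne hp
      have h6 : p ≠ 1 := fun h => hP1 (h ▸ hp)
      rw [Finset.mem_erase, Finset.mem_range]
      omega
    have := Finset.card_le_card this
    rw [Finset.card_erase_of_mem (Finset.mem_range.2 (by omega)), Finset.card_range] at this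
    omega
  obtain ⟨p, hp, hpmax⟩ := Finset.exists_max_image _ id hlow
  obtain ⟨q, hq, hqmax⟩ := Finset.exists_max_image _ id hhigh
  rw [Finset.mem_filter] at hp hq
  have hpX := (hP p).1 hp.1
  have hqX := (hP q).1 hq.1
  have hp1 : p + 1 ∉ P := fun h => by
    by_cases hps : p + 1 < s
    · have := hpmax (p + 1) (Finset.mem_filter.2 ⟨h, hps⟩)
      simp at this
    · have := hPmid _ h (by omega)
      omega
  have hq1 : q + 1 ∉ P := fun h => by
    have := hqmax (q + 1) (Finset.mem_filter.2 ⟨h, by omega⟩)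
    simp at this
  have hqm : q ≠ m - 1 := fun h => hPm (h ▸ hq.1)
  have hnot : ∀ p : ℕ, p + 1 < m → p + 1 ∉ P → y + (p : ZMod m) * 2 + 2 ∉ X := by
    intro p hpm hp hX
    refine hp ((hP _).2 ⟨hpm, ?_⟩)
    push_cast
    rwa [add_mul, one_mul, ← add_assoc]
  have hpn := hnot p (by omega) hp1
  have hqn := hnot q (by omega) hq1
  have hpq : y + (p : ZMod m) * 2 + 2 ≠ y + (q : ZMod m) * 2 + 2 := fun h => by
    have := hinj p q hpX.1 hqX.1 (add_right_cancel h)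
    omega
  have hsub : insert (y + (p : ZMod m) * 2 + 2) (insert (y + (q : ZMod m) * 2 + 2) X) ⊆
      progressions 2 X 2 := by
    intro x hx
    rw [Finset.mem_insert, Finset.mem_insert] at hx
    rw [mem_progressions]
    rcases hx with rfl | rfl | hx
    · exact ⟨1, by omega, _, hpX.2, by simp⟩
    · exact ⟨1, by omega, _, hqX.2, by simp⟩
    · exact ⟨0, by omega, x, hx, by simp⟩
  have := Finset.card_le_card hsub
  rwa [Finset.card_insert_of_notMem, Finset.card_insert_of_notMem hqn] at this
  rw [Finset.mem_insert, not_or]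
  exact ⟨hpq, hpn⟩

theorem FarApart.lt_of_card_eq {A A' : Finset (ZMod m)} {l g : ℕ} (hm : m % 2 = 1)
    (h : FarApart A A' l) (hl : l % 2 = 1) (hl4 : 4 ≤ l) (h' : FarApart A A' (2 * g))
    (hg : 2 ≤ g) (hA : 2 ≤ A.card) (hAA' : A'.card = A.card) : 2 * A.card + l < m + 2 := by
  have hne : ∃ x ∈ A, ∃ y ∈ A', x ≠ y := by
    obtain ⟨y, hy⟩ := Finset.card_pos.1 (show 0 < A'.card by omega)
    obtain ⟨x, hx, hxy⟩ := Finset.exists_mem_ne (s := A) (by omega) y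
    exact ⟨x, hx, y, hy, hxy⟩
  obtain ⟨h1, h2⟩ := h.card_odd hm hl (by omega) hne
  by_contra hlt
  obtain ⟨x, hx, y, hy, hxy⟩ := hne
  have hlm := h.lt hm hx hy hxy
  have hm2 : m ≠ 2 := by omega
  have h20 : (2 : ZMod m) ≠ 0 := fun h => by
    have h3 : ((2 : ℕ) : ZMod m) = 0 := by simpa using h
    rw [ZMod.natCast_eq_zero_iff] at h3
    have := Nat.le_of_dvd (by omega) h3
    omega
  have h3 : A.card + 2 ≤ (progressions 2 A 2).card := by
    refine card_add_two_le_card_progressions hm (y := y) hA (by omega) ?_ ?_ ?_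
    · intro hmem
      refine (h'.dist_even hm hmem hy ?_ (j := 1) (by omega)).2 (by simp)
      simpa using h20
    · intro hmem
      refine (h'.dist_even hm hmem hy ?_ (j := 1) (by omega)).1 (by simp)
      simpa using h20
    · intro j h4 h5
      exact h.symm.notMem hm hl hlm hy (by omega) (by omega)
  have hsub : progressions 2 (progressions 2 A 2) (l - 2) ⊆ progressions 2 A (l - 1) := by
    intro z hz
    obtain ⟨j, hj, w, hw, rfl⟩ := mem_progressions.1 hz
    obtain ⟨i, hi, a, ha, rfl⟩ := mem_progressions.1 hw
    refine mem_progressions.2 ⟨i + j, by omega, a, ha, ?_⟩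
    push_cast
    ring
  have h4 := Finset.card_le_card hsub
  have h5 := card_add_le_card_progressions (two_mul_half hm)
    (S := progressions 2 A 2) (Finset.card_pos.1 (by omega)) (l - 3)
  rw [show l - 3 + 1 = l - 2 by omega] at h5
  have h6 := h5 fun hu => by
    have h7 : (progressions 2 (progressions 2 A 2) (l - 2)).card = m := by
      rw [hu, Finset.card_univ, ZMod.card]
    omega
  omega

end CircularCounting

section Core

set_option linter.unusedSectionVars false

variable {V : Type*} [Fintype V] [DecidableEq V] {G : SimpleGraph V} [DecidableRel G.Adj]
  {m : ℕ} [NeZero m] {f : ZMod m → V} {r κ : ℕ} {H : Finset V}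

/-- The positions on the cycle `f` of the neighbours of `v`. -/
def att (G : SimpleGraph V) [DecidableRel G.Adj] (f : ZMod m → V) (v : V) : Finset (ZMod m) :=
  Finset.univ.filter fun i => G.Adj v (f i)

theorem mem_att {v : V} {i : ZMod m} : i ∈ att G f v ↔ G.Adj v (f i) := by simp [att]

/-- A cycle `f` of odd length `m`, about `2 * r`, in a 2-connected graph of minimum degree at
least `r`, such that paths outside of `f` cannot be used to produce certain longer cycles. -/
structure ExtremalCycle (G : SimpleGraph V) [DecidableRel G.Adj] (f : ZMod m → V)
    (r κ : ℕ) : Prop where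
  three_le : 3 ≤ r
  three_le_m : 3 ≤ m
  odd : m % 2 = 1
  inj : Function.Injective f
  size : (κ = 0 ∧ m + 3 ≤ 2 * r) ∨ (κ % 2 = 1 ∧ m + 2 = 2 * r + κ)
  deg : ∀ v, r ≤ dg G Finset.univ v
  sep : ∀ (K : Finset V) (q : V), K.Nonempty → q ∉ K → (∃ w, w ∉ K ∧ w ≠ q) →
    ∃ v ∈ K, ∃ w, G.Adj v w ∧ w ∉ K ∧ w ≠ q
  far : ∀ (T : Finset V) (u v : V) (n : ℕ), (∀ w ∈ T, ∀ i, w ≠ f i) → HasPath G T u v n →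
    FarApart (att G f u) (att G f v) (n + 2 + κ)

/-- `H` is a connected component of the complement of the cycle `f`, with at least two vertices. -/
structure OffComponent (G : SimpleGraph V) (f : ZMod m → V) (H : Finset V) : Prop where
  off : ∀ v ∈ H, ∀ i, v ≠ f i
  closed : ∀ v ∈ H, ∀ w, G.Adj v w → w ∈ H ∨ ∃ i, w = f i
  conn : Conn G H
  nontrivial : ∃ a ∈ H, ∃ b ∈ H, a ≠ b

namespace ExtremalCycle

variable (hC : ExtremalCycle G f r κ) (hO : OffComponent G f H)
include hC hO

theorem farApart {u v : V} {n : ℕ} (h : HasPath G H u v n) :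
    FarApart (att G f u) (att G f v) (n + 2 + κ) :=
  hC.far H u v n hO.off h

theorem le_dg_add {v : V} (hv : v ∈ H) : r ≤ dg G H v + (att G f v).card := by
  refine (hC.deg v).trans ((dg_le_dg_add (D' := H) (E := (att G f v).image f) ?_).trans
    (Nat.add_le_add_left Finset.card_image_le _))
  intro w _ hvw
  rw [Finset.mem_union, Finset.mem_image]
  refine (hO.closed v hv w hvw).imp_right ?_
  rintro ⟨i, rfl⟩
  exact ⟨i, mem_att.2 hvw, rfl⟩

theorem exists_att {K : Finset V} {q : V} (hKH : K ⊆ H) (hK : K.Nonempty) (hq : q ∈ H)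
    (hqK : q ∉ K) (hcl : ∀ v ∈ K, ∀ w ∈ H, G.Adj v w → w ∈ insert q K) :
    ∃ v ∈ K, 1 ≤ (att G f v).card := by
  obtain ⟨v, hv, w, hvw, hwK, hwq⟩ := hC.sep K q hK hqK
    ⟨f 0, fun h => hO.off _ (hKH h) 0 rfl, fun h => hO.off q hq 0 h.symm⟩
  refine ⟨v, hv, Finset.card_pos.2 ?_⟩
  rcases hO.closed v (hKH hv) w hvw with hw | ⟨i, rfl⟩
  · have := hcl v hv w hw hvw
    simp [hwK, hwq] at this
  · exact ⟨i, mem_att.2 hvw⟩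

theorem exists_att_ne (i : ZMod m) : ∃ v ∈ H, ∃ j ∈ att G f v, j ≠ i := by
  have hne : i + 1 ≠ i := by
    have : Fact (1 < m) := ⟨by have := hC.three_le_m; omega⟩
    simp
  obtain ⟨a, ha, -⟩ := hO.nontrivial
  obtain ⟨v, hv, w, hvw, hwK, hwq⟩ := hC.sep H (f i) ⟨a, ha⟩ (fun h => hO.off _ h i rfl)
    ⟨f (i + 1), fun h => hO.off _ h _ rfl, fun h => hne (hC.inj h)⟩
  rcases hO.closed v hv w hvw with hw | ⟨j, rfl⟩
  · exact absurd hw hwK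
  · exact ⟨v, hv, j, mem_att.2 hvw, fun h => hwq (h ▸ rfl)⟩

theorem attach_nonblock {v v' : V} {n i i' : ℕ} (hp : HasPath G H v v' n)
    (hi : 1 ≤ i) (hi' : 1 ≤ i') (hs : r ≤ (att G f v).card + i) (hs' : r ≤ (att G f v').card + i')
    (hn : i + i' ≤ n) (hne : ∃ x ∈ att G f v, ∃ y ∈ att G f v', x ≠ y) : False := by
  have hsz := hC.size
  have h3 := hC.three_le
  have hfar := hC.farApart hO hp
  rcases hfar.card hC.odd (by omega) hne with h1 | ⟨h1, h2, h4⟩ | ⟨h1, h2, h4⟩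
  · omega
  · have hs2 : 2 ≤ (att G f v).card := by
      obtain ⟨x, hx, y, hy, hxy⟩ := hne
      rw [← h1] at hy
      exact Finset.one_lt_card.2 ⟨x, hx, y, hy, hxy⟩
    rw [← h1] at hs'
    generalize (att G f v).card = s at *
    wlog hii : i ≤ i' generalizing i i'
    · exact this hi' hi (by omega) (by omega) (by omega) (by omega)
    have h5 : 2 * (r - 1) ≤ s * (i + 1) := by
      obtain ⟨a, rfl⟩ := Nat.exists_eq_add_of_le hs2
      obtain ⟨b, rfl⟩ := Nat.exists_eq_add_of_le hi
      have : (2 + a) * (1 + b + 1) = 4 + 2 * a + 2 * b + a * b := by ring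
      omega
    rcases hsz with ⟨rfl, hsz⟩ | ⟨hκ, hsz⟩
    · have : (2 * (i + 1)) * s ≤ (n + 2 + 0) * s := Nat.mul_le_mul_right _ (by omega)
      rw [mul_assoc, mul_comm (i + 1) s] at this
      omega
    · have : (2 * (i + 1) + (1 + κ)) * s ≤ (n + 2 + κ) * s := Nat.mul_le_mul_right _ (by omega)
      rw [add_mul, mul_assoc, mul_comm (i + 1) s] at this
      have h6 : (1 + κ) * 2 ≤ (1 + κ) * s := Nat.mul_le_mul_left _ hs2
      omega
  · omega

end ExtremalCycle

end Core

section

variable {V : Type*} [DecidableEq V] {G : SimpleGraph V}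

/-- A connected set that is not a block has two disjoint end blocks. -/
theorem Conn.exists_two_endBlocks {H : Finset V} (hH : Conn G H) (hne : ∃ a ∈ H, ∃ b ∈ H, a ≠ b)
    (hB : ¬ Block G H) : ∃ (K K' : Finset V) (q q' : V), K ⊆ H ∧ K' ⊆ H ∧ K.Nonempty ∧
      K'.Nonempty ∧ q ∈ H ∧ q' ∈ H ∧ q ∉ K ∧ q ∉ K' ∧ q' ∉ K ∧ q' ∉ K' ∧ Disjoint K K' ∧
      (∀ v ∈ K, ∀ w ∈ H, G.Adj v w → w ∈ insert q K) ∧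
      (∀ v ∈ K', ∀ w ∈ H, G.Adj v w → w ∈ insert q' K') ∧
      Block G (insert q K) ∧ Block G (insert q' K') ∧ Conn G (H \ K) ∧ Conn G (H \ K') ∧
      Conn G ((H \ K) \ K') := by
  obtain ⟨a, ha, b, hb, hab⟩ := hne
  obtain ⟨K, q, hKH, hK, hq, hqK, -, hcl, hBK, hHK⟩ := hH.exists_endBlock ha ⟨b, hb, hab.symm⟩
  have hqHK : q ∈ H \ K := by simp [hq, hqK]
  obtain ⟨K', q', hKH', hK', hq', hqK', hc', hcl', hBK', hHK'⟩ := hHK.exists_endBlock hqHK (by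
    by_contra hno
    push Not at hno
    refine hB ?_
    convert hBK
    ext x
    constructor
    · intro hx
      by_cases hxK : x ∈ K
      · simp [hxK]
      · simp [hno x (by simp [hx, hxK])]
    · intro hx
      rcases Finset.mem_insert.1 hx with rfl | hx
      · exact hq
      · exact hKH hx)
  rw [Finset.mem_sdiff] at hq'
  have hdisj : Disjoint K K' :=
    Finset.disjoint_left.2 fun x hx hx' => (Finset.mem_sdiff.1 (hKH' hx')).2 hx
  have hclH : ∀ v ∈ K', ∀ w ∈ H, G.Adj v w → w ∈ insert q' K' := by
    intro v hv w hw hvw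
    by_cases hwK : w ∈ K
    · have hv' := Finset.mem_sdiff.1 (hKH' hv)
      have := hcl w hwK v hv'.1 hvw.symm
      rw [Finset.mem_insert] at this
      rcases this with rfl | h
      · exact absurd hv hc'
      · exact absurd h hv'.2
    · exact hcl' v hv w (Finset.mem_sdiff.2 ⟨hw, hwK⟩) hvw
  refine ⟨K, K', q, q', hKH, fun x hx => (Finset.mem_sdiff.1 (hKH' hx)).1, hK, hK', hq, hq'.1, hqK,
    hc', hq'.2, hqK', hdisj, hcl, hclH, hBK, hBK', hHK, ?_, hHK'⟩
  have hsub : (H \ K) \ K' ⊆ H \ K' := Finset.sdiff_subset_sdiff Finset.sdiff_subset subset_rfl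
  have hsubK : insert q K ⊆ H \ K' := by
    intro x hx
    rw [Finset.mem_sdiff]
    rcases Finset.mem_insert.1 hx with rfl | hx
    · exact ⟨hq, hc'⟩
    · exact ⟨hKH hx, Finset.disjoint_left.1 hdisj hx⟩
  have key : ∀ x ∈ H \ K', Reach G (H \ K') x q := by
    intro x hx
    by_cases hxK : x ∈ K
    · exact (hBK.2.1 x (by simp [hxK]) q (by simp)).mono hsubK
    · rw [Finset.mem_sdiff] at hx
      exact (hHK' x (by simp [hx, hxK]) q (by simp [hqHK, hc'])).mono hsub
  exact fun x hx y hy => (key x hx).trans (key y hy).symm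

end

namespace ExtremalCycle

variable {V : Type*} [Fintype V] [DecidableEq V] {G : SimpleGraph V} [DecidableRel G.Adj]
  {m : ℕ} [NeZero m] {f : ZMod m → V} {r κ : ℕ} {H : Finset V}
  (hC : ExtremalCycle G f r κ) (hO : OffComponent G f H)

include hC hO

theorem endBlock_path {K : Finset V} {q v : V} (hKH : K ⊆ H) (hqK : q ∉ K)
    (hcl : ∀ v ∈ K, ∀ w ∈ H, G.Adj v w → w ∈ insert q K) (hB : Block G (insert q K)) (hv : v ∈ K)
    (hmax : ∀ w ∈ K, (att G f w).card ≤ (att G f v).card) :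
    ∃ n, 1 ≤ n ∧ r ≤ (att G f v).card + n ∧ HasPath G (insert q K) v q n := by
  have hvq : v ≠ q := fun h => hqK (h ▸ hv)
  have hdg : ∀ w ∈ K, r ≤ dg G (insert q K) w + (att G f v).card := fun w hw => by
    have h1 := hC.le_dg_add hO (hKH hw)
    have h2 : dg G H w ≤ dg G (insert q K) w + (∅ : Finset V).card :=
      dg_le_dg_add fun x hx hwx => by simpa using hcl w hw x hx hwx
    rw [Finset.card_empty] at h2
    have := hmax w hw
    omega
  obtain ⟨n, hn, hp⟩ := hB.exists_long_path_exceptional (x := v) (c := q)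
    (d := r - (att G f v).card) (by simp [hv]) (by simp) hvq (fun w hw _ hwq => by
      have := hdg w (by simpa [hwq] using hw)
      omega) (by
      by_cases h3 : ∃ z ∈ insert q K, z ≠ v ∧ z ≠ q
      · exact Or.inr h3
      · left
        have h2 : dg G (insert q K) v ≤ ({q} : Finset V).card := dg_le_card fun w hw hvw => by
          by_contra hwc
          exact h3 ⟨w, hw, hvw.ne', by simpa using hwc⟩
        rw [Finset.card_singleton] at h2
        have := hdg v hv
        omega)
  exact ⟨n, hp.pos hvq, by omega, hp⟩

/-- If all neighbours of the end block `K` on the cycle coincide, then `K` has few attachments. -/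
theorem endBlock_single {K : Finset V} {q v : V} {a : ZMod m} (hKH : K ⊆ H) (hq : q ∈ H)
    (hqK : q ∉ K) (hcl : ∀ v ∈ K, ∀ w ∈ H, G.Adj v w → w ∈ insert q K)
    (hB : Block G (insert q K)) (hHK : Conn G (H \ K)) (hv : v ∈ K) (ha : a ∈ att G f v)
    (hsingle : ∀ w ∈ K, ∀ b ∈ att G f w, b = a) : False := by
  have hsz := hC.size
  have hr := hC.three_le
  obtain ⟨h, hh, b, hb, hba⟩ := hC.exists_att_ne hO a
  have hhK : h ∉ K := fun hhK => hba (hsingle h hhK b hb)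
  have hqH : q ∈ H \ K := by simp [hq, hqK]
  have hhH : h ∈ H \ K := by simp [hh, hhK]
  obtain ⟨k, hk⟩ := (hHK q hqH h hhH).hasPath hqH
  have hsub : insert q K ⊆ H := Finset.insert_subset hq hKH
  have hlong := longPaths_aux (G := G) r (D := insert q K) (c := q) (p := f a) (x := v) (W := ∅)
    (e := 0) (by omega) hB (by simp) (fun h => hO.off _ (hsub h) a rfl) (by simp [hv])
    (fun h => hqK (h ▸ hv)) (mem_att.1 ha).symm (fun w hw hwq => by
      have hwK : w ∈ K := by simpa [hwq] using hw
      have h2 : dg G Finset.univ w ≤ dg G (insert (f a) (insert q K)) w + (∅ : Finset V).card :=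
        dg_le_dg_add fun x _ hwx => by
          rw [Finset.union_empty, Finset.mem_insert]
          rcases hO.closed w (hKH hwK) x hwx with hx | ⟨i, rfl⟩
          · exact Or.inr (hcl w hwK x hx hwx)
          · exact Or.inl (by rw [hsingle w hwK i (mem_att.2 hwx)])
      rw [Finset.card_empty] at h2
      have := hC.deg w
      exact ⟨by omega, fun _ => by omega⟩) (by simp) (by simp)
  have key : ∀ n, (∃ n', n' + 1 = n ∧ ∃ y ∈ insert q K, G.Adj (f a) y ∧
      HasPath G (insert q K) y q n') → FarApart {a} {b} (n + k + 1 + κ) := by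
    rintro n ⟨n', rfl, y, hy, hay, hp⟩
    have hp' : HasPath G H y h (n' + k) := by
      refine (hp.append hk ?_).mono ?_
      · intro x hx hx'
        rw [Finset.mem_insert] at hx
        exact hx.resolve_right (Finset.mem_sdiff.1 hx').2
      · exact Finset.union_subset hsub Finset.sdiff_subset
    have := (hC.farApart hO hp').mono (B := {a}) (B' := {b})
      (by simpa using mem_att.2 hay.symm) (by simpa using hb)
    rwa [show n' + 1 + k + 1 + κ = n' + k + 2 + κ by omega]
  have hne : ∃ x ∈ ({a} : Finset (ZMod m)), ∃ y ∈ ({b} : Finset (ZMod m)), x ≠ y := by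
    simpa using hba.symm
  rcases hlong with ⟨n₁, n₂, h0, h1, h2, h3, h4⟩ | ⟨n, h1, h2⟩
  · have := (key n₁ h3).add_le hC.odd (key n₂ h4) (by omega) hne
    omega
  · have := (key n h2).lt hC.odd (Finset.mem_singleton_self a) (Finset.mem_singleton_self b)
      hba.symm
    omega

theorem block : Block G H := by
  by_contra hB
  obtain ⟨K, K', q, q', hKH, hKH', hK, hK', hq, hq', hqK, hqK', hq'K, hq'K', hdisj, hcl, hcl', hBK,
    hBK', hHK, hHK', hmid⟩ := hO.conn.exists_two_endBlocks hO.nontrivial hB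
  have key : ∀ v ∈ K, (∀ w ∈ K, (att G f w).card ≤ (att G f v).card) → ∀ v' ∈ K',
      (∀ w ∈ K', (att G f w).card ≤ (att G f v').card) → ∀ x ∈ att G f v, ∀ y ∈ att G f v',
      x = y := by
    intro v hv hmax v' hv' hmax' x hx y hy
    by_contra hxy
    obtain ⟨i, hi, hs, hp⟩ := hC.endBlock_path hO hKH hqK hcl hBK hv hmax
    obtain ⟨i', hi', hs', hp'⟩ := hC.endBlock_path hO hKH' hq'K' hcl' hBK' hv' hmax'
    have hqm : q ∈ (H \ K) \ K' := by simp [hq, hqK, hqK']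
    obtain ⟨k, hk⟩ := (hmid q hqm q' (by simp [*])).hasPath hqm
    have hp2 : HasPath G H v v' (i + k + i') := by
      refine ((hp.append hk ?_).append hp'.symm ?_).mono ?_
      · intro z hz hz'
        simp only [Finset.mem_insert, Finset.mem_sdiff] at hz hz'
        tauto
      · intro z hz hz'
        simp only [Finset.mem_union, Finset.mem_insert, Finset.mem_sdiff] at hz hz'
        rcases hz' with h | h
        · exact h
        · rcases hz with (rfl | hz) | hz
          · exact absurd h hqK'
          · exact absurd h (Finset.disjoint_left.1 hdisj hz)
          · exact absurd h hz.2
      · exact Finset.union_subset (Finset.union_subset (Finset.insert_subset hq hKH)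
          (Finset.sdiff_subset.trans Finset.sdiff_subset)) (Finset.insert_subset hq' hKH')
    exact hC.attach_nonblock hO hp2 hi hi' hs hs' (by omega) ⟨x, hx, y, hy, hxy⟩
  obtain ⟨v, hv, hmax⟩ := K.exists_max_image (fun v => (att G f v).card) hK
  obtain ⟨v', hv', hmax'⟩ := K'.exists_max_image (fun v => (att G f v).card) hK'
  obtain ⟨w, hw, hws⟩ := hC.exists_att hO hKH hK hq hqK hcl
  obtain ⟨w', hw', hws'⟩ := hC.exists_att hO hKH' hK' hq' hq'K' hcl'
  obtain ⟨a, ha⟩ := Finset.card_pos.1 (show 0 < (att G f v).card from hws.trans (hmax w hw))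
  obtain ⟨a', ha'⟩ := Finset.card_pos.1 (show 0 < (att G f v').card from hws'.trans (hmax' w' hw'))
  have hsv : (att G f v).card ≤ 1 := by
    rw [Finset.card_le_one]
    intro x hx y hy
    rw [key v hv hmax v' hv' hmax' x hx a' ha', key v hv hmax v' hv' hmax' y hy a' ha']
  refine hC.endBlock_single hO hKH hq hqK hcl hBK hHK hv ha fun u hu b hb => ?_
  have hu1 : 1 ≤ (att G f u).card := Finset.card_pos.2 ⟨b, hb⟩
  rw [key u hu (fun w hw => (hmax w hw).trans (hsv.trans hu1)) v' hv' hmax' b hb a' ha',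
    key v hv hmax v' hv' hmax' a ha a' ha']

end ExtremalCycle

section

variable {V : Type*} [DecidableEq V] {G : SimpleGraph V}

theorem Conn.insert_of_adj {S : Finset V} {z u : V} (hS : Conn G S) (hu : u ∈ S) (hzu : G.Adj z u) :
    Conn G (insert z S) := by
  have key : ∀ x ∈ insert z S, Reach G (insert z S) x u := by
    intro x hx
    rcases Finset.mem_insert.1 hx with rfl | hx
    · exact .adj hzu (by simp) (by simp [hu])
    · exact (hS x hx u hu).mono (Finset.subset_insert _ _)
  exact fun x hx y hy => (key x hx).trans (key y hy).symm

theorem Block.insert_of_adj {S : Finset V} {z u v : V} (hS : Block G S) (hz : z ∉ S) (hu : u ∈ S)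
    (hv : v ∈ S) (huv : u ≠ v) (hzu : G.Adj z u) (hzv : G.Adj z v) : Block G (insert z S) := by
  refine ⟨⟨u, by simp [hu], v, by simp [hv], huv⟩, hS.2.1.insert_of_adj hu hzu, fun q => ?_⟩
  by_cases hq : q = z
  · rw [hq, Finset.erase_insert hz]
    exact hS.2.1
  · rw [Finset.erase_insert_of_ne (Ne.symm hq)]
    by_cases hqu : u = q
    · exact (hS.2.2 q).insert_of_adj (by simp [hv, ← hqu, huv.symm]) hzv
    · exact (hS.2.2 q).insert_of_adj (by simp [hu, hqu]) hzu

end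

namespace ExtremalCycle

variable {V : Type*} [Fintype V] [DecidableEq V] {G : SimpleGraph V} [DecidableRel G.Adj]
  {m : ℕ} [NeZero m] {f : ZMod m → V} {r κ : ℕ} {H : Finset V}

theorem two_mul_pred_le_mul {s i r : ℕ} (hs : 2 ≤ s) (hi : 1 ≤ i) (h : r ≤ s + i) :
    2 * (r - 1) ≤ s * (i + 1) := by
  obtain ⟨a, rfl⟩ := Nat.exists_eq_add_of_le hs
  obtain ⟨b, rfl⟩ := Nat.exists_eq_add_of_le hi
  have : (2 + a) * (1 + b + 1) = 4 + 2 * a + 2 * b + a * b := by ring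
  omega

omit [NeZero m] in
theorem exists_ne_of_two_le {A A' : Finset (ZMod m)} (hA : 2 ≤ A.card) (hA' : 1 ≤ A'.card) :
    ∃ x ∈ A, ∃ y ∈ A', x ≠ y := by
  obtain ⟨y, hy⟩ := Finset.card_pos.1 hA'
  obtain ⟨x, hx, hxy⟩ := Finset.exists_mem_ne (s := A) (by omega) y
  exact ⟨x, hx, y, hy, hxy⟩

variable (hC : ExtremalCycle G f r κ) (hO : OffComponent G f H)

include hC hO

theorem exists_third {v : V} {s : ℕ} (x c : V) (hv : v ∈ H) (hvxc : v = x ∨ v = c)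
    (hs : (att G f v).card ≤ s) : r - s ≤ 1 ∨ ∃ z ∈ H, z ≠ x ∧ z ≠ c := by
  by_cases h3 : ∃ z ∈ H, z ≠ x ∧ z ≠ c
  · exact Or.inr h3
  · left
    have h2 : dg G H v ≤ 1 := by
      have : dg G H v ≤ (({x, c} : Finset V).erase v).card := dg_le_card fun w hw hvw => by
        rw [Finset.mem_erase, Finset.mem_insert, Finset.mem_singleton]
        refine ⟨hvw.ne', ?_⟩
        by_contra hwc
        exact h3 ⟨w, hw, by tauto, by tauto⟩
      refine this.trans ?_
      rw [Finset.card_erase_of_mem (by simpa using hvxc)]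
      have := Finset.card_le_two (a := x) (b := c)
      omega
    have := hC.le_dg_add hO hv
    omega

theorem false_of_att_le_one (hmax : ∀ w ∈ H, (att G f w).card ≤ 1) : False := by
  have hB := hC.block hO
  have hsz := hC.size
  have hr := hC.three_le
  obtain ⟨u, hu, i, hi, -⟩ := hC.exists_att_ne hO 0
  obtain ⟨v, hv, j, hj, hji⟩ := hC.exists_att_ne hO i
  have huv : u ≠ v := fun h => hji (Finset.card_le_one.1 (hmax v hv) _ hj _ (h ▸ hi))
  have hne : ∃ x ∈ att G f u, ∃ y ∈ att G f v, x ≠ y := ⟨i, hi, j, hj, hji.symm⟩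
  rcases hB.longPaths (W := ∅) (e := 0) (d := r - 1) (by omega) hu hv huv
      (fun w hw _ _ => by
        have := hC.le_dg_add hO hw
        have := hmax w hw
        exact ⟨by omega, fun _ => by omega⟩)
      (hC.exists_third hO u v hu (Or.inl rfl) (hmax u hu)) (by simp) (by simp) with
    ⟨n₁, n₂, h0, h1, h2, h3, h4⟩ | ⟨n, h1, h2⟩
  · have := (hC.farApart hO h3).add_le hC.odd (hC.farApart hO h4) (by omega) hne
    omega
  · have := (hC.farApart hO h2).lt hC.odd hi hj hji.symm
    omega

theorem false_of_both {u v : V} {n₁ n₂ : ℕ} (h₁ : HasPath G H u v n₁) (h₂ : HasPath G H u v n₂)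
    (hpar : (n₁ + n₂) % 2 = 1) (hn₁ : 1 ≤ n₁) (hn₂ : 1 ≤ n₂)
    (hr₁ : r ≤ (att G f v).card + (n₁ + 1)) (hr₂ : r ≤ (att G f v).card + (n₂ + 1))
    (hu : 2 ≤ (att G f u).card) (hv : 1 ≤ (att G f v).card)
    (hvu : (att G f v).card ≤ (att G f u).card) : False := by
  have hsz := hC.size
  have hr := hC.three_le
  obtain ⟨i, hi₁, hi₂, hi, hri⟩ : ∃ i, i ≤ n₁ ∧ i ≤ n₂ ∧ 1 ≤ i ∧ r ≤ (att G f v).card + (i + 1) :=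
    ⟨min n₁ n₂, by omega, by omega, by omega, by omega⟩
  rcases (hC.farApart hO h₁).card_both (g := i + 2 + κ) hC.odd (hC.farApart hO h₂) (by omega)
    (by omega) (by omega) (by omega) (exists_ne_of_two_le hu hv) with ⟨-, h⟩ | ⟨h0, h⟩
  · omega
  · rw [← h0] at hri
    generalize (att G f u).card = s at *
    have h5 := two_mul_pred_le_mul hu (by omega) hri
    have h6 : κ * 2 ≤ κ * s := Nat.mul_le_mul_left _ hu
    have h7 : (i + 2 + κ) * s = s * (i + 1 + 1) + κ * s := by ring
    omega

theorem false_of_lt {u v : V} (hu : u ∈ H) (hv : v ∈ H) (hv1 : 1 ≤ (att G f v).card)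
    (hvu : (att G f v).card < (att G f u).card)
    (hmax : ∀ w ∈ H, w ≠ u → (att G f w).card ≤ (att G f v).card) : False := by
  have hB := hC.block hO
  have hsz := hC.size
  have hr := hC.three_le
  have huv : u ≠ v := by rintro rfl; omega
  have hne := exists_ne_of_two_le (A := att G f u) (by omega) hv1
  rcases hB.longPaths (W := ∅) (e := 0) (d := r - (att G f v).card) (by omega) hu hv huv
      (fun w hw hwu _ => by
        have := hC.le_dg_add hO hw
        have := hmax w hw hwu
        exact ⟨by omega, fun _ => by omega⟩)
      (hC.exists_third hO u v hv (Or.inr rfl) le_rfl) (by simp) (by simp) with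
    ⟨n₁, n₂, h0, h1, h2, h3, h4⟩ | ⟨n, h1, h2⟩
  · exact hC.false_of_both hO h3 h4 h0 (h3.pos huv) (h4.pos huv) (by omega) (by omega) (by omega)
      hv1 hvu.le
  · have := h2.pos huv
    rcases (hC.farApart hO h2).card hC.odd (by omega) hne with h | ⟨h, -⟩ | ⟨-, h, h'⟩
    · omega
    · rw [h] at hvu
      omega
    · omega

theorem false_of_nine {u v : V} (hu : u ∈ H) (hv : v ∈ H) (huv : u ≠ v) (hm : m = 9)
    (hκ : κ ≤ 1) (hrκ : r + κ = 6) (hA : att G f u = att G f v) (hs : (att G f u).card = 3)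
    (h3 : FarApart (att G f u) (att G f u) 3) (h6 : FarApart (att G f u) (att G f u) 6) :
    False := by
  subst hm
  have hstep : ∀ k : ℕ, 0 < k → k < 9 → ∀ i ∈ att G f u, i + k ∈ att G f u → k = 3 ∨ k = 6 := by
    intro k h0 hk i hi hik
    have hback : i + k + ((9 - k : ℕ) : ZMod 9) ∈ att G f u := by
      rwa [Nat.cast_sub hk.le, ZMod.natCast_self, zero_sub, add_neg_cancel_right]
    rcases Nat.mod_two_eq_zero_or_one k with hp | hp
    · have := (h6 k h0 hk (by omega)).1 i hi hik
      have := (h3 (9 - k) (by omega) (by omega) (by omega)).1 _ hik hback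
      omega
    · have := (h3 k h0 hk (by omega)).1 i hi hik
      have := (h6 (9 - k) (by omega) (by omega) (by omega)).1 _ hik hback
      omega
  obtain ⟨a, ha⟩ := Finset.card_pos.1 (show 0 < (att G f u).card by omega)
  have hAeq : att G f u = {a, a + 3, a + 6} := by
    refine Finset.eq_of_subset_of_card_le ?_ (by rw [hs]; exact Finset.card_le_three)
    intro b hb
    by_cases hab : a = b
    · simp [hab]
    · obtain ⟨k, hk0, hk, rfl⟩ := ZMod.exists_add_natCast hab
      rcases hstep k hk0 hk a ha hb with rfl | rfl <;> simp
  have hmem3 : a + 3 ∈ att G f u := by simp [hAeq]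
  have hmem6 : a + 6 ∈ att G f u := by simp [hAeq]
  have hB := hC.block hO
  have hatt : ∀ w ∈ H, att G f w ⊆ att G f u := by
    intro w hw b hb
    by_cases hwu : u = w
    · rwa [hwu]
    by_contra hbA
    obtain ⟨n, hp⟩ := hB.exists_path hu hw
    have hn := hp.pos hwu
    have hfar := hC.farApart hO hp
    have hnear : ∃ x ∈ att G f u, ∃ y ∈ att G f u,
        (x + (1 : ℕ) = b ∧ b + (2 : ℕ) = y) ∨ (x + (2 : ℕ) = b ∧ b + (1 : ℕ) = y) := by
      rw [hAeq] at hbA ⊢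
      revert hbA
      clear * -
      revert a b
      decide
    obtain ⟨x, hx, y, hy, ⟨h1, h2⟩ | ⟨h1, h2⟩⟩ := hnear
    · rcases Nat.mod_two_eq_zero_or_one (n + 2 + κ) with hp | hp
      · have := (hfar 2 (by omega) (by omega) (by omega)).2 b hb (h2 ▸ hy)
        omega
      · have := (hfar 1 (by omega) (by omega) (by omega)).1 x hx (h1 ▸ hb)
        omega
    · rcases Nat.mod_two_eq_zero_or_one (n + 2 + κ) with hp | hp
      · have := (hfar 2 (by omega) (by omega) (by omega)).1 x hx (h1 ▸ hb)
        omega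
      · have := (hfar 1 (by omega) (by omega) (by omega)).2 b hb (h2 ▸ hy)
        omega
  have ha3 : a ≠ a + 3 := by
    clear * -
    revert a
    decide
  have hzH : f (a + 3) ∉ H := fun h => hO.off _ h _ rfl
  have hlong := longPaths_aux (G := G) (r - 1) (D := insert (f (a + 3)) H) (c := f (a + 3))
    (p := f a) (x := u) (W := ∅) (e := 0) (by omega)
    (hB.insert_of_adj hzH hu hv huv (mem_att.1 hmem3).symm (mem_att.1 (hA ▸ hmem3)).symm) (by simp)
    (by
      rw [Finset.mem_insert, not_or]
      exact ⟨fun h => ha3 (hC.inj h), fun h => hO.off _ h _ rfl⟩)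
    (by simp [hu]) (fun h => hzH (h ▸ hu)) (mem_att.1 ha).symm (fun w hw hwq => by
      have hwH : w ∈ H := by simpa [hwq] using hw
      have h2 : dg G Finset.univ w ≤
          dg G (insert (f a) (insert (f (a + 3)) H)) w + ({f (a + 6)} : Finset V).card :=
        dg_le_dg_add fun x _ hwx => by
          simp only [Finset.mem_union, Finset.mem_insert, Finset.mem_singleton]
          rcases hO.closed w hwH x hwx with hx | ⟨i, rfl⟩
          · tauto
          · have := hatt w hwH (mem_att.2 hwx)
            simp only [hAeq, Finset.mem_insert, Finset.mem_singleton] at this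
            rcases this with rfl | rfl | rfl <;> simp
      rw [Finset.card_singleton] at h2
      have := hC.deg w
      exact ⟨by omega, fun _ => by omega⟩) (by simp) (by simp)
  have key : ∀ n, 2 ≤ n → (∃ n', n' + 1 = n ∧ ∃ y ∈ insert (f (a + 3)) H, G.Adj (f a) y ∧
      HasPath G (insert (f (a + 3)) H) y (f (a + 3)) n') →
      ((n + κ) % 2 = 1 → n + κ ≤ 3) ∧ n + κ ≤ 6 := by
    rintro n hn ⟨n', rfl, y, hy, hay, hp⟩
    obtain ⟨n', rfl⟩ := Nat.exists_eq_add_of_le' (show 1 ≤ n' by omega)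
    obtain ⟨b, hb, hp'⟩ := hp.exists_snoc
    rw [Finset.erase_insert hzH] at hp'
    have hfar := hC.farApart hO hp'
    rw [show n' + 2 + κ = n' + 1 + 1 + κ by omega] at hfar
    have hya := mem_att.2 hay.symm
    have hba := mem_att.2 hb
    rcases Nat.mod_two_eq_zero_or_one (n' + 1 + 1 + κ) with hp | hp
    · have := (hfar 6 (by omega) (by omega) (by omega)).2 _ hba (by
        convert hya using 1
        rw [add_assoc, show (3 : ZMod 9) + ((6 : ℕ) : ZMod 9) = 0 by decide, add_zero])
      omega
    · have := (hfar 3 (by omega) (by omega) (by omega)).1 _ hya (by simpa using hba)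
      omega
  rcases hlong with ⟨n₁, n₂, h0, h1, h2, h3, h4⟩ | ⟨n, h1, h2⟩
  · have := key n₁ (by omega) h3
    have := key n₂ (by omega) h4
    omega
  · have := key n (by omega) h2
    omega

theorem false_of_odd_path {u v : V} {n : ℕ} (hp : HasPath G H u v n) (huv : u ≠ v)
    (hA : att G f u = att G f v) (hκ : κ % 2 = 1) (hn : n % 2 = 1)
    (hs : 2 ≤ (att G f u).card) (hsr : (att G f u).card < r)
    (hnr : 2 * r ≤ 2 * (att G f u).card + n + 1)
    (hmul : (n + 2 + κ) * (att G f u).card ≤ 2 * m) : False := by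
  have hsz := hC.size
  have hfar := hC.farApart hO hp
  have hfar0 := hC.farApart hO (HasPath.refl hp.left_mem)
  rw [← hA] at hfar
  have hne := exists_ne_of_two_le (A := att G f u) (A' := att G f u) hs (by omega)
  have hadd := hfar.add_le hC.odd hfar0 (by omega) hne
  have hboth : (2 + κ) * (att G f u).card ≤ m := by
    rcases hfar.card_both (g := 2 + κ) hC.odd hfar0 (by omega) (by omega) (by omega) (by omega) hne
      with ⟨h, -⟩ | ⟨-, h⟩
    · exact absurd rfl h
    · exact h
  have key : (att G f u).card = 3 ∧ r = 5 ∧ κ = 1 ∧ n = 3 ∧ m = 9 := by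
    generalize (att G f u).card = s at *
    obtain ⟨t, rfl⟩ := Nat.exists_eq_add_of_le (show 3 ≤ s by omega)
    obtain ⟨l, rfl⟩ := Nat.exists_eq_add_of_le (show 1 ≤ κ by omega)
    obtain ⟨d, rfl⟩ := Nat.exists_eq_add_of_le (show 3 + t + 1 ≤ r by omega)
    have e1 : (2 + (1 + l)) * (3 + t) = 9 + 3 * t + 3 * l + l * t := by ring
    obtain ⟨e, rfl⟩ := Nat.exists_eq_add_of_le (show 1 ≤ d by omega)
    obtain ⟨b, rfl⟩ := Nat.exists_eq_add_of_le (show 2 * e + 3 ≤ n by omega)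
    have e2 : (2 * e + 3 + b + 2 + (1 + l)) * (3 + t) =
      18 + 6 * e + 6 * t + 2 * (e * t) + 3 * b + b * t + 3 * l + l * t := by ring
    omega
  obtain ⟨h1, h2, h3, h4, h5⟩ := key
  refine hC.false_of_nine hO hp.left_mem hp.right_mem huv h5 (by omega) (by omega) hA h1 ?_ ?_
  · rwa [h3] at hfar0
  · rwa [h3, h4] at hfar

theorem false_of_eq {u v : V} (hu : u ∈ H) (hv : v ∈ H) (huv : u ≠ v)
    (hs : 2 ≤ (att G f u).card) (hvs : (att G f v).card = (att G f u).card)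
    (hmax : ∀ w ∈ H, (att G f w).card ≤ (att G f u).card)
    (hadj : G.Adj u v ∨ ∀ x ∈ H, ∀ y ∈ H, (att G f x).card = (att G f u).card →
      (att G f y).card = (att G f u).card → ¬ G.Adj x y) : False := by
  have hB := hC.block hO
  have hsz := hC.size
  have hr := hC.three_le
  have hne := exists_ne_of_two_le (A := att G f u) (A' := att G f v) hs (by omega)
  have hcard : ∀ n, HasPath G H u v n → 1 ≤ n ∧ (2 * (att G f u).card + n + κ ≤ m ∨
      (att G f u = att G f v ∧ (n + κ) % 2 = 0 ∧ (n + 2 + κ) * (att G f u).card ≤ 2 * m)) := by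
    intro n hp
    have hn := hp.pos huv
    refine ⟨hn, ?_⟩
    rcases (hC.farApart hO hp).card hC.odd (by omega) hne with h | ⟨h1, h2, h3⟩ | ⟨h, -⟩
    · left; omega
    · exact Or.inr ⟨h1, by omega, h3⟩
    · exact absurd hvs.symm h
  have hsr : (att G f u).card < r := by
    by_contra hsr
    obtain ⟨n, hp⟩ := hB.exists_path hu hv
    obtain ⟨hn, h | ⟨-, h1, h2⟩⟩ := hcard n hp
    · omega
    · generalize (att G f u).card = s at *
      rcases hsz with ⟨rfl, hsz⟩ | ⟨hκ, hsz⟩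
      · have := Nat.mul_le_mul_right s (show 4 ≤ n + 2 + 0 by omega)
        omega
      · obtain ⟨l, rfl⟩ := Nat.exists_eq_add_of_le (show 1 ≤ κ by omega)
        have h3 := Nat.mul_le_mul_right s (show 4 + l ≤ n + 2 + (1 + l) by omega)
        have h4 := Nat.mul_le_mul_left l (show 3 ≤ s by omega)
        rw [add_mul] at h3
        omega
  have hthird := hC.exists_third hO u v hu (Or.inl rfl) le_rfl
  have hdeg : ∀ w ∈ H, r - (att G f u).card ≤ dg G H w ∧
      ((att G f w).card ≠ (att G f u).card → r - (att G f u).card + 1 ≤ dg G H w) := by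
    intro w hw
    have := hC.le_dg_add hO hw
    have := hmax w hw
    exact ⟨by omega, fun _ => by omega⟩
  rcases hadj with hadj | hadj
  · have hedge : HasPath G H u v 1 := (HasPath.edge hadj).mono (by
      intro x; simp only [Finset.mem_insert, Finset.mem_singleton]; rintro (rfl | rfl) <;> assumption)
    have hfar1 := hC.farApart hO hedge
    rcases hB.longPaths (W := ∅) (e := 0) (by omega) hu hv huv
      (fun w hw _ _ => ⟨(hdeg w hw).1, fun _ => (hdeg w hw).1⟩) hthird (by simp) (by simp) with
      ⟨n₁, n₂, h0, h1, h2, h3, h4⟩ | ⟨n, h1, h2⟩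
    · exact hC.false_of_both hO h3 h4 h0 (h3.pos huv) (h4.pos huv) (by omega) (by omega) hs
        (by omega) hvs.le
    · have hfar := hC.farApart hO h2
      obtain ⟨hn, hc⟩ := hcard n h2
      rcases hsz with ⟨rfl, hsz⟩ | ⟨hκ, hsz⟩
      · have h1' : (att G f u).card + 2 ≤ r := by
          rcases hcard 1 hedge with ⟨-, h | ⟨-, h, -⟩⟩ <;> omega
        rcases hc with h | ⟨hA, h3, h4⟩
        · omega
        · rw [← hA] at hfar hfar1
          have hne' := exists_ne_of_two_le (A := att G f u) (A' := att G f u) hs (by omega)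
          have hadd := hfar.add_le hC.odd hfar1 (by omega) hne'
          have hboth : 3 * (att G f u).card ≤ m := by
            rcases hfar.card_both (g := 3) hC.odd hfar1 (by omega) (by omega) (by omega) (by omega)
              hne' with ⟨h, -⟩ | ⟨-, h⟩
            · exact absurd rfl h
            · exact h
          have key : (att G f u).card = 3 ∧ r = 6 ∧ n = 4 ∧ m = 9 := by
            generalize (att G f u).card = s at *
            obtain ⟨t, rfl⟩ := Nat.exists_eq_add_of_le (show 3 ≤ s by omega)
            obtain ⟨d, rfl⟩ := Nat.exists_eq_add_of_le (show 3 + t + 3 ≤ r by omega)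
            obtain ⟨b, rfl⟩ := Nat.exists_eq_add_of_le (show 2 * d + 4 ≤ n by omega)
            have e2 : (2 * d + 4 + b + 2 + 0) * (3 + t) =
              18 + 6 * d + 6 * t + 2 * (d * t) + 3 * b + b * t := by ring
            omega
          obtain ⟨h5, h6, h7, h8⟩ := key
          refine hC.false_of_nine hO hu hv huv h8 (by omega) (by omega) hA h5 hfar1 ?_
          rwa [h7] at hfar
      · rcases hc with h | ⟨hA, h3, h4⟩
        · obtain ⟨g, hg⟩ : ∃ g, 1 + 2 + κ = 2 * g := ⟨(1 + 2 + κ) / 2, by omega⟩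
          rw [hg] at hfar1
          have := hfar.lt_of_card_eq hC.odd (by omega) (by omega) hfar1 (by omega) hs hvs
          omega
        · exact hC.false_of_odd_path hO h2 huv hA hκ (by omega) hs hsr (by omega) h4
  · rcases hB.longPaths (W := {w | w ∈ H ∧ (att G f w).card = (att G f u).card}) (e := 1) (by omega)
      hu hv huv (fun w hw _ _ => ⟨(hdeg w hw).1, fun hW => (hdeg w hw).2 fun h => hW ⟨hw, h⟩⟩)
      hthird (fun x hx y hy => hadj x hx.1 y hy.1 hx.2 hy.2)
      (fun w hw _ hW => hadj u hu w hw rfl hW.2) with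
      ⟨n₁, n₂, h0, h1, h2, h3, h4⟩ | ⟨n, h1, h2⟩
    · exact hC.false_of_both hO h3 h4 h0 (h3.pos huv) (h4.pos huv) (by omega) (by omega) hs
        (by omega) hvs.le
    · obtain ⟨hn, h | ⟨hA, h3, h4⟩⟩ := hcard n h2
      · omega
      · rcases hsz with ⟨rfl, hsz⟩ | ⟨hκ, hsz⟩
        · have h5 := two_mul_pred_le_mul (i := r - (att G f u).card) (r := r) hs (by omega)
            (by omega)
          generalize (att G f u).card = s at *
          have h6 := Nat.mul_le_mul_right s (show 2 * (r - s + 1) ≤ n + 2 + 0 by omega)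
          rw [mul_assoc, mul_comm (r - s + 1)] at h6
          omega
        · exact hC.false_of_odd_path hO h2 huv hA hκ (by omega) hs hsr (by omega) h4

/-- The complement of an extremal cycle is independent. -/
theorem false_of_offComponent : False := by
  obtain ⟨a, ha, b, hb, hab⟩ := hO.nontrivial
  obtain ⟨u, hu, hmax⟩ := H.exists_max_image (fun v => (att G f v).card) ⟨a, ha⟩
  by_cases hs : 2 ≤ (att G f u).card
  · by_cases hadj : ∃ x ∈ H, ∃ y ∈ H, (att G f x).card = (att G f u).card ∧
      (att G f y).card = (att G f u).card ∧ G.Adj x y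
    · obtain ⟨x, hx, y, hy, hxu, hyu, hxy⟩ := hadj
      exact hC.false_of_eq hO hx hy hxy.ne (by omega) (by omega)
        (fun w hw => (hmax w hw).trans hxu.ge) (Or.inl hxy)
    · push Not at hadj
      have hK : (H.erase u).Nonempty := by
        by_cases hau : a = u
        · exact ⟨b, by simp [hb, ← hau, hab.symm]⟩
        · exact ⟨a, by simp [ha, hau]⟩
      obtain ⟨v, hv, hmax'⟩ := (H.erase u).exists_max_image (fun v => (att G f v).card) hK
      obtain ⟨w, hw, hws⟩ := hC.exists_att hO (Finset.erase_subset u H) hK hu (by simp)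
        (fun x _ w hw _ => by by_cases h : w = u <;> simp [h, hw])
      have hvH := Finset.mem_of_mem_erase hv
      rcases (hmax v hvH).lt_or_eq with h | h
      · exact hC.false_of_lt hO hu hvH (hws.trans (hmax' w hw)) h
          (fun w hw hwu => hmax' w (by simp [hw, hwu]))
      · exact hC.false_of_eq hO hu hvH (Finset.ne_of_mem_erase hv).symm hs h hmax (Or.inr hadj)
  · exact hC.false_of_att_le_one hO fun w hw => (hmax w hw).trans (by omega)

end ExtremalCycle

section

variable {V : Type*} {G : SimpleGraph V}

/-- `G` contains a cycle of length `n`. -/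
def HasCycle (G : SimpleGraph V) (n : ℕ) : Prop :=
  ∃ (v : V) (c : G.Walk v v), c.IsCycle ∧ c.length = n

theorem HasPath.hasCycle [DecidableEq V] {S T : Finset V} {a b b' a' : V} {n k : ℕ}
    (h : HasPath G S a b n) (h' : HasPath G T b' a' k) (hST : Disjoint S T) (hb : G.Adj b b')
    (ha : G.Adj a' a) (hnk : 1 ≤ n + k) : HasCycle G (n + k + 2) := by
  refine (h.append (h'.cons hb (Finset.disjoint_left.1 hST h.right_mem)) ?_).exists_cycle
    (by omega) ha
  intro v hv hv'
  exact (Finset.mem_insert.1 hv').resolve_right (Finset.disjoint_left.1 hST hv)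

theorem exists_isPath_or_odd_cycle {a b : V} (p : G.Walk a b) :
    (∃ n, n % 2 = 1 ∧ HasCycle G n) ∨
      ∃ q : G.Walk a b, q.IsPath ∧ q.length % 2 = p.length % 2 := by
  classical
  induction p with
  | nil => exact Or.inr ⟨Walk.nil, by simp, rfl⟩
  | @cons u v w h p ih =>
    rcases ih with ih | ⟨q, hq, hqp⟩
    · exact Or.inl ih
    by_cases hu : u ∈ q.support
    · have hlen := congrArg Walk.length (q.take_spec hu)
      rw [Walk.length_append] at hlen
      have ht := hq.takeUntil hu
      by_cases hpar : (q.takeUntil u hu).length % 2 = 0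
      · left
        have h0 : (q.takeUntil u hu).length ≠ 0 := fun h0 =>
          h.ne (Walk.eq_of_length_eq_zero h0).symm
        refine ⟨(q.takeUntil u hu).length + 1, by omega, u, Walk.cons h (q.takeUntil u hu), ?_,
          by simp⟩
        rw [Walk.isCycle_iff_isPath_tail_and_le_length]
        exact ⟨by simpa using ht, by rw [Walk.length_cons]; omega⟩
      · refine Or.inr ⟨q.dropUntil u hu, hq.dropUntil hu, ?_⟩
        rw [Walk.length_cons]
        omega
    · refine Or.inr ⟨Walk.cons h q, hq.cons hu, ?_⟩
      rw [Walk.length_cons, Walk.length_cons]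
      omega

theorem exists_odd_cycle (hG : ¬ IsBip G) : ∃ n, n % 2 = 1 ∧ HasCycle G n := by
  by_contra hno
  refine hG ?_
  have h2 : G.Colorable 2 := by
    rw [two_colorable_iff_forall_loop_even]
    intro u w
    rcases exists_isPath_or_odd_cycle w with h | ⟨q, hq, hqw⟩
    · exact absurd h hno
    · rw [Walk.isPath_iff_nil, ← Walk.length_eq_zero_iff] at hq
      rw [hq] at hqw
      rw [Nat.even_iff, ← hqw]
  obtain ⟨C⟩ := h2
  refine ⟨{x | C x = 0}, fun x y hxy => ?_⟩
  have := C.valid hxy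
  simp only [Set.mem_ofPred_eq]
  omega

end

section

variable {V : Type*} {G : SimpleGraph V} {m : ℕ} {f : ZMod m → V}

/-- `f` enumerates the vertices of a cycle of length `m` in cyclic order. -/
structure IsCyc (G : SimpleGraph V) (f : ZMod m → V) : Prop where
  three_le : 3 ≤ m
  inj : Function.Injective f
  adj : ∀ i, G.Adj (f i) (f (i + 1))

theorem HasCycle.exists_isCyc (h : HasCycle G m) : ∃ f : ZMod m → V, IsCyc G f := by
  obtain ⟨v, c, hc, rfl⟩ := h
  have h3 := hc.three_le_length
  have : NeZero c.length := ⟨by omega⟩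
  refine ⟨fun i => c.getVert i.val, h3, fun i j hij => ?_, fun i => ?_⟩
  · have hi := i.val_lt
    have hj := j.val_lt
    exact ZMod.val_injective _ (hc.getVert_injOn' (by simp; omega) (by simp; omega) hij)
  · have hi := i.val_lt
    have h1 : (i + 1).val = (i.val + 1) % c.length := by
      rw [ZMod.val_add, ZMod.val_one'' (by omega)]
    simp only [h1]
    by_cases hlt : i.val + 1 < c.length
    · rw [Nat.mod_eq_of_lt hlt]
      exact c.adj_getVert_succ hi
    · have he : i.val + 1 = c.length := by omega
      rw [he, Nat.mod_self, Walk.getVert_zero]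
      have := c.adj_getVert_succ hi
      rwa [he, Walk.getVert_length] at this

variable [DecidableEq V]

/-- The vertices `f i, f (i + 1), …, f (i + k)`. -/
def arc (f : ZMod m → V) (i : ZMod m) (k : ℕ) : Finset V :=
  (Finset.range (k + 1)).image fun j : ℕ => f (i + j)

theorem mem_arc {i : ZMod m} {k : ℕ} {v : V} : v ∈ arc f i k ↔ ∃ j ≤ k, f (i + (j : ℕ)) = v := by
  simp [arc]

theorem add_natCast_inj {i : ZMod m} {a b : ℕ} (ha : a < m) (hb : b < m)
    (h : i + (a : ZMod m) = i + b) : a = b := by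
  have := (ZMod.natCast_eq_natCast_iff' a b m).1 (add_left_cancel h)
  rwa [Nat.mod_eq_of_lt ha, Nat.mod_eq_of_lt hb] at this

namespace IsCyc

variable (hf : IsCyc G f)
include hf

theorem hasPath_arc {i : ZMod m} {k : ℕ} (hk : k < m) :
    HasPath G (arc f i k) (f i) (f (i + k)) k := by
  induction k with
  | zero => simpa using HasPath.refl (G := G) (S := arc f i 0) (a := f i) (by simp [arc])
  | succ k ih =>
    have h := (ih (by omega)).snoc (c := f (i + (k + 1 : ℕ)))
      (by push_cast; rw [← add_assoc]; exact hf.adj _) (by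
        rw [mem_arc]
        rintro ⟨j, hj, he⟩
        have := add_natCast_inj (by omega) hk (hf.inj he)
        omega)
    refine h.mono fun v hv => ?_
    rw [Finset.mem_insert, mem_arc] at hv
    rw [mem_arc]
    rcases hv with rfl | ⟨j, hj, rfl⟩
    · exact ⟨k + 1, le_rfl, rfl⟩
    · exact ⟨j, by omega, rfl⟩

theorem disjoint_arc {i i' : ZMod m} {k k' l : ℕ} (hi : i' = i + k') (hk : k < k')
    (hl : k' + l < m) : Disjoint (arc f i k) (arc f i' l) := by
  rw [Finset.disjoint_left]
  intro v hv hv'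
  obtain ⟨a, ha, rfl⟩ := mem_arc.1 hv
  obtain ⟨b, hb, he⟩ := mem_arc.1 hv'
  have he' := hf.inj he
  rw [hi, add_assoc, ← Nat.cast_add] at he'
  have := add_natCast_inj (by omega) (by omega) he'
  omega

omit [DecidableEq V] in
theorem card_le [Fintype V] : m ≤ Fintype.card V := by
  have : NeZero m := ⟨by have := hf.three_le; omega⟩
  simpa using Fintype.card_le_of_injective f hf.inj

/-- Closing up a path outside of the cycle by an arc of the cycle. -/
theorem hasCycle_of_hasPath {T : Finset V} {u v : V} {n k : ℕ} {i : ZMod m}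
    (hT : ∀ w ∈ T, ∀ i, w ≠ f i) (hp : HasPath G T u v n) (hu : G.Adj u (f i))
    (hv : G.Adj v (f (i + k))) (hk0 : 0 < k) (hk : k < m) : HasCycle G (n + (m - k) + 2) := by
  refine hp.hasCycle (hf.hasPath_arc (i := i + k) (k := m - k) (by omega)) ?_ hv ?_ (by omega)
  · rw [Finset.disjoint_left]
    intro w hw hw'
    obtain ⟨j, -, rfl⟩ := mem_arc.1 hw'
    exact hT _ hw _ rfl
  · rw [add_assoc, ← Nat.cast_add, Nat.add_sub_cancel' hk.le]
    simpa using hu.symm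

theorem hasCycle_of_chord {i : ZMod m} {j : ℕ} (h : G.Adj (f i) (f (i + j))) (hj : 2 ≤ j)
    (hjm : j < m) : HasCycle G (j + 1) :=
  (hf.hasPath_arc hjm).exists_cycle hj h.symm

theorem hasCycle_of_two_chords {i : ZMod m} {j k : ℕ} (h : G.Adj (f i) (f (i + j)))
    (h' : G.Adj (f (i + 1)) (f (i + 1 + k))) (hj : 2 ≤ j) (hjk : j ≤ k) (hk : k + 1 < m) :
    HasCycle G (j + (m - k)) := by
  obtain ⟨j, rfl⟩ := Nat.exists_eq_add_of_le' (show 1 ≤ j by omega)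
  have h1 := (hf.hasPath_arc (i := i + 1) (k := j) (by omega)).symm
  have h2 := hf.hasPath_arc (i := i + 1 + k) (k := m - k - 1) (by omega)
  have h3 := h1.hasCycle h2 (hf.disjoint_arc rfl (by omega) (by omega)) h' (by
    rw [show i + 1 + (j : ZMod m) = i + (j + 1 : ℕ) by push_cast; ring,
      show i + 1 + (k : ZMod m) + ((m - k - 1 : ℕ) : ZMod m) = i by
        rw [add_assoc, add_assoc, ← Nat.cast_add, ← Nat.cast_one, ← Nat.cast_add,
          show 1 + (k + (m - k - 1)) = m by omega]
        simp]
    exact h) (by omega)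
  rwa [show j + (m - k - 1) + 2 = j + 1 + (m - k) by omega] at h3

/-- Two vertices outside of the cycle can be inserted into two different edges. -/
theorem hasCycle_of_insert_two {v w : V} {i j : ZMod m} (hvw : v ≠ w) (hv : ∀ i, v ≠ f i)
    (hw : ∀ i, w ≠ f i) (hij : i ≠ j) (hvi : G.Adj v (f i)) (hvi' : G.Adj v (f (i + 1)))
    (hwj : G.Adj w (f j)) (hwj' : G.Adj w (f (j + 1))) : HasCycle G (m + 2) := by
  have : NeZero m := ⟨by have := hf.three_le; omega⟩
  obtain ⟨k, hk0, hk, rfl⟩ := ZMod.exists_add_natCast hij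
  have hva : ∀ i k, v ∉ arc f i k := fun i k h => by
    obtain ⟨j, -, h⟩ := mem_arc.1 h
    exact hv _ h.symm
  have hwa : ∀ i k, w ∉ arc f i k := fun i k h => by
    obtain ⟨j, -, h⟩ := mem_arc.1 h
    exact hw _ h.symm
  have h1 := (hf.hasPath_arc (i := i + 1) (k := k - 1) (by omega)).snoc (c := w) (by
    rw [add_assoc, ← Nat.cast_one, ← Nat.cast_add, show 1 + (k - 1) = k by omega]
    exact hwj.symm) (hwa _ _)
  have h2 := (hf.hasPath_arc (i := i + k + 1) (k := m - k - 1) (by omega)).snoc (c := v) (by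
    rw [add_assoc, add_assoc, ← Nat.cast_one, ← Nat.cast_add, ← Nat.cast_add,
      show k + (1 + (m - k - 1)) = m by omega]
    simpa using hvi.symm) (hva _ _)
  have h3 := h1.hasCycle h2 (by
    simp only [Finset.disjoint_insert_left, Finset.disjoint_insert_right, Finset.mem_insert,
      not_or]
    exact ⟨⟨hvw, hva _ _⟩, hwa _ _,
      hf.disjoint_arc (k' := k) (by ring) (by omega) (by omega)⟩) hwj' hvi' (by omega)
  rwa [show k - 1 + 1 + (m - k - 1 + 1) + 2 = m + 2 by omega] at h3

end IsCyc

end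

section

variable {V : Type*} [Fintype V] {G : SimpleGraph V}

theorem TwoConnected.exists_adj (h : TwoConnected G) {K : Finset V} {q : V} (hK : K.Nonempty)
    (hq : q ∉ K) (hw : ∃ w, w ∉ K ∧ w ≠ q) : ∃ v ∈ K, ∃ w, G.Adj v w ∧ w ∉ K ∧ w ≠ q := by
  by_contra! hno
  obtain ⟨a, ha⟩ := hK
  obtain ⟨w, hwK, hwq⟩ := hw
  have key : ∀ x y : {u | u ≠ q}, (G.induce {u | u ≠ q}).Walk x y → (x : V) ∈ K → (y : V) ∈ K := by
    intro x y p
    induction p with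
    | nil => exact id
    | @cons x z y hxz p ih =>
      intro hx
      refine ih ?_
      by_contra hz
      exact z.2 (hno x hx z hxz hz)
  obtain ⟨p⟩ := (h.2 q).preconnected ⟨a, fun h => hq (h ▸ ha)⟩ ⟨w, hwq⟩
  exact hwK (key _ _ p ha)

variable [DecidableEq V] {m : ℕ} {f : ZMod m → V} {r κ : ℕ}

theorem exists_offComponent {v w : V} (hv : ∀ i, v ≠ f i) (hw : ∀ i, w ≠ f i) (hvw : G.Adj v w) :
    ∃ H, OffComponent G f H := by
  classical
  let O : Finset V := Finset.univ.filter fun w => ∀ i, w ≠ f i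
  have hO : ∀ w, w ∈ O ↔ ∀ i, w ≠ f i := by simp [O]
  let H : Finset V := O.filter fun w => Reach G O v w
  have hH : ∀ w, w ∈ H ↔ w ∈ O ∧ Reach G O v w := by simp [H]
  have hvO : v ∈ O := (hO v).2 hv
  have hstep : ∀ x ∈ H, ∀ y ∈ O, G.Adj x y → y ∈ H := fun x hx y hy hxy =>
    (hH y).2 ⟨hy, ((hH x).1 hx).2.trans (.adj hxy ((hH x).1 hx).1 hy)⟩
  have hvH : v ∈ H := (hH v).2 ⟨hvO, .refl⟩
  have hreach : ∀ x ∈ H, Reach G H v x := fun x hx =>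
    (((hH x).1 hx).2.mem_of_closed (P := fun x => x ∈ H ∧ Reach G H v x) ⟨hvH, .refl⟩
      fun x y hx hxy _ hy => by
        have := hstep x hx.1 y hy hxy
        exact ⟨this, hx.2.trans (.adj hxy hx.1 this)⟩).2
  refine ⟨H, fun x hx => (hO x).1 ((hH x).1 hx).1, fun x hx y hxy => ?_,
    fun x hx y hy => (hreach x hx).symm.trans (hreach y hy),
    v, hvH, w, hstep v hvH w ((hO w).2 hw) hvw, hvw.ne⟩
  by_cases hy : y ∈ O
  · exact Or.inl (hstep x hx y hy hxy)
  · rw [hO] at hy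
    push Not at hy
    exact Or.inr hy

variable [DecidableRel G.Adj] [NeZero m]

omit [DecidableEq V] in
theorem dg_univ (v : V) : dg G Finset.univ v = G.degree v := by
  rw [dg, ← G.card_neighborFinset_eq_degree, neighborFinset_eq_filter]

theorem IsCyc.farApart (hf : IsCyc G f) (hm : m % 2 = 1)
    (hmax : ∀ n, HasCycle G n → n % 2 = (κ + 1) % 2 → n + κ ≤ m)
    {T : Finset V} {u v : V} {n : ℕ} (hT : ∀ w ∈ T, ∀ i, w ≠ f i) (hp : HasPath G T u v n) :
    FarApart (att G f u) (att G f v) (n + 2 + κ) := by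
  intro k hk0 hk hpar
  constructor
  · intro i hi hi'
    have := hmax _ (hf.hasCycle_of_hasPath hT hp (mem_att.1 hi) (mem_att.1 hi') hk0 hk) (by omega)
    omega
  · intro i hi hi'
    have := hmax _ (hf.hasCycle_of_hasPath hT hp.symm (mem_att.1 hi) (mem_att.1 hi') hk0 hk)
      (by omega)
    omega

theorem IsCyc.extremalCycle (hf : IsCyc G f) (h2c : TwoConnected G) (hr : 3 ≤ r)
    (hdeg : r ≤ G.minDegree) (hm : m % 2 = 1)
    (hsize : (κ = 0 ∧ m + 3 ≤ 2 * r) ∨ (κ % 2 = 1 ∧ m + 2 = 2 * r + κ))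
    (hmax : ∀ n, HasCycle G n → n % 2 = (κ + 1) % 2 → n + κ ≤ m) : ExtremalCycle G f r κ where
  three_le := hr
  three_le_m := hf.three_le
  odd := hm
  inj := hf.inj
  size := hsize
  deg v := by
    rw [dg_univ]
    exact hdeg.trans (G.minDegree_le_degree v)
  sep K q hK hq hw := h2c.exists_adj hK hq hw
  far T u v n hT hp := hf.farApart hm hmax hT hp

theorem le_card_att {v : V} (hdeg : r ≤ G.minDegree) (hv : ∀ w, (∀ i, w ≠ f i) → ¬ G.Adj v w) :
    r ≤ (att G f v).card := by
  refine (hdeg.trans (G.minDegree_le_degree v)).trans ?_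
  rw [← dg_univ]
  refine (dg_le_card (E := (att G f v).image f) fun w _ hvw => ?_).trans Finset.card_image_le
  have : ∃ i, w = f i := by
    by_contra! h
    exact hv w h hvw
  obtain ⟨i, rfl⟩ := this
  exact Finset.mem_image_of_mem f (mem_att.2 hvw)

/-- If `A` has at least `r` elements, then it contains many pairs of consecutive elements. -/
theorem card_consecutive {A : Finset (ZMod m)} (hA : r ≤ A.card) :
    2 * r ≤ m + (A.filter fun i => i + 1 ∈ A).card := by
  have h1 := Finset.card_union_add_card_inter A (A.image (· - 1))
  have h2 := Finset.card_le_univ (A ∪ A.image (· - 1))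
  rw [ZMod.card] at h2
  rw [Finset.card_image_of_injective _ (sub_left_injective (b := (1 : ZMod m)))] at h1
  have h3 : A ∩ A.image (· - 1) = A.filter fun i => i + 1 ∈ A := by
    ext i
    simp only [Finset.mem_inter, Finset.mem_image, Finset.mem_filter, and_congr_right_iff]
    refine fun _ => ⟨?_, fun h => ⟨i + 1, h, by ring⟩⟩
    rintro ⟨j, hj, rfl⟩
    simpa using hj
  rw [h3] at h1
  omega

theorem exists_odd_cycle_ge (h2c : TwoConnected G) (hnb : ¬ IsBip G) (hr : 3 ≤ r)
    (hdeg : r ≤ G.minDegree) (hcard : 2 * r + 1 ≤ Fintype.card V) :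
    ∃ n, n % 2 = 1 ∧ 2 * r - 1 ≤ n ∧ HasCycle G n := by
  classical
  obtain ⟨n, hn1, hn⟩ := exists_odd_cycle hnb
  have hbound : ∀ n, HasCycle G n → n ≤ Fintype.card V := fun n h => by
    obtain ⟨f, hf⟩ := h.exists_isCyc
    exact hf.card_le
  set P : ℕ → Prop := fun n => n % 2 = 1 ∧ HasCycle G n with hP
  have hspec : P (Nat.findGreatest P (Fintype.card V)) :=
    Nat.findGreatest_spec (hbound n hn) ⟨hn1, hn⟩
  have hgr : ∀ k, P k → k ≤ Nat.findGreatest P (Fintype.card V) := fun k hk =>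
    Nat.le_findGreatest (hbound k hk.2) hk
  generalize Nat.findGreatest P (Fintype.card V) = m at hspec hgr
  obtain ⟨hm, hmc⟩ := hspec
  obtain ⟨f, hf⟩ := hmc.exists_isCyc
  have h3 := hf.three_le
  have : NeZero m := ⟨by omega⟩
  refine ⟨m, hm, ?_, hmc⟩
  by_contra hlt
  have hext : ExtremalCycle G f r 0 := hf.extremalCycle h2c hr hdeg hm (Or.inl ⟨rfl, by omega⟩)
    fun n hn hn1 => hgr n ⟨hn1, hn⟩
  have hiso : ∀ v w, (∀ i, v ≠ f i) → (∀ i, w ≠ f i) → ¬ G.Adj v w := by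
    intro v w hv hw hvw
    obtain ⟨H, hH⟩ := exists_offComponent hv hw hvw
    exact hext.false_of_offComponent hH
  have houtside : 1 < (Finset.univ \ Finset.univ.image f).card := by
    have h1 : (Finset.univ.image f).card ≤ m := Finset.card_image_le.trans (by simp)
    have h2 := Finset.le_card_sdiff (Finset.univ.image f) Finset.univ
    rw [Finset.card_univ] at h2
    omega
  obtain ⟨v, hv, w, hw, hvw⟩ := Finset.one_lt_card.1 houtside
  simp only [Finset.mem_sdiff, Finset.mem_univ, true_and, Finset.mem_image, not_exists,
    eq_comm (a := f _)] at hv hw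
  have hv' := card_consecutive (le_card_att hdeg (hiso v · hv))
  have hw' := card_consecutive (le_card_att hdeg (hiso w · hw))
  obtain ⟨i, hi⟩ := Finset.card_pos.1 (show 0 < ((att G f v).filter fun i => i + 1 ∈ att G f v).card by omega)
  obtain ⟨j, hj, hji⟩ := Finset.exists_mem_ne 
    (show 1 < ((att G f w).filter fun i => i + 1 ∈ att G f w).card by omega) i
  rw [Finset.mem_filter, mem_att, mem_att] at hi hj
  have := hgr (m + 2) ⟨by omega, hf.hasCycle_of_insert_two hvw hv hw hji.symm hi.1 hi.2 hj.1 hj.2⟩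
  omega

/-- The steps `j` of the chords from `f i` to `f (i + j)`. -/
def chords (G : SimpleGraph V) [DecidableRel G.Adj] (f : ZMod m → V) (i : ZMod m) : Finset ℕ :=
  (Finset.range m).filter fun j => 2 ≤ j ∧ j + 2 ≤ m ∧ G.Adj (f i) (f (i + (j : ℕ)))

omit [Fintype V] [DecidableEq V] [NeZero m] in
theorem mem_chords {i : ZMod m} {j : ℕ} :
    j ∈ chords G f i ↔ j < m ∧ 2 ≤ j ∧ j + 2 ≤ m ∧ G.Adj (f i) (f (i + (j : ℕ))) := by
  simp [chords]

theorem le_card_chords (hf : Function.Surjective f) (hm : 3 ≤ m) (hdeg : r ≤ G.minDegree)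
    (i : ZMod m) : r ≤ (chords G f i).card + 2 := by
  refine (hdeg.trans (G.minDegree_le_degree (f i))).trans ?_
  rw [← dg_univ]
  refine (dg_le_card (E := ((chords G f i) ∪ {1, m - 1}).image fun j : ℕ => f (i + j))
    fun w _ hvw => ?_).trans (Finset.card_image_le.trans ((Finset.card_union_le _ _).trans
      (Nat.add_le_add_left Finset.card_le_two _)))
  obtain ⟨j, rfl⟩ := hf w
  obtain ⟨k, hk0, hk, rfl⟩ := ZMod.exists_add_natCast (show i ≠ j by rintro rfl; exact hvw.ne rfl)
  refine Finset.mem_image.2 ⟨k, ?_, rfl⟩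
  rw [Finset.mem_union, mem_chords, Finset.mem_insert, Finset.mem_singleton]
  by_cases h1 : k = 1
  · exact Or.inr (Or.inl h1)
  by_cases h2 : k = m - 1
  · exact Or.inr (Or.inr h2)
  exact Or.inl ⟨hk, by omega, by omega, hvw⟩

/-- An odd hamiltonian cycle produces a slightly shorter cycle. -/
theorem IsCyc.exists_shorter (hf : IsCyc G f) (hsurj : Function.Surjective f) (hr : 3 ≤ r)
    (hdeg : r ≤ G.minDegree) (hm : m % 2 = 1) (hmr : 2 * r + 1 ≤ m) :
    ∃ n, 2 * r - 1 ≤ n ∧ n < m ∧ HasCycle G n := by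
  by_contra! hno
  obtain ⟨t, ht⟩ : ∃ t, m = 2 * r + 1 + 2 * t := ⟨(m - (2 * r + 1)) / 2, by omega⟩
  have hrange : ∀ i, ∀ j ∈ chords G f i, 2 * t + 4 ≤ j ∧ j + 3 ≤ 2 * r := by
    intro i j hj
    rw [mem_chords] at hj
    constructor
    · by_contra hlt
      refine hno (m - j + 1) (by omega) (by omega)
        (hf.hasCycle_of_chord (i := i + j) ?_ (by omega) (by omega))
      rw [add_assoc, ← Nat.cast_add, Nat.add_sub_cancel' hj.1.le]
      simpa using hj.2.2.2.symm
    · by_contra hlt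
      exact hno (j + 1) (by omega) (by omega)
        (hf.hasCycle_of_chord hj.2.2.2 hj.2.1 hj.1)
  have hX := le_card_chords hsurj (by omega) hdeg (0 : ZMod m)
  have hY := le_card_chords hsurj (by omega) hdeg (1 : ZMod m)
  have hcross : ∀ j ∈ chords G f 0, ∀ k ∈ chords G f 1, j + 1 ≠ k ∧ j + 2 ≠ k := by
    intro j hj k hk
    have := hrange _ k hk
    rw [mem_chords] at hj hk
    have key : j ≤ k → HasCycle G (j + (m - k)) := fun hjk =>
      hf.hasCycle_of_two_chords (i := 0) hj.2.2.2 (by simpa using hk.2.2.2) hj.2.1 hjk (by omega)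
    constructor
    · rintro rfl
      exact hno _ (by omega) (by omega) (key (by omega))
    · rintro rfl
      exact hno _ (by omega) (by omega) (key (by omega))
  have hr0 := hrange 0
  have hr1 := hrange 1
  generalize chords G f 0 = X at *
  generalize chords G f 1 = Y at *
  obtain ⟨x, hx, hxmax⟩ := X.exists_max_image id (Finset.card_pos.1 (by omega))
  have hZ : (insert (x + 2) (X.image (· + 1))).card = X.card + 1 := by
    rw [Finset.card_insert_of_notMem, Finset.card_image_of_injective _ (add_left_injective 1)]
    rw [Finset.mem_image]
    rintro ⟨y, hy, hyx⟩
    have := hxmax y hy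
    simp only [id] at this
    omega
  have hdisj : Disjoint (insert (x + 2) (X.image (· + 1))) Y := by
    rw [Finset.disjoint_left]
    intro y hy hyY
    rw [Finset.mem_insert, Finset.mem_image] at hy
    rcases hy with rfl | ⟨z, hz, rfl⟩
    · exact (hcross x hx _ hyY).2 rfl
    · exact (hcross z hz _ hyY).1 rfl
  have hsub : insert (x + 2) (X.image (· + 1)) ∪ Y ⊆ Finset.Icc (2 * t + 4) (2 * r - 1) := by
    intro y hy
    rw [Finset.mem_union, Finset.mem_insert, Finset.mem_image] at hy
    rw [Finset.mem_Icc]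
    rcases hy with (rfl | ⟨z, hz, rfl⟩) | hy
    · have := hr0 x hx
      omega
    · have := hr0 z hz
      omega
    · have := hr1 y hy
      omega
  have := Finset.card_le_card hsub
  rw [Finset.card_union_of_disjoint hdisj, hZ, Nat.card_Icc] at this
  omega

theorem exists_even_cycle_ge (h2c : TwoConnected G) (hnb : ¬ IsBip G) (hr : 3 ≤ r)
    (hdeg : r ≤ G.minDegree) (hcard : 2 * r + 1 ≤ Fintype.card V) :
    ∃ n, n % 2 = 0 ∧ 2 * r ≤ n ∧ HasCycle G n := by
  by_contra! hno
  have hspan : ∀ m, m % 2 = 1 → 2 * r - 1 ≤ m → HasCycle G m → m = Fintype.card V := by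
    intro m hm hmr hmc
    obtain ⟨f, hf⟩ := hmc.exists_isCyc
    have h3 := hf.three_le
    have : NeZero m := ⟨by omega⟩
    by_contra hne
    have hle := hf.card_le
    obtain ⟨κ, hκ⟩ : ∃ κ, m + 2 = 2 * r + κ := ⟨m + 2 - 2 * r, by omega⟩
    have hext : ExtremalCycle G f r κ := hf.extremalCycle h2c hr hdeg hm
      (Or.inr ⟨by omega, hκ⟩) fun n hn hn0 => by
        by_contra hlt
        exact hno n (by omega) (by omega) hn
    obtain ⟨v, hv⟩ : ∃ v, ∀ i, v ≠ f i := by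
      by_contra! hsurj
      have := Fintype.card_le_of_surjective f fun v => (hsurj v).imp fun _ h => h.symm
      rw [ZMod.card] at this
      omega
    have hiso : ∀ w, (∀ i, w ≠ f i) → ¬ G.Adj v w := by
      intro w hw hvw
      obtain ⟨H, hH⟩ := exists_offComponent hv hw hvw
      exact hext.false_of_offComponent hH
    have hs := le_card_att hdeg hiso
    have hfar := hext.far {v} v v 0 (by simpa using hv) (HasPath.refl (by simp))
    rcases hfar.card hm (by omega) (ExtremalCycle.exists_ne_of_two_le (by omega) (by omega)) with
      h | ⟨-, h, -⟩ | ⟨-, h, -⟩ <;> omega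
  obtain ⟨m, hm, hmr, hmc⟩ := exists_odd_cycle_ge h2c hnb hr hdeg hcard
  have hmV := hspan m hm hmr hmc
  obtain ⟨f, hf⟩ := hmc.exists_isCyc
  have h3 := hf.three_le
  have : NeZero m := ⟨by omega⟩
  have hsurj : Function.Surjective f :=
    ((Fintype.bijective_iff_injective_and_card f).2 ⟨hf.inj, by rw [ZMod.card, hmV]⟩).2
  obtain ⟨n, hn, hnm, hnc⟩ := hf.exists_shorter hsurj hr hdeg hm (by omega)
  rcases Nat.mod_two_eq_zero_or_one n with hp | hp
  · exact hno n hp (by omega) hnc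
  · have := hspan n hp hn hnc
    omega

end

/-- Let `r ≥ 3` and let `G` be a 2-connected non-bipartite graph with `δ(G) ≥ r` and
`|V(G)| ≥ 2r + 1`. Then `G` contains an even cycle of length at least `2r` and an odd
cycle of length at least `2r − 1`. -/
theorem statement16 {V : Type*} [Fintype V] (r : ℕ) (hr : 3 ≤ r)
    (G : SimpleGraph V) [DecidableRel G.Adj]
    (h2c : TwoConnected G) (hnb : ¬ IsBip G)
    (hdeg : r ≤ G.minDegree) (hcard : 2 * r + 1 ≤ Fintype.card V) :
    (∃ (v : V) (c : G.Walk v v), c.IsCycle ∧ Even c.length ∧ 2 * r ≤ c.length) ∧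
    (∃ (v : V) (c : G.Walk v v), c.IsCycle ∧ Odd c.length ∧ 2 * r - 1 ≤ c.length) := by
  classical
  constructor
  · obtain ⟨n, hn, hnr, v, c, hc, rfl⟩ := exists_even_cycle_ge h2c hnb hr hdeg hcard
    exact ⟨v, c, hc, Nat.even_iff.2 hn, hnr⟩
  · obtain ⟨n, hn, hnr, v, c, hc, rfl⟩ := exists_odd_cycle_ge h2c hnb hr hdeg hcard
    exact ⟨v, c, hc, Nat.odd_iff.2 hn, hnr⟩
end

section
/- For every ε > 0 there exists a constant K = K(ε) ∈ (0, ∞) such that every graph G on n vertices with n ≥ 45K/ε⁴ and minimum degree δ(G) ≥ εn contains a cycle of length m for every even integer m with 4 ≤ m ≤ ec(G) − K and for every odd integer m with K ≤ m ≤ oc(G) − K, where ec(G) and oc(G) denote the maximum lengths of an even cycle and of an odd cycle in G respectively. -/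
open SimpleGraph

/-- The even circumference of `G`: the maximum length of an even cycle in `G`. -/
noncomputable def evenCirc {V : Type*} (G : SimpleGraph V) : ℕ :=
  sSup {L : ℕ | Even L ∧ ∃ (v : V) (c : G.Walk v v), c.IsCycle ∧ c.length = L}

/-- The odd circumference of `G`: the maximum length of an odd cycle in `G`. -/
noncomputable def oddCirc {V : Type*} (G : SimpleGraph V) : ℕ :=
  sSup {L : ℕ | Odd L ∧ ∃ (v : V) (c : G.Walk v v), c.IsCycle ∧ c.length = L}

/-- In a graph of linear minimum degree, every large enough set of vertices contains `k` vertices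
with linearly many common neighbors. -/
lemma exists_common_neighbors (d k : ℕ) (hd : 0 < d) (hk : 0 < k) :
    ∃ w D : ℕ, 0 < D ∧ k ≤ w ∧ ∀ (V : Type) [Fintype V] [DecidableEq V] (G : SimpleGraph V)
      [DecidableRel G.Adj], (∀ v, Fintype.card V ≤ d * G.degree v) →
      ∀ U : Finset V, U.card = w → ∃ T ⊆ U, T.card = k ∧
        Fintype.card V ≤ D * (Finset.univ.filter fun x => ∀ t ∈ T, G.Adj t x).card := by
  refine ⟨2 * d * k, 2 * d * (2 * d * k).choose k, ?_, by nlinarith, ?_⟩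
  · have : 0 < (2 * d * k).choose k := Nat.choose_pos (by nlinarith)
    positivity
  intro V _ _ G _ hdeg U hU
  set cn : Finset V → Finset V := fun T => Finset.univ.filter fun x => ∀ t ∈ T, G.Adj t x with hcn
  set X : Finset V := Finset.univ.filter fun x => k ≤ (U.filter fun u => G.Adj u x).card with hX
  have hdc : ∑ u ∈ U, G.degree u = ∑ x : V, (U.filter fun u => G.Adj u x).card := by
    have := Finset.sum_card_bipartiteAbove_eq_sum_card_bipartiteBelow (s := U)
      (t := (Finset.univ : Finset V)) G.Adj
    refine (Finset.sum_congr rfl fun u _ => ?_).trans this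
    rw [← G.card_neighborFinset_eq_degree]
    congr 1
    ext x
    simp [Finset.bipartiteAbove]
  have h1 : (2 * d * k) * Fintype.card V ≤ d * ∑ u ∈ U, G.degree u := by
    rw [Finset.mul_sum, ← hU, ← smul_eq_mul]
    exact Finset.card_nsmul_le_sum _ _ _ fun u _ => hdeg u
  have h2 : ∑ x : V, (U.filter fun u => G.Adj u x).card
      ≤ X.card * (2 * d * k) + Fintype.card V * k := by
    have : ∀ x : V, (U.filter fun u => G.Adj u x).card
        ≤ (if x ∈ X then 2 * d * k else 0) + k := by
      intro x
      split_ifs with h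
      · have := Finset.card_filter_le U fun u => G.Adj u x
        omega
      · simp [hX] at h
        omega
    refine (Finset.sum_le_sum fun x _ => this x).trans ?_
    rw [Finset.sum_add_distrib]
    simp [Finset.sum_ite_mem]
  have h3 : Fintype.card V ≤ 2 * d * X.card := by
    rw [hdc] at h1
    have h4 := h1.trans (Nat.mul_le_mul_left d h2)
    have : (d * k) * Fintype.card V ≤ (d * k) * (2 * d * X.card) := by nlinarith
    exact Nat.le_of_mul_le_mul_left this (by positivity)
  have h4 : X.card ≤ ∑ T ∈ U.powersetCard k, (cn T).card := by
    refine (Finset.card_le_card ?_).trans Finset.card_biUnion_le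
    intro x hx
    simp only [hX, Finset.mem_filter, Finset.mem_univ, true_and] at hx
    obtain ⟨T, hT, hTk⟩ := Finset.exists_subset_card_eq hx
    rw [Finset.mem_biUnion]
    refine ⟨T, Finset.mem_powersetCard.2 ⟨hT.trans (Finset.filter_subset _ _), hTk⟩, ?_⟩
    simp only [hcn, Finset.mem_filter, Finset.mem_univ, true_and]
    exact fun t ht => (Finset.mem_filter.1 (hT ht)).2
  have h5 : ∑ T ∈ U.powersetCard k, Fintype.card V
      ≤ ∑ T ∈ U.powersetCard k, 2 * d * (2 * d * k).choose k * (cn T).card := by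
    rw [← Finset.mul_sum, Finset.sum_const, Finset.card_powersetCard, hU, smul_eq_mul]
    calc _ ≤ (2 * d * k).choose k * (2 * d * ∑ T ∈ U.powersetCard k, (cn T).card) :=
          Nat.mul_le_mul_left _ (h3.trans (Nat.mul_le_mul_left _ h4))
      _ = _ := by ring
  obtain ⟨T, hT, hle⟩ := Finset.exists_le_of_sum_le
    (Finset.powersetCard_nonempty.2 (by rw [hU]; nlinarith)) h5
  exact ⟨T, (Finset.mem_powersetCard.1 hT).1, (Finset.mem_powersetCard.1 hT).2, hle⟩

/-- A long path has `k` vertices at even positions near its start that are joined completely either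
to `k` vertices off the path or to `k` vertices lying close together on the path. -/
lemma exists_attached_indices (d k : ℕ) (hd : 0 < d) (hk : 0 < k) :
    ∃ W B : ℕ, 0 < W ∧ ∀ q : ℕ, ∃ N : ℕ, ∀ (V : Type) [Fintype V] [DecidableEq V] (G : SimpleGraph V)
      [DecidableRel G.Adj], (∀ v, Fintype.card V ≤ d * G.degree v) → N ≤ Fintype.card V →
      ∀ l : List V, l.Nodup → W ≤ l.length → ∀ Q : Finset V, Q.card ≤ q →
      ∃ I : Finset ℕ, I.card = k ∧ (∀ i ∈ I, i < W ∧ Even i) ∧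
        ((∃ X : Finset V, X.card = k ∧ (∀ x ∈ X, x ∉ l ∧ x ∉ Q) ∧
            ∀ i ∈ I, ∀ x ∈ X, ∀ u, l[i]? = some u → G.Adj u x) ∨
          (∃ J : Finset ℕ, J.card = k ∧ (∀ j ∈ J, W ≤ j ∧ j < l.length) ∧
            (∀ j ∈ J, ∀ j' ∈ J, j ≤ j' + B ∧ Even (j + j')) ∧
            ∀ i ∈ I, ∀ j ∈ J, ∀ u v, l[i]? = some u → l[j]? = some v → G.Adj u v)) := by
  obtain ⟨w, D, hD, hkw, H⟩ := exists_common_neighbors d k hd hk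
  refine ⟨2 * w, 4 * k * D, by omega, fun q => ⟨2 * D * (3 * k + q + 2 * w), ?_⟩⟩
  intro V _ _ G _ hdeg hN l hl hlen Q hQ
  have hne : 0 < l.length := by omega
  set f : ℕ → V := fun i => l.getD i l[0] with hf
  have hfs : ∀ i u, l[i]? = some u → f i = u := by intro i u h; simp [hf, h]
  have hfm : ∀ x ∈ l, ∃ i < l.length, f i = x := by
    intro x hx
    obtain ⟨i, hi, rfl⟩ := List.getElem_of_mem hx
    exact ⟨i, hi, by simp [hf, hi]⟩
  have hinj : ∀ i < l.length, ∀ j < l.length, f i = f j → i = j := by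
    intro i hi j hj h
    simp only [hf, List.getD_eq_getElem _ _ hi, List.getD_eq_getElem _ _ hj] at h
    exact (hl.getElem_inj_iff).1 h
  obtain ⟨T, hTU, hTk, hT⟩ := H V G hdeg ((Finset.range w).image fun i => f (2 * i)) (by
    rw [Finset.card_image_of_injOn, Finset.card_range]
    intro i hi j hj h
    simp only [Finset.coe_range, Set.mem_Iio] at hi hj
    have := hinj (2 * i) (by omega) (2 * j) (by omega) h
    omega)
  set I := (Finset.range (2 * w)).filter fun i => Even i ∧ f i ∈ T with hI
  have hIT : I.image f = T := by
    ext x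
    simp only [hI, Finset.mem_image, Finset.mem_filter, Finset.mem_range]
    constructor
    · rintro ⟨i, ⟨_, _, h⟩, rfl⟩
      exact h
    · intro hx
      obtain ⟨i, hi, rfl⟩ := Finset.mem_image.1 (hTU hx)
      rw [Finset.mem_range] at hi
      exact ⟨2 * i, ⟨by omega, by simp, hx⟩, rfl⟩
  refine ⟨I, ?_, ?_, ?_⟩
  · rw [← hTk, ← hIT, Finset.card_image_of_injOn]
    intro i hi j hj h
    simp only [hI, Finset.coe_filter, Finset.mem_range, Set.mem_ofPred_eq] at hi hj
    exact hinj i (by omega) j (by omega) h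
  · intro i hi
    simp only [hI, Finset.mem_filter, Finset.mem_range] at hi
    exact ⟨hi.1, hi.2.1⟩
  set C := Finset.univ.filter fun x => ∀ t ∈ T, G.Adj t x with hC
  have hIC : ∀ i ∈ I, ∀ x ∈ C, G.Adj (f i) x := by
    intro i hi x hx
    exact (Finset.mem_filter.1 hx).2 _ (Finset.mem_filter.1 hi).2.2
  set Y := (C \ Q) \ (Finset.range (2 * w)).image f with hY
  have hYc : C.card ≤ Y.card + q + 2 * w := by
    have h1 := Finset.le_card_sdiff Q C
    have h2 := Finset.le_card_sdiff ((Finset.range (2 * w)).image f) (C \ Q)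
    have h3 : ((Finset.range (2 * w)).image f).card ≤ 2 * w :=
      Finset.card_image_le.trans (by simp)
    rw [← hY] at h2
    omega
  by_cases hoff : k ≤ (Y.filter fun x => x ∉ l).card
  · left
    obtain ⟨X, hX, hXk⟩ := Finset.exists_subset_card_eq hoff
    refine ⟨X, hXk, fun x hx => ?_, fun i hi x hx u hu => ?_⟩
    · have := hX hx
      simp only [hY, Finset.mem_filter, Finset.mem_sdiff] at this
      exact ⟨this.2, this.1.1.2⟩
    · have := hX hx
      simp only [hY, Finset.mem_filter, Finset.mem_sdiff] at this
      rw [← hfs i u hu]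
      exact hIC i hi x this.1.1.1
  · right
    set Z := (Finset.range l.length).filter fun j => 2 * w ≤ j ∧ f j ∈ C with hZ
    have hZc : (Y.filter fun x => x ∈ l).card ≤ Z.card := by
      refine (Finset.card_le_card ?_).trans (Finset.card_image_le (s := Z) (f := f))
      intro x hx
      simp only [hY, Finset.mem_filter, Finset.mem_sdiff, Finset.mem_image, Finset.mem_range,
        not_exists, not_and] at hx
      obtain ⟨⟨⟨hxC, _⟩, hxw⟩, hxl⟩ := hx
      obtain ⟨j, hj, rfl⟩ := hfm x hxl
      refine Finset.mem_image.2 ⟨j, Finset.mem_filter.2 ⟨Finset.mem_range.2 hj, ?_, hxC⟩, rfl⟩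
      by_contra hlt
      exact hxw j (by omega) rfl
    have hsplit := Finset.card_filter_add_card_filter_not (s := Y) (fun x => x ∈ l)
    have hln : l.length ≤ Fintype.card V := hl.length_le_card
    set n := Fintype.card V with hn
    have hbig : (n / (4 * k * D) + 1) * 2 * k ≤ Z.card := by
      have h1 : C.card ≤ Z.card + k + q + 2 * w := by omega
      have h2 : n / (4 * k * D) * (4 * k * D) ≤ n := Nat.div_mul_le_self _ _
      have h3 : n ≤ D * (Z.card + k + q + 2 * w) := hT.trans (Nat.mul_le_mul_left _ h1)
      set e := n / (4 * k * D)
      have : D * ((e + 1) * 2 * k) ≤ D * Z.card := by nlinarith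
      exact Nat.le_of_mul_le_mul_left this hD
    obtain ⟨y, _, hy⟩ := Finset.exists_le_card_fiber_of_mul_le_card_of_maps_to
      (s := Z) (t := Finset.range (n / (4 * k * D) + 1) ×ˢ Finset.range 2)
      (f := fun j => (j / (4 * k * D), j % 2)) (n := k) (by
        intro j hj
        simp only [hZ, Finset.mem_filter, Finset.mem_range] at hj
        simp only [Finset.mem_product, Finset.mem_range]
        exact ⟨Nat.lt_succ_of_le (Nat.div_le_div_right (by omega)), Nat.mod_lt _ (by omega)⟩)
      (by simp) (by simpa using hbig)
    obtain ⟨J, hJ, hJk⟩ := Finset.exists_subset_card_eq hy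
    have hJ' : ∀ j ∈ J, j < l.length ∧ 2 * w ≤ j ∧ f j ∈ C ∧ j / (4 * k * D) = y.1 ∧ j % 2 = y.2 := by
      intro j hj
      have := hJ hj
      simp only [hZ, Finset.mem_filter, Finset.mem_range, Prod.ext_iff] at this
      tauto
    refine ⟨J, hJk, fun j hj => ⟨(hJ' j hj).2.1, (hJ' j hj).1⟩, fun j hj j' hj' => ⟨?_, ?_⟩, ?_⟩
    · have h1 := (hJ' j hj).2.2.2.1
      have h2 := (hJ' j' hj').2.2.2.1
      have hp : 0 < 4 * k * D := by positivity
      have h3 := Nat.div_mul_le_self j' (4 * k * D)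
      have h4 := Nat.lt_div_mul_add hp (a := j)
      rw [h1] at h4
      rw [h2] at h3
      omega
    · have h1 := (hJ' j hj).2.2.2.2
      have h2 := (hJ' j' hj').2.2.2.2
      rw [Nat.even_iff]
      omega
    · intro i hi j hj u v hu hv
      rw [← hfs i u hu, ← hfs j v hv]
      exact hIC i hi _ (hJ' j hj).2.2.1

/-- A path, given by its list of vertices, whose ends are joined by an edge, together with disjoint
sets `S` and `Y` off the path which span a complete bipartite graph also after the first vertex of
the path has been added to `Y` and the last one to `S`. -/
structure IsExtendable {V : Type} (G : SimpleGraph V) (l : List V) (S Y : Finset V) : Prop where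
  chain : l.IsChain G.Adj
  nodup : l.Nodup
  ne_nil : l ≠ []
  closing : ∀ a ∈ l.getLast?, ∀ b ∈ l.head?, G.Adj a b
  disjoint : ∀ s ∈ S, ∀ y ∈ Y, s ≠ y
  notMem_left : ∀ s ∈ S, s ∉ l
  notMem_right : ∀ y ∈ Y, y ∉ l
  adj : ∀ s ∈ S, ∀ y ∈ Y, G.Adj s y
  adj_head : ∀ b ∈ l.head?, ∀ s ∈ S, G.Adj b s
  adj_last : ∀ a ∈ l.getLast?, ∀ y ∈ Y, G.Adj a y

lemma exists_isCycle_of_list {V : Type} {G : SimpleGraph V} {l : List V} (hc : l.IsChain G.Adj)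
    (hn : l.Nodup) (h : ∀ a ∈ l.getLast?, ∀ b ∈ l.head?, G.Adj a b) (h3 : 3 ≤ l.length) :
    ∃ (v : V) (c : G.Walk v v), c.IsCycle ∧ c.length = l.length := by
  have hne : l ≠ [] := by rintro rfl; simp at h3
  set p := Walk.ofSupport l hne hc
  have hadj : G.Adj (l.getLast hne) (l.head hne) :=
    h _ (List.getLast_mem_getLast? hne) _ (List.head_mem_head? hne)
  have hlen : (Walk.cons hadj p).length = l.length := by
    simp only [Walk.length_cons, p, Walk.length_ofSupport]
    omega
  refine ⟨_, Walk.cons hadj p, ?_, hlen⟩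
  rw [Walk.isCycle_iff_isPath_tail_and_le_length, hlen]
  refine ⟨?_, h3⟩
  simp only [Walk.getVert_cons_succ, Walk.tail_cons, Walk.isPath_copy]
  rw [Walk.isPath_def, Walk.support_ofSupport]
  exact hn

lemma exists_list_of_isCycle {V : Type} {G : SimpleGraph V} {v : V} {c : G.Walk v v}
    (hc : c.IsCycle) : ∃ l : List V, l.IsChain G.Adj ∧ l.Nodup ∧
      (∀ a ∈ l.getLast?, ∀ b ∈ l.head?, G.Adj a b) ∧ l.length = c.length := by
  cases c with
  | nil => exact absurd hc (by simp)
  | cons h p =>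
    rw [Walk.isCycle_def] at hc
    refine ⟨p.support, p.isChain_adj_support, by simpa using hc.2.2, ?_, by simp⟩
    intro a ha b hb
    rw [List.getLast?_eq_getLast_of_ne_nil p.support_ne_nil] at ha
    rw [List.head?_eq_some_head p.support_ne_nil] at hb
    simp at ha hb
    subst ha hb
    exact h

/-- An extendable path closes up to cycles which use `2 * i` additional vertices. -/
lemma IsExtendable.exists_isCycle {V : Type} [DecidableEq V] {G : SimpleGraph V} (i : ℕ) :
    ∀ {l : List V} {S Y : Finset V}, IsExtendable G l S Y → i ≤ S.card → i ≤ Y.card →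
      3 ≤ l.length + 2 * i → ∃ (v : V) (c : G.Walk v v), c.IsCycle ∧ c.length = l.length + 2 * i := by
  induction i with
  | zero => exact fun h _ _ h3 => exists_isCycle_of_list h.chain h.nodup h.closing h3
  | succ i ih =>
    intro l S Y h hS hY h3
    obtain ⟨s, hs⟩ := Finset.card_pos.1 (by omega : 0 < S.card)
    obtain ⟨y, hy⟩ := Finset.card_pos.1 (by omega : 0 < Y.card)
    have key : IsExtendable G (l ++ [y, s]) (S.erase s) (Y.erase y) := by
      have hhead : (l ++ [y, s]).head? = l.head? := by
        obtain _ | ⟨a, l⟩ := l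
        · exact absurd rfl h.ne_nil
        · rfl
      have hlast : (l ++ [y, s]).getLast? = some s := by simp
      refine ⟨?_, ?_, by simp, ?_, ?_, ?_, ?_, ?_, ?_, ?_⟩
      · rw [List.isChain_append]
        refine ⟨h.chain, by simpa using (h.adj s hs y hy).symm, ?_⟩
        intro a ha b hb
        obtain rfl : y = b := by simpa using hb
        exact h.adj_last a ha y hy
      · have := h.nodup
        have := h.notMem_left s hs
        have := h.notMem_right y hy
        have := h.disjoint s hs y hy
        grind
      · rw [hhead, hlast]
        intro a ha b hb
        obtain rfl : s = a := by simpa using ha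
        exact (h.adj_head b hb s hs).symm
      · exact fun s hs y hy => h.disjoint s (Finset.mem_of_mem_erase hs) y (Finset.mem_of_mem_erase hy)
      · intro t ht
        have := h.notMem_left t (Finset.mem_of_mem_erase ht)
        have := h.disjoint t (Finset.mem_of_mem_erase ht) y hy
        have := Finset.ne_of_mem_erase ht
        simp [*]
      · intro t ht
        have := h.notMem_right t (Finset.mem_of_mem_erase ht)
        have := (h.disjoint s hs t (Finset.mem_of_mem_erase ht)).symm
        have := Finset.ne_of_mem_erase ht
        simp [*]
      · exact fun s hs y hy => h.adj s (Finset.mem_of_mem_erase hs) y (Finset.mem_of_mem_erase hy)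
      · rw [hhead]
        exact fun b hb s hs => h.adj_head b hb s (Finset.mem_of_mem_erase hs)
      · rw [hlast]
        intro a ha t ht
        obtain rfl : s = a := by simpa using ha
        exact h.adj s hs t (Finset.mem_of_mem_erase ht)
    have hlen : (l ++ [y, s]).length + 2 * i = l.length + 2 * (i + 1) := by
      simp
      omega
    have := ih key (by rw [Finset.card_erase_of_mem hs]; omega)
      (by rw [Finset.card_erase_of_mem hy]; omega) (by omega)
    rwa [hlen] at this

lemma exists_short_even_cycle (d k : ℕ) (hd : 0 < d) (hk : 0 < k) :
    ∃ N : ℕ, ∀ (V : Type) [Fintype V] [DecidableEq V] (G : SimpleGraph V)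
      [DecidableRel G.Adj], (∀ v, Fintype.card V ≤ d * G.degree v) → N ≤ Fintype.card V →
      ∀ m, Even m → 4 ≤ m → m ≤ 2 * k → ∃ (v : V) (c : G.Walk v v), c.IsCycle ∧ c.length = m := by
  obtain ⟨w, D, hD, hkw, H⟩ := exists_common_neighbors d k hd hk
  refine ⟨w + D * k, fun V _ _ G _ hdeg hN m hm h4 hmk => ?_⟩
  obtain ⟨U, _, hU⟩ := Finset.exists_subset_card_eq (s := (Finset.univ : Finset V)) (n := w)
    (by rw [Finset.card_univ]; omega)
  obtain ⟨T, _, hT, hC⟩ := H V G hdeg U hU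
  set C := Finset.univ.filter fun x => ∀ t ∈ T, G.Adj t x
  have hTC : ∀ t ∈ T, ∀ c ∈ C, G.Adj t c := fun t ht c hc => (Finset.mem_filter.1 hc).2 t ht
  have hkC : k ≤ C.card := Nat.le_of_mul_le_mul_left (by omega : D * k ≤ D * C.card) hD
  obtain ⟨t, ht⟩ := Finset.card_pos.1 (by omega : 0 < T.card)
  obtain ⟨c, hc⟩ := Finset.card_pos.1 (by omega : 0 < C.card)
  have hne : ∀ t ∈ T, ∀ c ∈ C, t ≠ c := fun t ht c hc => (hTC t ht c hc).ne
  have key : IsExtendable G [t, c] (C.erase c) (T.erase t) := by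
    refine ⟨by simpa using hTC t ht c hc, by simpa using hne t ht c hc, by simp,
      by simpa using (hTC t ht c hc).symm, ?_, ?_, ?_, ?_, ?_, ?_⟩
    · exact fun s hs y hy => (hne y (Finset.mem_of_mem_erase hy) s (Finset.mem_of_mem_erase hs)).symm
    · intro s hs
      have := (hne t ht s (Finset.mem_of_mem_erase hs)).symm
      have := Finset.ne_of_mem_erase hs
      simp [*]
    · intro s hs
      have := hne s (Finset.mem_of_mem_erase hs) c hc
      have := Finset.ne_of_mem_erase hs
      simp [*]
    · exact fun s hs y hy => (hTC y (Finset.mem_of_mem_erase hy) s (Finset.mem_of_mem_erase hs)).symm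
    · intro b hb s hs
      obtain rfl : t = b := by simpa using hb
      exact hTC t ht s (Finset.mem_of_mem_erase hs)
    · intro b hb s hs
      obtain rfl : c = b := by simpa using hb
      exact (hTC s (Finset.mem_of_mem_erase hs) c hc).symm
  have hm2 : [t, c].length + 2 * ((m - 2) / 2) = m := by
    obtain ⟨r, rfl⟩ := hm
    simp
    omega
  have := key.exists_isCycle ((m - 2) / 2) (by rw [Finset.card_erase_of_mem hc]; omega)
    (by rw [Finset.card_erase_of_mem ht]; omega) (by omega)
  rwa [hm2] at this

lemma mem_take_iff_getElem? {V : Type} {l : List V} {n : ℕ} {x : V} :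
    x ∈ l.take n ↔ ∃ i < n, l[i]? = some x := by
  rw [List.mem_iff_getElem?]
  simp only [List.getElem?_take]
  grind

lemma mem_drop_iff_getElem? {V : Type} {l : List V} {n : ℕ} {x : V} :
    x ∈ l.drop n ↔ ∃ i, n ≤ i ∧ l[i]? = some x := by
  rw [List.mem_iff_getElem?]
  simp only [List.getElem?_drop]
  constructor
  · rintro ⟨i, h⟩
    exact ⟨n + i, by omega, h⟩
  · rintro ⟨i, hi, h⟩
    exact ⟨i - n, by rwa [Nat.add_sub_cancel' hi]⟩

lemma mem_slice_iff_getElem? {V : Type} {l : List V} {a b : ℕ} {x : V} :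
    x ∈ (l.take b).drop a ↔ ∃ i, a ≤ i ∧ i < b ∧ l[i]? = some x := by
  rw [mem_drop_iff_getElem?]
  simp only [List.getElem?_take]
  grind

lemma getLast?_take_succ {V : Type} {l : List V} {i : ℕ} (hi : i < l.length) :
    (l.take (i + 1)).getLast? = some l[i] := by
  simp [List.getLast?_take, hi]

lemma head?_slice {V : Type} {l : List V} {a b : ℕ} (hab : a ≤ b) (hb : b < l.length) :
    ((l.take (b + 1)).drop a).head? = some l[a] := by
  rw [List.head?_drop, List.getElem?_take]
  grind

lemma getLast?_slice {V : Type} {l : List V} {a b : ℕ} (hab : a ≤ b) (hb : b < l.length) :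
    ((l.take (b + 1)).drop a).getLast? = some l[b] := by
  rw [List.getLast?_drop, getLast?_take_succ hb]
  simp
  omega

lemma head?_drop_lt {V : Type} {l : List V} {i : ℕ} (hi : i < l.length) :
    (l.drop i).head? = some l[i] := by
  simp [List.head?_drop, hi]

lemma getLast?_drop_lt {V : Type} {l : List V} {i : ℕ} (hi : i < l.length) :
    (l.drop i).getLast? = l.getLast? := by
  rw [List.getLast?_drop]
  simp
  omega

lemma head?_take_succ {V : Type} {l : List V} {i : ℕ} :
    (l.take (i + 1)).head? = l.head? := by
  simp [List.head?_take]

lemma isChain_adj_reverse {V : Type} {G : SimpleGraph V} {l : List V} (h : l.IsChain G.Adj) :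
    l.reverse.IsChain G.Adj := by
  rw [List.isChain_reverse]
  exact h.imp fun _ _ h => h.symm

lemma index_unique {V : Type} {l : List V} (hl : l.Nodup) {i j : ℕ} {x : V}
    (hi : l[i]? = some x) (hj : l[j]? = some x) : i = j := by
  have hi' := List.getElem?_eq_some_iff.1 hi
  have hj' := List.getElem?_eq_some_iff.1 hj
  exact hl.getElem_inj_iff.1 (hi'.2.trans hj'.2.symm)

lemma exists_detour {V : Type} {G : SimpleGraph V} {l : List V} (hc : l.IsChain G.Adj)
    (hn : l.Nodup) {i j : ℕ} (hij : i < j) (hj : j < l.length) {x : V} (hx : x ∉ l)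
    (hi : G.Adj l[i] x) (hjx : G.Adj l[j] x) :
    ∃ l' : List V, l'.IsChain G.Adj ∧ l'.Nodup ∧ (∀ y ∈ l', y ∈ l ∨ y = x) ∧
      l'.head? = l.head? ∧ l'.getLast? = l.getLast? ∧ l'.length + j = l.length + i + 2 := by
  refine ⟨l.take (i + 1) ++ ([x] ++ l.drop j), ?_, ?_, ?_, ?_, ?_, ?_⟩
  · rw [List.isChain_append, List.isChain_append, List.head?_append, getLast?_take_succ (by omega),
      head?_drop_lt hj]
    refine ⟨hc.take _, ⟨by simp, hc.drop _, by simpa using hjx.symm⟩, by simpa using hi⟩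
  · rw [List.nodup_append, List.nodup_append]
    refine ⟨hn.sublist (List.take_sublist _ _), ⟨by simp, hn.sublist (List.drop_sublist _ _), ?_⟩, ?_⟩
    · rintro a ha b hb rfl
      rw [List.mem_singleton.1 ha] at hb
      exact hx (List.mem_of_mem_drop hb)
    · rintro a ha b hb rfl
      rcases List.mem_append.1 hb with hb | hb
      · rw [List.mem_singleton.1 hb] at ha
        exact hx (List.mem_of_mem_take ha)
      · obtain ⟨r, hr, hr'⟩ := mem_take_iff_getElem?.1 ha
        obtain ⟨s, hs, hs'⟩ := mem_drop_iff_getElem?.1 hb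
        have := index_unique hn hr' hs'
        omega
  · intro y hy
    rcases List.mem_append.1 hy with hy | hy
    · exact .inl (List.mem_of_mem_take hy)
    · rcases List.mem_append.1 hy with hy | hy
      · exact .inr (List.mem_singleton.1 hy)
      · exact .inl (List.mem_of_mem_drop hy)
  · rw [List.head?_append_of_ne_nil _ (by rw [← List.length_pos_iff]; simp; omega),
      head?_take_succ]
  · rw [← List.append_assoc, List.getLast?_append_of_ne_nil _
      (by rw [← List.length_pos_iff]; simp; omega), getLast?_drop_lt hj]
  · simp
    omega

lemma exists_crossing {V : Type} {G : SimpleGraph V} {l : List V} (hc : l.IsChain G.Adj)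
    (hn : l.Nodup) {a b c e : ℕ} (hab : a < b) (hbc : b < c) (hce : c < e) (he : e < l.length)
    (hac : G.Adj l[a] l[c]) (hbe : G.Adj l[b] l[e]) :
    ∃ l' : List V, l'.IsChain G.Adj ∧ l'.Nodup ∧ (∀ y ∈ l', y ∈ l) ∧
      l'.head? = l.head? ∧ l'.getLast? = l.getLast? ∧
      l'.length + e + b = l.length + c + a + 2 := by
  refine ⟨l.take (a + 1) ++ (((l.take (c + 1)).drop b).reverse ++ l.drop e), ?_, ?_, ?_, ?_, ?_, ?_⟩
  · rw [List.isChain_append, List.isChain_append, List.head?_append, List.head?_reverse,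
      List.getLast?_reverse, getLast?_take_succ (by omega), head?_drop_lt he,
      head?_slice (by omega) (by omega), getLast?_slice (by omega) (by omega)]
    exact ⟨hc.take _, ⟨isChain_adj_reverse ((hc.take _).drop _), hc.drop _, by simpa using hbe⟩,
      by simpa using hac⟩
  · rw [List.nodup_append, List.nodup_append, List.nodup_reverse]
    refine ⟨hn.sublist (List.take_sublist _ _), ⟨hn.sublist ((List.drop_sublist _ _).trans
      (List.take_sublist _ _)), hn.sublist (List.drop_sublist _ _), ?_⟩, ?_⟩
    · rintro x hx y hy rfl
      rw [List.mem_reverse] at hx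
      obtain ⟨r, hr, hr2, hr'⟩ := mem_slice_iff_getElem?.1 hx
      obtain ⟨s, hs, hs'⟩ := mem_drop_iff_getElem?.1 hy
      have := index_unique hn hr' hs'
      omega
    · rintro x hx y hy rfl
      obtain ⟨s, hs, hs'⟩ := mem_take_iff_getElem?.1 hx
      rw [List.mem_append, List.mem_reverse] at hy
      rcases hy with hy | hy
      · obtain ⟨r, hr, hr2, hr'⟩ := mem_slice_iff_getElem?.1 hy
        have := index_unique hn hr' hs'
        omega
      · obtain ⟨r, hr, hr'⟩ := mem_drop_iff_getElem?.1 hy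
        have := index_unique hn hr' hs'
        omega
  · intro y hy
    rw [List.mem_append, List.mem_append, List.mem_reverse] at hy
    rcases hy with hy | hy | hy
    · exact List.mem_of_mem_take hy
    · exact List.mem_of_mem_take (List.mem_of_mem_drop hy)
    · exact List.mem_of_mem_drop hy
  · rw [List.head?_append_of_ne_nil _ (by rw [← List.length_pos_iff]; simp; omega),
      head?_take_succ]
  · rw [← List.append_assoc, List.getLast?_append_of_ne_nil _
      (by rw [← List.length_pos_iff]; simp; omega), getLast?_drop_lt he]
  · simp
    omega

/-- A long path can be shortened by a bounded even amount, keeping its ends and avoiding `Q`. -/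
lemma exists_shorter_path (d : ℕ) (hd : 0 < d) :
    ∃ W J : ℕ, ∀ q : ℕ, ∃ N : ℕ, ∀ (V : Type) [Fintype V] [DecidableEq V] (G : SimpleGraph V)
      [DecidableRel G.Adj], (∀ v, Fintype.card V ≤ d * G.degree v) → N ≤ Fintype.card V →
      ∀ l : List V, l.IsChain G.Adj → l.Nodup → W ≤ l.length →
      ∀ Q : Finset V, Q.card ≤ q → (∀ x ∈ Q, x ∉ l) →
      ∃ l' : List V, l'.IsChain G.Adj ∧ l'.Nodup ∧ (∀ x ∈ Q, x ∉ l') ∧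
        l'.head? = l.head? ∧ l'.getLast? = l.getLast? ∧ l'.length < l.length ∧
        l.length ≤ l'.length + J ∧ Even (l.length + l'.length) := by
  obtain ⟨W, B, hW, H⟩ := exists_attached_indices d 3 hd (by omega)
  refine ⟨W, W + B, fun q => ?_⟩
  obtain ⟨N, H⟩ := H q
  refine ⟨N, fun V _ _ G _ hdeg hN l hc hn hlen Q hQ hQl => ?_⟩
  obtain ⟨I, hI, hIW, h⟩ := H V G hdeg hN l hn hlen Q hQ
  set e := I.orderEmbOfFin hI
  have he : ∀ r, e r ∈ I := I.orderEmbOfFin_mem hI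
  have e01 : e 0 < e 1 := e.strictMono (by decide)
  have e12 : e 1 < e 2 := e.strictMono (by decide)
  have p0 := Nat.even_iff.1 (hIW _ (he 0)).2
  have p1 := Nat.even_iff.1 (hIW _ (he 1)).2
  have p2 := Nat.even_iff.1 (hIW _ (he 2)).2
  have w2 := (hIW _ (he 2)).1
  rcases h with ⟨X, hX, hXl, hadj⟩ | ⟨J, hJ, hJl, hJB, hadj⟩
  · obtain ⟨x, hx⟩ := Finset.card_pos.1 (by omega : 0 < X.card)
    obtain ⟨l', h1, h2, h3, h4, h5, h6⟩ := exists_detour hc hn (i := e 0) (j := e 2) (x := x)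
      (by omega) (by omega) (hXl x hx).1
      (hadj _ (he 0) x hx _ (List.getElem?_eq_getElem _))
      (hadj _ (he 2) x hx _ (List.getElem?_eq_getElem _))
    refine ⟨l', h1, h2, fun y hy hy' => ?_, h4, h5, by omega, by omega, ?_⟩
    · rcases h3 y hy' with h | rfl
      · exact hQl y hy h
      · exact (hXl _ hx).2 hy
    · rw [Nat.even_iff]
      omega
  · set g := J.orderEmbOfFin hJ
    have hg : ∀ r, g r ∈ J := J.orderEmbOfFin_mem hJ
    have g01 : g 0 < g 1 := g.strictMono (by decide)
    have := hJl _ (hg 0)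
    have := hJl _ (hg 1)
    have hB := hJB _ (hg 1) _ (hg 0)
    have hp := Nat.even_iff.1 hB.2
    obtain ⟨l', h1, h2, h3, h4, h5, h6⟩ := exists_crossing hc hn (a := e 0) (b := e 1) (c := g 0)
      (e := g 1) (by omega) (by omega) (by omega) (by omega)
      (hadj _ (he 0) _ (hg 0) _ _ (List.getElem?_eq_getElem _) (List.getElem?_eq_getElem _))
      (hadj _ (he 1) _ (hg 1) _ _ (List.getElem?_eq_getElem _) (List.getElem?_eq_getElem _))
    refine ⟨l', h1, h2, fun y hy hy' => hQl y hy (h3 y hy'), h4, h5, by omega, by omega, ?_⟩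
    rw [Nat.even_iff]
    omega

lemma exists_interior (I : Finset ℕ) (hI : 2 ≤ I.card) :
    ∃ a ∈ I, ∃ b ∈ I, a < b ∧ ∃ I' ⊆ I, I'.card + 2 = I.card ∧ ∀ i ∈ I', a < i ∧ i < b := by
  have hne : I.Nonempty := Finset.card_pos.1 (by omega)
  have hlt : I.min' hne < I.max' hne := Finset.min'_lt_max'_of_card I (by omega)
  refine ⟨_, I.min'_mem hne, _, I.max'_mem hne, hlt, (I.erase (I.min' hne)).erase (I.max' hne),
    (Finset.erase_subset _ _).trans (Finset.erase_subset _ _), ?_, ?_⟩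
  · rw [Finset.card_erase_of_mem (Finset.mem_erase.2 ⟨hlt.ne', I.max'_mem hne⟩),
      Finset.card_erase_of_mem (I.min'_mem hne)]
    omega
  · intro i hi
    simp only [Finset.mem_erase] at hi
    have := I.min'_le i hi.2.2
    have := I.le_max' i hi.2.2
    omega

lemma exists_finset_of_indices {V : Type} [DecidableEq V] {l : List V} (hl : l.Nodup)
    (I : Finset ℕ) (hI : ∀ i ∈ I, i < l.length) :
    ∃ S : Finset V, S.card = I.card ∧ ∀ s ∈ S, ∃ i ∈ I, l[i]? = some s := by
  refine ⟨I.attach.image fun i => l[i.1]'(hI i.1 i.2), ?_, ?_⟩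
  · rw [Finset.card_image_of_injective, Finset.card_attach]
    intro i j h
    exact Subtype.ext (hl.getElem_inj_iff.1 h)
  · intro s hs
    obtain ⟨i, _, rfl⟩ := Finset.mem_image.1 hs
    exact ⟨i.1, i.2, List.getElem?_eq_getElem _⟩

/-- A long cycle can be turned into an extendable path with the same parity and at most `R` fewer
vertices. -/
lemma exists_isExtendable (d f : ℕ) (hd : 0 < d) :
    ∃ W R N : ℕ, ∀ (V : Type) [Fintype V] [DecidableEq V] (G : SimpleGraph V)
      [DecidableRel G.Adj], (∀ v, Fintype.card V ≤ d * G.degree v) → N ≤ Fintype.card V →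
      ∀ l : List V, l.IsChain G.Adj → l.Nodup → (∀ a ∈ l.getLast?, ∀ b ∈ l.head?, G.Adj a b) →
      W ≤ l.length → ∃ (l' : List V) (S Y : Finset V), IsExtendable G l' S Y ∧ S.card = f ∧
        Y.card = f ∧ l.length ≤ l'.length + R ∧ Even (l.length + l'.length) := by
  obtain ⟨W, B, hW, H⟩ := exists_attached_indices d (f + 2) hd (by omega)
  obtain ⟨N, H⟩ := H 0
  refine ⟨W, W + B, N, fun V _ _ G _ hdeg hN l hc hn hcl hlen => ?_⟩
  obtain ⟨I, hI, hIW, h⟩ := H V G hdeg hN l hn hlen ∅ (by simp)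
  obtain ⟨a, ha, b, hb, hab, I', hI', hIc, hIab⟩ := exists_interior I (by omega)
  obtain ⟨T, hTc, hT⟩ := exists_finset_of_indices hn I' fun i hi => by
    have := (hIW i (hI' hi)).1
    omega
  have pa := Nat.even_iff.1 (hIW a ha).2
  have pb := Nat.even_iff.1 (hIW b hb).2
  have wb := (hIW b hb).1
  have la := List.getElem?_eq_getElem (l := l) (i := a) (by omega)
  have lb := List.getElem?_eq_getElem (l := l) (i := b) (by omega)
  rcases h with ⟨X, hX, hXl, hadj⟩ | ⟨J, hJ, hJl, hJB, hadj⟩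
  · obtain ⟨x, hx⟩ := Finset.card_pos.1 (by omega : 0 < X.card)
    obtain ⟨S, hS, hSc⟩ := Finset.exists_subset_card_eq (s := X.erase x) (n := f)
      (by rw [Finset.card_erase_of_mem hx]; omega)
    have hSX : ∀ s ∈ S, s ≠ x ∧ s ∈ X := fun s hs => Finset.mem_erase.1 (hS hs)
    have hTl : ∀ t ∈ T, t ∈ l := fun t ht => by
      obtain ⟨i, _, hi⟩ := hT t ht
      exact List.mem_of_getElem? hi
    have hhead : (l.drop b ++ (l.take (a + 1) ++ [x])).head? = some l[b] := by
      simp [List.head?_append, head?_drop_lt (show b < l.length by omega)]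
    have hlast : (l.drop b ++ (l.take (a + 1) ++ [x])).getLast? = some x := by simp
    refine ⟨l.drop b ++ (l.take (a + 1) ++ [x]), S, T, ⟨?_, ?_, by simp, ?_, ?_, ?_, ?_, ?_, ?_, ?_⟩,
      hSc, by omega, by simp; omega, by rw [Nat.even_iff]; simp; omega⟩
    · rw [List.isChain_append, List.isChain_append, List.head?_append, getLast?_take_succ (by omega),
        getLast?_drop_lt (by omega), head?_take_succ]
      refine ⟨hc.drop _, ⟨hc.take _, by simp, ?_⟩, ?_⟩
      · simpa using hadj a ha x hx _ la
      · rw [List.head?_eq_some_head (by rw [← List.length_pos_iff]; omega)] at hcl ⊢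
        simpa using hcl
    · rw [List.nodup_append, List.nodup_append]
      refine ⟨hn.sublist (List.drop_sublist _ _), ⟨hn.sublist (List.take_sublist _ _), by simp, ?_⟩, ?_⟩
      · rintro y hy z hz rfl
        rw [List.mem_singleton.1 hz] at hy
        exact (hXl x hx).1 (List.mem_of_mem_take hy)
      · rintro y hy z hz rfl
        rcases List.mem_append.1 hz with hz | hz
        · obtain ⟨r, hr, hr'⟩ := mem_take_iff_getElem?.1 hz
          obtain ⟨s, hs, hs'⟩ := mem_drop_iff_getElem?.1 hy
          have := index_unique hn hr' hs'
          omega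
        · rw [List.mem_singleton.1 hz] at hy
          exact (hXl x hx).1 (List.mem_of_mem_drop hy)
    · rw [hhead, hlast]
      simpa using (hadj b hb x hx _ lb).symm
    · rintro s hs t ht rfl
      exact (hXl s (hSX s hs).2).1 (hTl s ht)
    · intro s hs h
      rw [List.mem_append, List.mem_append, List.mem_singleton] at h
      rcases h with h | h | h
      · exact (hXl s (hSX s hs).2).1 (List.mem_of_mem_drop h)
      · exact (hXl s (hSX s hs).2).1 (List.mem_of_mem_take h)
      · exact (hSX s hs).1 h
    · intro t ht h
      obtain ⟨i, hi, hi'⟩ := hT t ht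
      have hi2 := hIab i hi
      rw [List.mem_append, List.mem_append, List.mem_singleton] at h
      rcases h with h | h | rfl
      · obtain ⟨s, hs, hs'⟩ := mem_drop_iff_getElem?.1 h
        have := index_unique hn hi' hs'
        omega
      · obtain ⟨s, hs, hs'⟩ := mem_take_iff_getElem?.1 h
        have := index_unique hn hi' hs'
        omega
      · exact (hXl t hx).1 (hTl t ht)
    · intro s hs t ht
      obtain ⟨i, hi, hi'⟩ := hT t ht
      exact (hadj i (hI' hi) s (hSX s hs).2 t hi').symm
    · rw [hhead]
      intro u hu s hs
      exact hadj b hb s (hSX s hs).2 u (lb.trans hu)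
    · rw [hlast]
      intro u hu t ht
      obtain rfl : x = u := by simpa using hu
      obtain ⟨i, hi, hi'⟩ := hT t ht
      exact (hadj i (hI' hi) x hx t hi').symm
  · obtain ⟨c, hcJ, e, heJ, hce, J', hJ', hJc, hJce⟩ := exists_interior J (by omega)
    obtain ⟨S, hSc, hS⟩ := exists_finset_of_indices hn J' fun j hj => (hJl j (hJ' hj)).2
    have hc1 := hJl c hcJ
    have he1 := hJl e heJ
    have hB := hJB e heJ c hcJ
    have hp := Nat.even_iff.1 hB.2
    have lc := List.getElem?_eq_getElem (l := l) (i := c) (by omega)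
    have le := List.getElem?_eq_getElem (l := l) (i := e) (by omega)
    set P := ((l.take (c + 1)).drop b).reverse ++ (l.drop e ++ l.take (a + 1)) with hP
    have hhead : P.head? = some l[c] := by
      simp [hP, List.head?_append, getLast?_slice (show b ≤ c by omega) hc1.2]
    have hlast : P.getLast? = some l[a] := by
      simp [hP, List.getLast?_append, getLast?_take_succ (show a < l.length by omega)]
    have hmem : ∀ x ∈ P, ∃ i, l[i]? = some x ∧ (i ≤ a ∨ (b ≤ i ∧ i ≤ c) ∨ e ≤ i) := by
      intro x hx
      rw [hP, List.mem_append, List.mem_append, List.mem_reverse] at hx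
      rcases hx with h | h | h
      · obtain ⟨i, h1, h2, h3⟩ := mem_slice_iff_getElem?.1 h
        exact ⟨i, h3, by omega⟩
      · obtain ⟨i, h1, h3⟩ := mem_drop_iff_getElem?.1 h
        exact ⟨i, h3, by omega⟩
      · obtain ⟨i, h1, h3⟩ := mem_take_iff_getElem?.1 h
        exact ⟨i, h3, by omega⟩
    have hPl : P.length + (e - c) + (b - a) = l.length + 2 := by
      simp [hP]
      omega
    refine ⟨P, T, S, ⟨?_, ?_, ?_, ?_, ?_, ?_, ?_, ?_, ?_, ?_⟩,
      by omega, by omega, by omega, by rw [Nat.even_iff]; omega⟩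
    · rw [hP, List.isChain_append, List.isChain_append, List.getLast?_reverse, List.head?_append,
        head?_drop_lt he1.2, getLast?_drop_lt he1.2, head?_take_succ,
        head?_slice (by omega) (by omega)]
      refine ⟨isChain_adj_reverse ((hc.take _).drop _), ⟨hc.drop _, hc.take _, hcl⟩, ?_⟩
      simpa using hadj b hb e heJ _ _ lb le
    · rw [hP, List.nodup_append, List.nodup_append, List.nodup_reverse]
      refine ⟨hn.sublist ((List.drop_sublist _ _).trans (List.take_sublist _ _)),
        ⟨hn.sublist (List.drop_sublist _ _), hn.sublist (List.take_sublist _ _), ?_⟩, ?_⟩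
      · rintro x hx y hy rfl
        obtain ⟨r, hr, hr'⟩ := mem_drop_iff_getElem?.1 hx
        obtain ⟨s, hs, hs'⟩ := mem_take_iff_getElem?.1 hy
        have := index_unique hn hr' hs'
        omega
      · rintro x hx y hy rfl
        rw [List.mem_reverse] at hx
        obtain ⟨r, hr, hr2, hr'⟩ := mem_slice_iff_getElem?.1 hx
        rcases List.mem_append.1 hy with hy | hy
        · obtain ⟨s, hs, hs'⟩ := mem_drop_iff_getElem?.1 hy
          have := index_unique hn hr' hs'
          omega
        · obtain ⟨s, hs, hs'⟩ := mem_take_iff_getElem?.1 hy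
          have := index_unique hn hr' hs'
          omega
    · rintro h
      simp [h] at hhead
    · rw [hhead, hlast]
      simpa using hadj a ha c hcJ _ _ la lc
    · rintro t ht s hs rfl
      obtain ⟨i, hi, hi'⟩ := hT t ht
      obtain ⟨j, hj, hj'⟩ := hS t hs
      have := index_unique hn hi' hj'
      have := hIab i hi
      have := hJce j hj
      omega
    · intro t ht h
      obtain ⟨i, hi, hi'⟩ := hT t ht
      obtain ⟨j, hj, hj'⟩ := hmem t h
      have := index_unique hn hi' hj
      have := hIab i hi
      omega
    · intro t ht h
      obtain ⟨i, hi, hi'⟩ := hS t ht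
      obtain ⟨j, hj, hj'⟩ := hmem t h
      have := index_unique hn hi' hj
      have := hJce i hi
      omega
    · intro t ht s hs
      obtain ⟨i, hi, hi'⟩ := hT t ht
      obtain ⟨j, hj, hj'⟩ := hS s hs
      exact hadj i (hI' hi) j (hJ' hj) _ _ hi' hj'
    · rw [hhead]
      intro u hu t ht
      obtain ⟨i, hi, hi'⟩ := hT t ht
      exact (hadj i (hI' hi) c hcJ _ _ hi' (lc.trans hu)).symm
    · rw [hlast]
      intro u hu s hs
      obtain ⟨j, hj, hj'⟩ := hS s hs
      exact hadj a ha j (hJ' hj) _ _ (la.trans hu) hj'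

/-- A cycle of length `L` forces cycles of all lengths of the same parity from `K` to `L - K`. -/
lemma exists_isCycle_of_le (d : ℕ) (hd : 0 < d) :
    ∃ K : ℕ, ∀ (V : Type) [Fintype V] [DecidableEq V] (G : SimpleGraph V)
      [DecidableRel G.Adj], (∀ v, Fintype.card V ≤ d * G.degree v) → K ≤ Fintype.card V →
      ∀ (v : V) (c : G.Walk v v), c.IsCycle → ∀ m, K ≤ m → m + K ≤ c.length →
      Even (m + c.length) → ∃ (v : V) (c : G.Walk v v), c.IsCycle ∧ c.length = m := by
  obtain ⟨W₁, f, H₁⟩ := exists_shorter_path d hd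
  obtain ⟨W₂, R, N₂, H₂⟩ := exists_isExtendable d f hd
  obtain ⟨N₁, H₁⟩ := H₁ (f + f)
  refine ⟨W₁ + W₂ + R + N₁ + N₂ + 3, ?_⟩
  intro V _ _ G _ hdeg hK v c hc m hm hmc hpar
  obtain ⟨l, hl, hln, hlc, hlen⟩ := exists_list_of_isCycle hc
  obtain ⟨P, S, Y, hE, hS, hY, hPR, hPp⟩ := H₂ V G hdeg (by omega) l hl hln hlc (by omega)
  have key : ∀ p : ℕ, ∀ P : List V, P.length = p → IsExtendable G P S Y → m ≤ P.length + 2 * f →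
      Even (P.length + m) → ∃ (v : V) (c : G.Walk v v), c.IsCycle ∧ c.length = m := by
    intro p
    induction p using Nat.strong_induction_on with
    | _ p ih =>
      rintro P rfl hE hmP hp
      rw [Nat.even_iff] at hp
      rcases le_or_gt P.length m with hle | hgt
      · have hm2 : P.length + 2 * ((m - P.length) / 2) = m := by omega
        have := hE.exists_isCycle ((m - P.length) / 2) (by omega) (by omega) (by omega)
        rwa [hm2] at this
      · obtain ⟨P', h1, h2, h3, h4, h5, h6, h7, h8⟩ := H₁ V G hdeg (by omega) P hE.chain hE.nodup
          (by omega) (S ∪ Y) ((Finset.card_union_le _ _).trans (by omega)) (by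
            intro x hx
            rcases Finset.mem_union.1 hx with hx | hx
            · exact hE.notMem_left x hx
            · exact hE.notMem_right x hx)
        rw [Nat.even_iff] at h8
        refine ih P'.length h6 P' rfl ⟨h1, h2, ?_, ?_, hE.disjoint,
          fun s hs => h3 s (Finset.mem_union_left _ hs),
          fun s hs => h3 s (Finset.mem_union_right _ hs), hE.adj, ?_, ?_⟩ (by omega)
          (by rw [Nat.even_iff]; omega)
        · rintro rfl
          exact hE.ne_nil (List.head?_eq_none_iff.1 h4.symm)
        · rw [h4, h5]
          exact hE.closing
        · rw [h4]
          exact hE.adj_head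
        · rw [h5]
          exact hE.adj_last
  rw [Nat.even_iff] at hpar hPp
  exact key _ P rfl hE (by omega) (by rw [Nat.even_iff]; omega)

lemma bddAbove_cycle_lengths {n : ℕ} (G : SimpleGraph (Fin n)) (p : ℕ → Prop) :
    BddAbove {L : ℕ | p L ∧ ∃ (v : Fin n) (c : G.Walk v v), c.IsCycle ∧ c.length = L} := by
  refine ⟨n, ?_⟩
  rintro L ⟨_, v, c, hc, rfl⟩
  obtain ⟨l, _, hl, _, hlen⟩ := exists_list_of_isCycle hc
  rw [← hlen]
  simpa using hl.length_le_card

lemma exists_isCycle_length_eq_sSup {n : ℕ} (G : SimpleGraph (Fin n)) (p : ℕ → Prop)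
    (h : 0 < sSup {L : ℕ | p L ∧ ∃ (v : Fin n) (c : G.Walk v v), c.IsCycle ∧ c.length = L}) :
    p (sSup {L : ℕ | p L ∧ ∃ (v : Fin n) (c : G.Walk v v), c.IsCycle ∧ c.length = L}) ∧
      ∃ (v : Fin n) (c : G.Walk v v), c.IsCycle ∧
        c.length = sSup {L : ℕ | p L ∧ ∃ (v : Fin n) (c : G.Walk v v), c.IsCycle ∧ c.length = L} := by
  refine Nat.sSup_mem (s := {L | p L ∧ _}) ?_ (bddAbove_cycle_lengths G p)
  by_contra hne
  rw [Set.not_nonempty_iff_eq_empty] at hne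
  simp [hne] at h

/-- For every `ε > 0` there exists `K = K(ε) ∈ (0, ∞)` such that every graph `G` on `n`
vertices with `n ≥ 45K/ε⁴` and `δ(G) ≥ εn` contains a cycle of length `m` for every even
`m` with `4 ≤ m ≤ ec(G) − K` and every odd `m` with `K ≤ m ≤ oc(G) − K`. -/
theorem statement17 (ε : ℝ) (hε : 0 < ε) :
    ∃ K : ℝ, 0 < K ∧
      ∀ (n : ℕ) (G : SimpleGraph (Fin n)) [DecidableRel G.Adj],
        45 * K / ε ^ 4 ≤ (n : ℝ) → ε * (n : ℝ) ≤ (G.minDegree : ℝ) →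
        ∀ m : ℕ,
          ((Even m ∧ 4 ≤ m ∧ (m : ℝ) ≤ (evenCirc G : ℝ) - K) ∨
           (Odd m ∧ K ≤ (m : ℝ) ∧ (m : ℝ) ≤ (oddCirc G : ℝ) - K)) →
          ∃ (v : Fin n) (c : G.Walk v v), c.IsCycle ∧ c.length = m := by
  obtain ⟨d, hd⟩ := exists_nat_gt (1 / ε)
  have hd0 : 0 < d := by
    have : (0 : ℝ) < d := lt_trans (by positivity) hd
    exact_mod_cast this
  have hdε : 1 ≤ d * ε := by
    rw [div_lt_iff₀ hε] at hd
    exact hd.le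
  obtain ⟨K₁, H₁⟩ := exists_isCycle_of_le d hd0
  obtain ⟨K₂, H₂⟩ := exists_short_even_cycle d (K₁ + 1) hd0 (by omega)
  refine ⟨((K₁ + K₂ + 1 : ℕ) : ℝ), by positivity, ?_⟩
  intro n G _ hn hδ m hm
  have hn0 : 0 < n := by
    have : (0 : ℝ) < n := lt_of_lt_of_le (by positivity) hn
    exact_mod_cast this
  have : Nonempty (Fin n) := ⟨⟨0, hn0⟩⟩
  have hn0' : (0 : ℝ) < n := by exact_mod_cast hn0
  have hε1 : ε ≤ 1 := by
    have h1 : G.minDegree < Fintype.card (Fin n) := G.minDegree_lt_card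
    rw [Fintype.card_fin] at h1
    have h2 : (G.minDegree : ℝ) ≤ n := by exact_mod_cast h1.le
    nlinarith
  have hKn : K₁ + K₂ + 1 ≤ Fintype.card (Fin n) := by
    rw [Fintype.card_fin]
    rw [div_le_iff₀ (by positivity)] at hn
    have h1 : ε ^ 4 ≤ 1 := pow_le_one₀ hε.le hε1
    have h2 : (0 : ℝ) ≤ ((K₁ + K₂ + 1 : ℕ) : ℝ) := by positivity
    have : ((K₁ + K₂ + 1 : ℕ) : ℝ) ≤ n := by nlinarith
    exact_mod_cast this
  have hdeg : ∀ v, Fintype.card (Fin n) ≤ d * G.degree v := by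
    intro v
    rw [Fintype.card_fin]
    have h1 : (G.minDegree : ℝ) ≤ G.degree v := by exact_mod_cast G.minDegree_le_degree v
    have h2 : (0 : ℝ) < d := by exact_mod_cast hd0
    have : (n : ℝ) ≤ d * G.degree v := by
      calc (n : ℝ) ≤ d * ε * n := by nlinarith
        _ = d * (ε * n) := by ring
        _ ≤ d * G.degree v := by gcongr; exact hδ.trans h1
    exact_mod_cast this
  rcases hm with ⟨hm, h4, hmc⟩ | ⟨hm, hmK, hmc⟩
  · have hmc' : m + (K₁ + K₂ + 1) ≤ evenCirc G := by
      have : ((m + (K₁ + K₂ + 1) : ℕ) : ℝ) ≤ evenCirc G := by push_cast at hmc ⊢; linarith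
      exact_mod_cast this
    rcases le_or_gt m (2 * (K₁ + 1)) with hs | hs
    · exact H₂ _ G hdeg (by omega) m hm h4 hs
    · obtain ⟨he, v, c, hc, hlen⟩ := exists_isCycle_length_eq_sSup G Even
        (lt_of_lt_of_le (by omega) hmc')
      change c.length = evenCirc G at hlen
      change Even (evenCirc G) at he
      exact H₁ _ G hdeg (by omega) v c hc m (by omega) (by omega) (by rw [hlen]; exact hm.add he)
  · have hmc' : m + (K₁ + K₂ + 1) ≤ oddCirc G := by
      have : ((m + (K₁ + K₂ + 1) : ℕ) : ℝ) ≤ oddCirc G := by push_cast at hmc ⊢; linarith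
      exact_mod_cast this
    have hmK' : K₁ + K₂ + 1 ≤ m := by exact_mod_cast hmK
    obtain ⟨he, v, c, hc, hlen⟩ := exists_isCycle_length_eq_sSup G Odd
      (lt_of_lt_of_le (by omega) hmc')
    change c.length = oddCirc G at hlen
    change Odd (oddCirc G) at he
    exact H₁ _ G hdeg (by omega) v c hc m (by omega) (by omega) (by rw [hlen]; exact hm.add_odd he)
end
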